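/- Let ℓ, n ∈ ℕ. The Cartan matrix Cart_ℓ(n) is equivalent over ℤ to the diagonal matrix with diagonal entries r_ℓ(λ), where λ runs through the partitions λ = (λ_1,…,λ_t) of n such that ℓ does not divide λ_i for any i, and where r_ℓ(λ) = Π_{k=1}^∞ [ (ℓ/(ℓ,k))^{⌊m_k(λ)/ℓ⌋} · (⌊m_k(λ)/ℓ⌋!)_{π(ℓ,k)} ]. -/

import Mathlib

open scoped BigOperators
open Classical

noncomputable section

/-- The number of maps `f` from the (indexed) parts of `mu` to the parts of `lam` such that for
every part `lam_i` of `lam`, the sum of the parts of `mu` in the fibre `f⁻¹(i)` equals `lam_i`.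
This is `|𝓜_{λμ}|` and also the value of the permutation character `h_λ` on the class of cycle
type `μ`. -/
def Mcount (lam mu : Multiset ℕ) : ℕ :=
  Fintype.card {f : Fin (Multiset.card mu) → Fin (Multiset.card lam) //
    ∀ i : Fin (Multiset.card lam),
      (∑ j ∈ Finset.univ.filter (fun j => f j = i), (mu.sort (· ≤ ·)).getD j 0)
        = (lam.sort (· ≤ ·)).getD i 0}

/-- `z_λ = ∏_i i^{m_i(λ)} m_i(λ)!`. -/
def zMult (lam : Multiset ℕ) : ℕ :=
  ∏ i ∈ lam.toFinset, i ^ lam.count i * (lam.count i).factorial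

/-- The cycle type of a permutation of `Fin n`, as the multiset of parts of a partition of `n`
(including the parts equal to `1` corresponding to fixed points). -/
def cycM {n : ℕ} (g : Equiv.Perm (Fin n)) : Multiset ℕ :=
  g.cycleType + Multiset.replicate (n - g.support.card) 1

/-- The value of the irreducible character `s_λ` of the symmetric group on the conjugacy class
of cycle type `nu`, given by the Jacobi–Trudi determinant `s_λ = det(h_{λ_i - i + j})_{i,j}`,
where `h_α` has value `Mcount α ν` on the class of cycle type `ν`. -/
def sval (lam nu : Multiset ℕ) : ℚ :=
  let L := (lam.sort (· ≤ ·)).reverse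
  let l := Multiset.card lam
  ∑ σ : Equiv.Perm (Fin l),
    ((Equiv.Perm.sign σ : ℤ) : ℚ) *
      (if ∀ i : Fin l, (i : ℕ) ≤ L.getD i 0 + (σ i : ℕ) then
        (Mcount ((Multiset.map (fun i : Fin l => L.getD i 0 + (σ i : ℕ) - (i : ℕ))
            (Finset.univ.val : Multiset (Fin l))).filter (fun x => x ≠ 0)) nu : ℚ)
       else 0)

/-- The irreducible character of `S_n` labelled by the partition `lam`, as a class function on
the symmetric group `S_n = Perm (Fin n)`. -/
def sFun {n : ℕ} (lam : Nat.Partition n) : Equiv.Perm (Fin n) → ℚ :=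
  fun g => sval lam.parts (cycM g)

/-- The usual scalar product of class functions on a finite group:
`⟨f, h⟩ = |G|⁻¹ ∑_{g ∈ G} f(g) h(g⁻¹)`. -/
def sp {G : Type*} [Group G] [Fintype G] (f h : G → ℚ) : ℚ :=
  (Fintype.card G : ℚ)⁻¹ * ∑ g : G, f g * h g⁻¹

/-- Two square matrices over `ℚ` (with possibly differently labelled index sets) are equivalent
over `ℤ` if one is obtained from the other by left and right multiplication by matrices
invertible over `ℤ`. -/
def IntEquiv {T D : Type*} [Fintype T] [Fintype D] [DecidableEq T] [DecidableEq D]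
    (A : Matrix T T ℚ) (B : Matrix D D ℚ) : Prop :=
  ∃ (e : T ≃ D) (U V : Matrix T T ℤ), IsUnit U ∧ IsUnit V ∧
    (U.map (fun x : ℤ => (x : ℚ))) * A * (V.map (fun x : ℤ => (x : ℚ))) = B.submatrix e e

/-- The multiset of beta-numbers of a partition, displayed with `N` beads:
`β_i = λ_i + N - i` for `1 ≤ i ≤ N` (where `λ_i = 0` for `i > l(λ)`). -/
def betaSet (lam : Multiset ℕ) (N : ℕ) : Multiset ℕ :=
  Multiset.ofList ((List.range N).map
    (fun i => ((lam.sort (· ≤ ·)).reverse).getD i 0 + N - 1 - i))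

/-- Two partitions have the same `ℓ`-core if and only if their beta-sets (displayed with a
common number of beads) have equal multisets of residues modulo `ℓ`. -/
def sameCore (l : ℕ) (lam rho : Multiset ℕ) : Prop :=
  (betaSet lam (Multiset.card lam + Multiset.card rho)).map (· % l)
    = (betaSet rho (Multiset.card lam + Multiset.card rho)).map (· % l)

/-- `ρ` is an `ℓ`-core: no rim `ℓ`-hook can be removed, i.e. for every beta-number `b ≥ ℓ` of
`ρ`, `b - ℓ` is again a beta-number. -/
def IsCore (l : ℕ) (rho : Multiset ℕ) : Prop :=
  ∀ b ∈ betaSet rho (Multiset.card rho), l ≤ b → b - l ∈ betaSet rho (Multiset.card rho)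

/-- `g ∈ S_n` is `ℓ`-singular: its cycle decomposition contains a cycle of length divisible
by `ℓ`. -/
def IsSingular (l : ℕ) {n : ℕ} (g : Equiv.Perm (Fin n)) : Prop :=
  ∃ j ∈ cycM g, l ∣ j

/-- The `ℤ`-submodule of functions on `S_n` vanishing on all `ℓ`-singular elements. -/
def VanishSub (l n : ℕ) : Submodule ℤ (Equiv.Perm (Fin n) → ℚ) where
  carrier := {f | ∀ g, IsSingular l g → f g = 0}
  add_mem' := by
    intro f g hf hg x hx
    have h1 : f x = 0 := hf x hx
    have h2 : g x = 0 := hg x hx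
    simp [Pi.add_apply, h1, h2]
  zero_mem' := by intro x _; rfl
  smul_mem' := by
    intro c f hf x hx
    have h1 : f x = 0 := hf x hx
    simp [Pi.smul_apply, h1]

/-- `𝒞(S_n) = ℤ[Irr(S_n)]`: the `ℤ`-span of the irreducible characters of `S_n`. -/
def VirtCharS (n : ℕ) : Submodule ℤ (Equiv.Perm (Fin n) → ℚ) :=
  Submodule.span ℤ (Set.range (fun lam : Nat.Partition n => sFun lam))

/-- `𝒞(S_n, ρ) = ℤ[Irr(S_n, ρ)]`: the `ℤ`-span of the irreducible characters `s_λ` with the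
`ℓ`-core of `λ` equal to `ρ`. -/
def CBlock (l n : ℕ) (rho : Multiset ℕ) : Submodule ℤ (Equiv.Perm (Fin n) → ℚ) :=
  Submodule.span ℤ ((fun lam : Nat.Partition n => sFun lam) ''
    {lam | IsCore l rho ∧ sameCore l lam.parts rho})

/-- `k_π` : the greatest divisor of `k` all of whose prime divisors lie in `π`, applied below
with `k = ⌊m_k(λ)/ℓ⌋!`. -/
def piPart (m : ℕ) (pi : Finset ℕ) : ℕ :=
  ∏ q ∈ m.primeFactors.filter (fun q => q ∈ pi), q ^ (m.factorization q)

/-- `r_ℓ(λ) = ∏_{k ≥ 1} (ℓ/(ℓ,k))^{⌊m_k(λ)/ℓ⌋} ⌊m_k(λ)/ℓ⌋!_{π(ℓ,k)}` for a partition `λ` of `n`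
(all factors with `k > n` are equal to `1`). -/
def rEll (l n : ℕ) (lam : Multiset ℕ) : ℚ :=
  ∏ k ∈ (Finset.range (n + 1)).filter (fun k => 0 < k),
    (((l / Nat.gcd l k) ^ (lam.count k / l) *
      piPart (Nat.factorial (lam.count k / l)) (Nat.primeFactors (l / Nat.gcd l k)) : ℕ) : ℚ)

/-! ### Part A: equivalence of integer matrices from local data -/

/-- Equivalence of endomorphisms of `ℤ^T`. -/
def LEq {T : Type*} (f g : (T → ℤ) →ₗ[ℤ] (T → ℤ)) : Prop :=
  ∃ U V : (T → ℤ) ≃ₗ[ℤ] (T → ℤ), ∀ v, U (f (V v)) = g v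

lemma LEq.refl {T : Type*} (f : (T → ℤ) →ₗ[ℤ] (T → ℤ)) : LEq f f :=
  ⟨LinearEquiv.refl _ _, LinearEquiv.refl _ _, fun _ => rfl⟩

lemma LEq.symm {T : Type*} {f g : (T → ℤ) →ₗ[ℤ] (T → ℤ)} (h : LEq f g) : LEq g f := by
  obtain ⟨U, V, h⟩ := h
  refine ⟨U.symm, V.symm, fun v => ?_⟩
  rw [← h]; simp

lemma LEq.trans {T : Type*} {f g k : (T → ℤ) →ₗ[ℤ] (T → ℤ)} (h : LEq f g) (h' : LEq g k) :
    LEq f k := by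
  obtain ⟨U, V, h⟩ := h
  obtain ⟨U', V', h'⟩ := h'
  refine ⟨U.trans U', V'.trans V, fun v => ?_⟩
  simp [h, h']

/-- diagonal endomorphism -/
def dg {T : Type*} (a : T → ℤ) : (T → ℤ) →ₗ[ℤ] (T → ℤ) where
  toFun v i := a i * v i
  map_add' := by intro x y; ext i; simp [mul_add]
  map_smul' := by intro x y; ext i; simp; ring

/-- two by two block endomorphism -/
def blk {T : Type*} (s t : T) (x y z w : ℤ) : (T → ℤ) →ₗ[ℤ] (T → ℤ) where
  toFun v i := if i = s then x * v s + y * v t else if i = t then z * v s + w * v t else v i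
  map_add' := by intro u v; ext i; simp only [Pi.add_apply]; split_ifs <;> ring
  map_smul' := by
    intro u v; ext i; simp only [Pi.smul_apply, smul_eq_mul, RingHom.id_apply]; split_ifs <;> ring

def blkE {T : Type*} (s t : T) (hst : s ≠ t) (x y z w : ℤ) (h : x * w - y * z = 1) :
    (T → ℤ) ≃ₗ[ℤ] (T → ℤ) :=
  LinearEquiv.ofLinearMap (blk s t x y z w) (blk s t w (-y) (-z) x)
    (by
      ext v i
      have hts : t ≠ s := hst.symm
      have h1 : y * z = x * w - 1 := by linarith
      simp only [blk, LinearMap.comp_apply, LinearMap.coe_mk, AddHom.coe_mk, LinearMap.id_apply]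
      split_ifs with h1 h2
      · subst h1; simp [hts]; linear_combination v i * h
      · subst h2; simp [hts]; linear_combination v i * h
      · rfl)
    (by
      ext v i
      have hts : t ≠ s := hst.symm
      simp only [blk, LinearMap.comp_apply, LinearMap.coe_mk, AddHom.coe_mk, LinearMap.id_apply]
      split_ifs with h1 h2
      · subst h1; simp [hts]; linear_combination v i * h
      · subst h2; simp [hts]; linear_combination v i * h
      · rfl)

lemma blkE_apply {T : Type*} (s t : T) (hst : s ≠ t) (x y z w : ℤ) (h : x * w - y * z = 1)
    (v : T → ℤ) (i : T) : blkE s t hst x y z w h v i =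
      if i = s then x * v s + y * v t else if i = t then z * v s + w * v t else v i := rfl

lemma dg_two {T : Type*} (s t : T) (hst : s ≠ t) (a : T → ℤ) (c u v : ℤ) (h : IsCoprime u v) :
    LEq (dg (Function.update (Function.update a s (c * u)) t (c * v)))
      (dg (Function.update (Function.update a s c) t (c * u * v))) := by
  obtain ⟨x, y, h⟩ := h
  have hts : t ≠ s := hst.symm
  refine ⟨blkE s t hst 1 1 (-(y * v)) (x * u) (by linarith),
    blkE s t hst x (-v) y u (by linarith), fun w => ?_⟩
  ext i
  rw [blkE_apply]
  simp only [dg, LinearMap.coe_mk, AddHom.coe_mk, blkE_apply]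
  split_ifs with h1 h2
  · subst h1; simp [hst, hts]; linear_combination (c * w i) * h
  · subst h2; simp [hst, hts]; linear_combination (c * u * v * w i) * h
  · simp [h1, h2]

lemma dg_two' {T : Type*} (s t : T) (hst : s ≠ t) (a : T → ℤ) (A B A' B' : ℕ) (hA : A ≠ 0)
    (hg : Nat.gcd A B = Nat.gcd A' B') (hm : A * B = A' * B') :
    LEq (dg (Function.update (Function.update a s (A : ℤ)) t (B : ℤ)))
      (dg (Function.update (Function.update a s (A' : ℤ)) t (B' : ℤ))) := by
  set c := Nat.gcd A B with hc
  have hc0 : 0 < c := Nat.gcd_pos_of_pos_left _ (Nat.pos_of_ne_zero hA)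
  obtain ⟨u, hu⟩ : c ∣ A := Nat.gcd_dvd_left _ _
  obtain ⟨v, hv⟩ : c ∣ B := Nat.gcd_dvd_right _ _
  obtain ⟨u', hu'⟩ : c ∣ A' := hg ▸ Nat.gcd_dvd_left _ _
  obtain ⟨v', hv'⟩ : c ∣ B' := hg ▸ Nat.gcd_dvd_right _ _
  have h1 : Nat.Coprime u v := by
    have : c * Nat.gcd u v = c * 1 := by rw [← Nat.gcd_mul_left, ← hu, ← hv, ← hc, mul_one]
    exact Nat.eq_of_mul_eq_mul_left hc0 this
  have h2 : Nat.Coprime u' v' := by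
    have : c * Nat.gcd u' v' = c * 1 := by rw [← Nat.gcd_mul_left, ← hu', ← hv', ← hg, mul_one]
    exact Nat.eq_of_mul_eq_mul_left hc0 this
  have h3 : u * v = u' * v' := by
    have : (c * c) * (u * v) = (c * c) * (u' * v') := by
      calc _ = A * B := by rw [hu, hv]; ring
        _ = A' * B' := hm
        _ = _ := by rw [hu', hv']; ring
    exact Nat.eq_of_mul_eq_mul_left (by positivity) this
  have e1 := dg_two s t hst a c u v (Nat.isCoprime_iff_coprime.2 h1)
  have e2 := dg_two s t hst a c u' v' (Nat.isCoprime_iff_coprime.2 h2)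
  rw [hu, hv, hu', hv']
  push_cast
  refine e1.trans ?_
  have h4 : (c : ℤ) * u * v = c * u' * v' := by
    have : (u : ℤ) * v = u' * v' := by exact_mod_cast h3
    linear_combination (c : ℤ) * this
  rw [h4]
  exact e2.symm

/-- permute the `p`-parts -/
def pswap {T : Type*} (p : ℕ) (a : T → ℕ) (σ : Equiv.Perm T) : T → ℕ :=
  fun t => p ^ padicValNat p (a (σ t)) * (a t / p ^ padicValNat p (a t))

lemma gcd_pp (p : ℕ) (hp : p.Prime) (x y a b : ℕ) (ha : ¬ p ∣ a) (hb : ¬ p ∣ b) :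
    Nat.gcd (p ^ x * a) (p ^ y * b) = Nat.gcd (p ^ y * a) (p ^ x * b) := by
  have h1 : ∀ z, Nat.Coprime (p ^ z) a := fun z => ((Nat.Prime.coprime_iff_not_dvd hp).2 ha).pow_left z
  have h2 : ∀ z, Nat.Coprime (p ^ z) b := fun z => ((Nat.Prime.coprime_iff_not_dvd hp).2 hb).pow_left z
  have key : ∀ x y, Nat.gcd (p ^ x * a) (p ^ y * b) = Nat.gcd (p^x) (p^y) * Nat.gcd a b := by
    intro x y
    rw [Nat.Coprime.gcd_mul _ (h2 y), Nat.Coprime.gcd_mul_right_cancel, 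
      Nat.Coprime.gcd_mul_left_cancel]
    · exact h2 x
    · exact (h1 y).symm
  rw [key, key, Nat.gcd_comm (p^x)]

lemma pswap_ne {T : Type*} (p : ℕ) (hp : p.Prime) (a : T → ℕ) (ha : ∀ t, a t ≠ 0) (σ : Equiv.Perm T) (t : T) :
    pswap p a σ t ≠ 0 := by
  unfold pswap
  have := (Nat.ordCompl_pos p (ha t)).ne'
  rw [Nat.factorization_def _ hp] at this
  exact mul_ne_zero (pow_ne_zero _ hp.ne_zero) this

lemma not_dvd_oc (p : ℕ) (hp : p.Prime) (a : ℕ) (ha : a ≠ 0) : ¬ p ∣ a / p ^ padicValNat p a := by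
  have := Nat.not_dvd_ordCompl hp ha
  rwa [Nat.factorization_def _ hp] at this

lemma val_pm (p : ℕ) (hp : p.Prime) (x a : ℕ) (ha : ¬ p ∣ a) : padicValNat p (p ^ x * a) = x := by
  haveI := Fact.mk hp
  rw [padicValNat.mul (pow_ne_zero _ hp.ne_zero) (by rintro rfl; simp at ha), padicValNat.prime_pow,
    padicValNat.eq_zero_of_not_dvd ha, add_zero]

lemma pswap_self_val {T : Type*} (p : ℕ) (hp : p.Prime) (a : T → ℕ) (ha : ∀ t, a t ≠ 0) (σ : Equiv.Perm T) (t : T) :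
    padicValNat p (pswap p a σ t) = padicValNat p (a (σ t)) := val_pm p hp _ _ (not_dvd_oc p hp _ (ha t))

lemma oc_pm (p : ℕ) (hp : p.Prime) (x a : ℕ) (ha : ¬ p ∣ a) :
    (p ^ x * a) / p ^ padicValNat p (p ^ x * a) = a := by
  rw [val_pm p hp x a ha, Nat.mul_div_cancel_left _ (pow_pos hp.pos _)]

lemma pswap_mul {T : Type*} (p : ℕ) (hp : p.Prime) (a : T → ℕ) (ha : ∀ t, a t ≠ 0) (σ τ : Equiv.Perm T) :
    pswap p (pswap p a σ) τ = pswap p a (σ * τ) := by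
  ext t
  rw [pswap, pswap_self_val p hp a ha]
  conv_lhs => rw [show pswap p a σ t = p ^ padicValNat p (a (σ t)) * (a t / p ^ padicValNat p (a t)) from rfl]
  rw [oc_pm p hp _ _ (not_dvd_oc p hp _ (ha t))]
  rfl

lemma pswap_one {T : Type*} (p : ℕ) (hp : p.Prime) (a : T → ℕ) : pswap p a 1 = a := by
  ext t
  have := Nat.ordProj_mul_ordCompl_eq_self (a t) p
  rw [Nat.factorization_def _ hp] at this
  simpa [pswap] using this

lemma LEq_pswap {T : Type*} [Fintype T] (p : ℕ) (hp : p.Prime) (σ : Equiv.Perm T) :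
    ∀ (a : T → ℕ) (ha : ∀ t, a t ≠ 0), 
    LEq (dg fun t => (a t : ℤ)) (dg fun t => (pswap p a σ t : ℤ)) := by
  induction σ using Equiv.Perm.swap_induction_on with
  | one => intro a ha; rw [pswap_one p hp]; exact LEq.refl _
  | swap_mul f x y hxy ih =>
    intro a ha
    rw [← pswap_mul p hp a ha]
    refine LEq.trans ?_ (ih _ (pswap_ne p hp a ha _))
    have hyx := hxy.symm
    have h := dg_two' x y hxy (fun t => (a t : ℤ)) (a x) (a y) (pswap p a (Equiv.swap x y) x)
      (pswap p a (Equiv.swap x y) y) (ha x) ?_ ?_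
    · convert h using 2
      · ext t
        by_cases h2 : t = y
        · subst h2; simp
        by_cases h1 : t = x
        · subst h1; simp [hxy]
        simp [h1, h2]
      · ext t
        by_cases h2 : t = y
        · subst h2; simp
        by_cases h1 : t = x
        · subst h1; simp [hxy]
        simp only [h1, h2, Function.update_of_ne, ne_eq, not_false_eq_true]
        have := congrFun (pswap_one p hp a) t
        conv_rhs => rw [← this]
        simp [pswap, Equiv.swap_apply_of_ne_of_ne h1 h2]
    · have h3 := gcd_pp p hp (padicValNat p (a x)) (padicValNat p (a y)) _ _ (not_dvd_oc p hp _ (ha x))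
        (not_dvd_oc p hp _ (ha y))
      have e1 := congrFun (pswap_one p hp a) x
      have e2 := congrFun (pswap_one p hp a) y
      simp only [pswap, Equiv.Perm.coe_one, id_eq] at e1 e2
      rw [e1, e2] at h3
      rw [h3]
      simp [pswap]
    · have e1 := congrFun (pswap_one p hp a) x
      have e2 := congrFun (pswap_one p hp a) y
      simp only [pswap, Equiv.Perm.coe_one, id_eq] at e1 e2
      conv_lhs => rw [← e1, ← e2]
      simp [pswap]
      ring

lemma pswap_other {T : Type*} (p q : ℕ) (hp : p.Prime) (hq : q.Prime) (hpq : p ≠ q) (a : T → ℕ) (ha : ∀ t, a t ≠ 0)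
    (σ : Equiv.Perm T) (t : T) : padicValNat q (pswap p a σ t) = padicValNat q (a t) := by
  haveI := Fact.mk hq
  haveI := Fact.mk hp
  have h1 : ∀ x, padicValNat q (p ^ x) = 0 := fun x => by
    apply padicValNat.eq_zero_of_not_dvd
    intro h
    exact hpq ((Nat.prime_dvd_prime_iff_eq hq hp).1 (hq.dvd_of_dvd_pow h)).symm
  have h2 : a t / p ^ padicValNat p (a t) ≠ 0 := by
    intro h
    have := not_dvd_oc p hp _ (ha t)
    simp [h] at this
  have e1 := congrFun (pswap_one p hp a) t
  conv_rhs => rw [← e1]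
  unfold pswap
  rw [padicValNat.mul (pow_ne_zero _ hp.ne_zero) h2, padicValNat.mul (pow_ne_zero _ hp.ne_zero) h2, h1, h1]

lemma LEq_of_vals {T : Type*} [Fintype T] (d : T → ℕ) (hd : ∀ t, d t ≠ 0) (S : Finset ℕ) :
    ∀ (a : T → ℕ) (ha : ∀ t, a t ≠ 0) 
    (h : ∀ p, p.Prime → ∃ σ : Equiv.Perm T, ∀ t, padicValNat p (a (σ t)) = padicValNat p (d t))
    (hS : ∀ p, p.Prime → p ∉ S → ∀ t, padicValNat p (a t) = padicValNat p (d t)),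
    LEq (dg fun t => (a t : ℤ)) (dg fun t => (d t : ℤ)) := by
  induction S using Finset.induction_on with
  | empty =>
    intro a ha h hS
    have : a = d := by
      ext t
      refine Nat.eq_of_factorization_eq (ha t) (hd t) fun p => ?_
      by_cases hp : p.Prime
      · rw [Nat.factorization_def _ hp, Nat.factorization_def _ hp]
        exact hS p hp (by simp) t
      · simp [Nat.factorization_eq_zero_of_not_prime _ hp]
    rw [this]
    exact LEq.refl _
  | insert p S hpS ih =>
    intro a ha h hS
    by_cases hp : p.Prime
    · obtain ⟨σ, hσ⟩ := h p hp
      refine (LEq_pswap p hp σ a ha).trans (ih _ (pswap_ne p hp a ha σ) ?_ ?_)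
      · intro q hq
        by_cases hpq : p = q
        · subst hpq
          exact ⟨1, fun t => by simp [pswap_self_val p hp a ha, hσ]⟩
        · obtain ⟨τ, hτ⟩ := h q hq
          exact ⟨τ, fun t => by rw [pswap_other p q hp hq hpq a ha, hτ]⟩
      · intro q hq hqS t
        by_cases hpq : p = q
        · subst hpq
          rw [pswap_self_val p hp a ha, hσ]
        · rw [pswap_other p q hp hq hpq a ha]
          exact hS q hq (by simp [hqS, Ne.symm hpq]) t
    · refine ih a ha h fun q hq hqS => hS q hq ?_
      simp only [Finset.mem_insert, not_or]
      exact ⟨fun h => hp (h ▸ hq), hqS⟩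

lemma exists_perm_unit {T : Type*} [Fintype T] (p : ℕ) [hp : Fact p.Prime] (U : Matrix T T ℚ)
    (hU : ∀ s t, padicNorm p (U s t) ≤ 1) (hd : padicNorm p U.det = 1) :
    ∃ σ : Equiv.Perm T, ∀ i, padicNorm p (U (σ i) i) = 1 := by
  by_contra! hcon
  have : padicNorm p U.det < 1 := by
    rw [Matrix.det_apply]
    refine padicNorm.sum_lt' (fun σ _ => ?_) one_pos
    obtain ⟨i, hi⟩ := hcon σ
    have h1 : padicNorm p (∏ i, U (σ i) i) < 1 := by
      have : padicNorm p (∏ i, U (σ i) i) = ∏ i, padicNorm p (U (σ i) i) := by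
        induction (Finset.univ : Finset T) using Finset.induction_on with
        | empty => simp
        | insert a s ha ih => rw [Finset.prod_insert ha, Finset.prod_insert ha, padicNorm.mul, ih]
      rw [this, ← Finset.mul_prod_erase _ _ (Finset.mem_univ i)]
      have h2 : ∏ x ∈ Finset.univ.erase i, padicNorm p (U (σ x) x) ≤ 1 :=
        Finset.prod_le_one (fun _ _ => padicNorm.nonneg _) (fun _ _ => hU _ _)
      have h3 : padicNorm p (U (σ i) i) < 1 := lt_of_le_of_ne (hU _ _) hi
      have h4 := padicNorm.nonneg (p := p) (U (σ i) i)
      calc _ ≤ padicNorm p (U (σ i) i) * 1 := mul_le_mul_of_nonneg_left h2 h4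
        _ < 1 := by linarith
    rcases Int.units_eq_one_or (Equiv.Perm.sign σ) with h | h
    · simpa [h] using h1
    · simpa [h] using h1
  linarith

lemma exists_perm_norm {T : Type*} [Fintype T] (p : ℕ) [hp : Fact p.Prime] (U V : Matrix T T ℚ)
    (hU : ∀ s t, padicNorm p (U s t) ≤ 1) (hdU : padicNorm p U.det = 1)
    (hV : ∀ s t, padicNorm p (V s t) ≤ 1) (hdV : padicNorm p V.det = 1) (a b : T → ℚ)
    (ha : ∀ t, a t ≠ 0) (hb : ∀ t, b t ≠ 0)
    (h : ∀ s t, U s t * a t = b s * V s t) :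
    ∃ σ : Equiv.Perm T, ∀ t, padicNorm p (a t) = padicNorm p (b (σ t)) := by
  obtain ⟨σ, hσ⟩ := exists_perm_unit p U hU hdU
  obtain ⟨τ, hτ⟩ := exists_perm_unit p V.transpose (fun s t => hV t s) (by rwa [Matrix.det_transpose])
  have h1 : ∀ i, padicNorm p (a i) ≤ padicNorm p (b (σ i)) := by
    intro i
    have := congrArg (padicNorm p) (h (σ i) i)
    rw [padicNorm.mul, padicNorm.mul, hσ, one_mul] at this
    rw [this]
    exact mul_le_of_le_one_right (padicNorm.nonneg _) (hV _ _)
  have h2 : ∀ i, padicNorm p (b i) ≤ padicNorm p (a (τ i)) := by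
    intro i
    have := congrArg (padicNorm p) (h i (τ i))
    have h3 := hτ i
    rw [Matrix.transpose_apply] at h3
    rw [padicNorm.mul, padicNorm.mul, h3, mul_one] at this
    rw [← this]
    exact mul_le_of_le_one_left (padicNorm.nonneg _) (hU _ _)
  have pos : ∀ x : ℚ, x ≠ 0 → 0 < padicNorm p x := fun x hx =>
    lt_of_le_of_ne (padicNorm.nonneg _) (padicNorm.nonzero hx).symm
  refine ⟨σ, ?_⟩
  by_contra! hcon
  obtain ⟨i, hi⟩ := hcon
  have h3 : ∏ i, padicNorm p (a i) < ∏ i, padicNorm p (b (σ i)) :=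
    Finset.prod_lt_prod (fun i _ => pos _ (ha i)) (fun i _ => h1 i) ⟨i, Finset.mem_univ _, lt_of_le_of_ne (h1 i) hi⟩
  have h4 : ∏ i, padicNorm p (b i) ≤ ∏ i, padicNorm p (a (τ i)) :=
    Finset.prod_le_prod (fun i _ => padicNorm.nonneg _) (fun i _ => h2 i)
  rw [Equiv.prod_comp σ (fun i => padicNorm p (b i))] at h3
  rw [Equiv.prod_comp τ (fun i => padicNorm p (a i))] at h4
  linarith

lemma exists_snf {T : Type*} [Fintype T] (G : Matrix T T ℤ) (hG : G.det ≠ 0) :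
    ∃ a : T → ℤ, LEq (Matrix.toLin' G) (dg a) := by
  set f := Matrix.toLin' G with hf
  have hinj : Function.Injective f := by
    rw [← LinearMap.ker_eq_bot]
    rw [LinearMap.ker_eq_bot']
    intro v hv
    exact Matrix.eq_zero_of_mulVec_eq_zero hG (by simpa [hf] using hv)
  have hrank : Module.finrank ℤ (LinearMap.range f) = Module.finrank ℤ (T → ℤ) :=
    (LinearEquiv.ofInjective f hinj).finrank_eq.symm
  obtain ⟨b', a, ab', h⟩ := Submodule.exists_smith_normal_form_of_rank_eq (Pi.basisFun ℤ T) hrank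
  refine ⟨a, b'.equivFun, ((ab'.equivFun.symm).trans (LinearEquiv.ofInjective f hinj).symm), fun v => ?_⟩
  have h1 : f (((ab'.equivFun.symm).trans (LinearEquiv.ofInjective f hinj).symm) v) = ab'.equivFun.symm v := by
    have := LinearEquiv.apply_symm_apply (LinearEquiv.ofInjective f hinj) (ab'.equivFun.symm v)
    exact congrArg Subtype.val this
  rw [h1]
  have h2 : ((ab'.equivFun.symm v : LinearMap.range f) : T → ℤ) = b'.equivFun.symm (dg a v) := by
    rw [Module.Basis.equivFun_symm_apply, Module.Basis.equivFun_symm_apply]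
    simp only [AddSubmonoidClass.coe_finsetSum, Submodule.coe_smul, h, dg, LinearMap.coe_mk, AddHom.coe_mk]
    refine Finset.sum_congr rfl fun i _ => ?_
    rw [smul_smul, mul_comm]
  rw [h2]; exact b'.equivFun.apply_symm_apply _

lemma isUnit_toMatrix {T : Type*} [Fintype T] (U : (T → ℤ) ≃ₗ[ℤ] (T → ℤ)) :
    IsUnit (LinearMap.toMatrix' (U : (T → ℤ) →ₗ[ℤ] (T → ℤ))) := by
  rw [Matrix.isUnit_iff_isUnit_det]
  refine IsUnit.of_mul_eq_one (LinearMap.toMatrix' (U.symm : (T → ℤ) →ₗ[ℤ] (T → ℤ))).det ?_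
  rw [← Matrix.det_mul, ← LinearMap.toMatrix'_comp]
  simp

lemma LEq_mat {T : Type*} [Fintype T] (G : Matrix T T ℤ) (a : T → ℤ) (h : LEq (Matrix.toLin' G) (dg a)) :
    ∃ U V : Matrix T T ℤ, IsUnit U ∧ IsUnit V ∧ U * G * V = Matrix.diagonal a := by
  obtain ⟨U, V, h⟩ := h
  refine ⟨_, _, isUnit_toMatrix U, isUnit_toMatrix V, ?_⟩
  have : (U : (T → ℤ) →ₗ[ℤ] (T → ℤ)) ∘ₗ (Matrix.toLin' G) ∘ₗ (V : (T → ℤ) →ₗ[ℤ] (T → ℤ)) = dg a := by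
    refine LinearMap.ext fun v => ?_
    exact h v
  have h2 := congrArg LinearMap.toMatrix' this
  rw [LinearMap.toMatrix'_comp, LinearMap.toMatrix'_comp, LinearMap.toMatrix'_toLin'] at h2
  rw [mul_assoc, h2]
  have h3 : dg a = Matrix.toLin' (Matrix.diagonal a) := by
    refine LinearMap.ext fun v => ?_
    ext i
    simp [dg, Matrix.mulVec_diagonal]
  rw [h3, LinearMap.toMatrix'_toLin']

lemma norm_det_of_isUnit {T : Type*} [Fintype T] (p : ℕ) [hp : Fact p.Prime] (U : Matrix T T ℤ) (hU : IsUnit U) :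
    padicNorm p (U.map (fun x : ℤ => (x : ℚ))).det = 1 := by
  have h1 : (U.map (fun x : ℤ => (x : ℚ))).det = ((U.det : ℤ) : ℚ) := by
    have := RingHom.map_det (Int.castRingHom ℚ) U
    simpa using this.symm
  rw [h1]
  rw [Matrix.isUnit_iff_isUnit_det, Int.isUnit_iff] at hU
  rcases hU with h | h <;> simp [h]

lemma norm_mul_int {T : Type*} [Fintype T] (p : ℕ) [hp : Fact p.Prime] (U V : Matrix T T ℚ)
    (hU : ∀ s t, padicNorm p (U s t) ≤ 1) (hV : ∀ s t, padicNorm p (V s t) ≤ 1) (s t : T) :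
    padicNorm p ((U * V) s t) ≤ 1 := by
  rw [Matrix.mul_apply]
  refine padicNorm.sum_le' (fun i _ => ?_) zero_le_one
  rw [padicNorm.mul]
  exact mul_le_one₀ (hU _ _) (padicNorm.nonneg _) (hV _ _)

lemma norm_eq_val (p : ℕ) [hp : Fact p.Prime] (a b : ℕ) (ha : a ≠ 0) (hb : b ≠ 0) (h : padicNorm p (a : ℚ) = padicNorm p (b : ℚ)) :
    padicValNat p a = padicValNat p b := by
  rw [padicNorm.eq_zpow_of_nonzero (by exact_mod_cast ha), padicNorm.eq_zpow_of_nonzero (by exact_mod_cast hb)] at h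
  have hp1 : (1 : ℚ) < p := by exact_mod_cast hp.out.one_lt
  have := zpow_right_injective₀ (by linarith) hp1.ne' h
  simpa using this

theorem partA {T D : Type*} [Fintype T] [Fintype D] (G0 : Matrix T T ℤ) (d : D → ℕ) (hd : ∀ x, d x ≠ 0)
    (h : ∀ p : ℕ, p.Prime → ∃ (e : T ≃ D) (b : T → ℚ) (U V : Matrix T T ℚ),
      (∀ s t, padicNorm p (U s t) ≤ 1) ∧ (∀ s t, padicNorm p (V s t) ≤ 1) ∧
      padicNorm p U.det = 1 ∧ padicNorm p V.det = 1 ∧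
      (∀ s, padicNorm p (b s) = padicNorm p (d (e s) : ℚ)) ∧
      U * (G0.map (fun x : ℤ => (x : ℚ))) = Matrix.diagonal b * V) :
    IntEquiv (G0.map (fun x : ℤ => (x : ℚ))) (Matrix.diagonal (fun x => (d x : ℚ))) := by
  have hb0 : ∀ p : ℕ, p.Prime → ∀ (x : ℚ) (n : ℕ), n ≠ 0 → padicNorm p x = padicNorm p (n : ℚ) → x ≠ 0 := by
    intro p hp x n hn h hx
    haveI := Fact.mk hp
    rw [hx, padicNorm.zero] at h
    exact padicNorm.nonzero (p := p) (q := (n : ℚ)) (by exact_mod_cast hn) h.symm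
  have hG : G0.det ≠ 0 := by
    obtain ⟨e, b, U, V, hU, hV, hdU, hdV, hb, he⟩ := h 2 Nat.prime_two
    intro h0
    have h1 := congrArg Matrix.det he
    have h2 : (G0.map (fun x : ℤ => (x : ℚ))).det = 0 := by
      have := RingHom.map_det (Int.castRingHom ℚ) G0
      rw [h0] at this
      simpa using this.symm
    rw [Matrix.det_mul, Matrix.det_mul, h2, mul_zero, Matrix.det_diagonal] at h1
    have h3 : V.det ≠ 0 := by intro h; rw [h] at hdV; simp at hdV
    have h4 : ∏ i, b i ≠ 0 := Finset.prod_ne_zero_iff.2 fun i _ => hb0 2 Nat.prime_two _ _ (hd _) (hb i)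
    exact mul_ne_zero h4 h3 h1.symm
  obtain ⟨e0, _⟩ := h 2 Nat.prime_two
  obtain ⟨a, ha⟩ := exists_snf G0 hG
  obtain ⟨U0, V0, hU0, hV0, h0⟩ := LEq_mat G0 a ha
  have ha0 : ∀ t, a t ≠ 0 := by
    intro t ht
    have h1 := congrArg Matrix.det h0
    rw [Matrix.det_diagonal, Finset.prod_eq_zero (Finset.mem_univ t) ht, Matrix.det_mul, Matrix.det_mul] at h1
    rw [Matrix.isUnit_iff_isUnit_det] at hU0 hV0
    exact mul_ne_zero (mul_ne_zero hU0.ne_zero hG) hV0.ne_zero h1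
  -- make `a` positive
  have habs : LEq (Matrix.toLin' G0) (dg fun t => ((a t).natAbs : ℤ)) := by
    refine ha.trans ⟨LinearEquiv.ofLinearMap (dg fun t => (a t).sign) (dg fun t => (a t).sign) ?_ ?_, LinearEquiv.refl _ _, ?_⟩
    · refine LinearMap.ext fun v => ?_
      ext i
      have : (a i).sign * (a i).sign = 1 := by
        rcases lt_or_gt_of_ne (ha0 i) with h | h <;> simp [Int.sign_eq_one_of_pos, Int.sign_eq_neg_one_of_neg, h]
      simp [dg, ← mul_assoc, this]
    · refine LinearMap.ext fun v => ?_
      ext i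
      have : (a i).sign * (a i).sign = 1 := by
        rcases lt_or_gt_of_ne (ha0 i) with h | h <;> simp [Int.sign_eq_one_of_pos, Int.sign_eq_neg_one_of_neg, h]
      simp [dg, ← mul_assoc, this]
    · intro v
      ext i
      simp [dg, ← mul_assoc, Int.sign_mul_self_eq_abs]
  have hmain : LEq (Matrix.toLin' G0) (dg fun t => ((d (e0 t) : ℕ) : ℤ)) := by
    refine habs.trans (LEq_of_vals (fun t => d (e0 t)) (fun t => hd _) 
      ((Finset.univ.biUnion fun t => (a t).natAbs.primeFactors) ∪ 
       (Finset.univ.biUnion fun t => (d (e0 t)).primeFactors)) (fun t => (a t).natAbs) 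
       (fun t => Int.natAbs_ne_zero.2 (ha0 t)) ?_ ?_)
    · intro p hp
      haveI := Fact.mk hp
      obtain ⟨e, b, U, V, hU, hV, hdU, hdV, hb, he⟩ := h p hp
      -- G0 = U0⁻¹ diag V0⁻¹
      obtain ⟨U0i, hU0i⟩ := hU0.exists_left_inv
      obtain ⟨V0i, hV0i⟩ := hV0.exists_right_inv
      have hU0u : IsUnit U0i := ⟨⟨U0i, U0, hU0i, mul_eq_one_comm.1 hU0i⟩, rfl⟩
      set c := fun M : Matrix T T ℤ => M.map (fun x : ℤ => (x : ℚ)) with hc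
      have cmul : ∀ M N, c (M * N) = c M * c N := fun M N => 
        (Matrix.map_mul (f := Int.castRingHom ℚ))
      have hcint : ∀ M s t, padicNorm p (c M s t) ≤ 1 := fun M s t => padicNorm.of_int _
      have h1 : U * c U0i * Matrix.diagonal (fun t => (a t : ℚ)) = Matrix.diagonal b * (V * c V0) := by
        have : G0 * V0 = U0i * Matrix.diagonal a := by
          rw [← h0, ← mul_assoc, ← mul_assoc, hU0i, one_mul]
        have h2 : c (Matrix.diagonal a) = Matrix.diagonal (fun t => (a t : ℚ)) := by
          simp [hc, Matrix.diagonal_map]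
        rw [← h2, mul_assoc, ← cmul, ← this, cmul, ← mul_assoc, he, mul_assoc]
      obtain ⟨σ, hσ⟩ := exists_perm_norm p (U * c U0i) (V * c V0) 
        (norm_mul_int p _ _ hU (hcint _)) 
        (by rw [Matrix.det_mul, padicNorm.mul, hdU, norm_det_of_isUnit p _ hU0u, one_mul])
        (norm_mul_int p _ _ hV (hcint _))
        (by rw [Matrix.det_mul, padicNorm.mul, hdV, norm_det_of_isUnit p _ hV0, one_mul])
        (fun t => (a t : ℚ)) b (fun t => by exact_mod_cast ha0 t) (fun t => hb0 p hp _ _ (hd _) (hb t))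
        (fun s t => by
          have := congrFun (congrFun h1 s) t
          simpa [Matrix.mul_diagonal, Matrix.diagonal_mul] using this)
      refine ⟨(e0.trans e.symm).trans σ.symm, fun t => ?_⟩
      refine norm_eq_val p _ _ (Int.natAbs_ne_zero.2 (ha0 _)) (hd _) ?_
      have h5 := hσ (((e0.trans e.symm).trans σ.symm) t)
      rw [hb] at h5
      simp only [Equiv.trans_apply, Equiv.apply_symm_apply] at h5 ⊢
      rw [← h5]
      rcases Int.natAbs_eq (a (σ.symm (e.symm (e0 t)))) with h | h
      · rw [← Int.cast_natCast, ← h]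
      · conv_rhs => rw [h]
        simp
    · intro p hp hS t
      simp only [Finset.mem_union, Finset.mem_biUnion, Finset.mem_univ, true_and, not_or, not_exists] at hS
      rw [padicValNat.eq_zero_of_not_dvd, padicValNat.eq_zero_of_not_dvd]
      · intro hd1; exact hS.2 t (Nat.mem_primeFactors.2 ⟨hp, hd1, hd _⟩)
      · intro hd1; exact hS.1 t (Nat.mem_primeFactors.2 ⟨hp, hd1, Int.natAbs_ne_zero.2 (ha0 _)⟩)
  obtain ⟨U, V, hU, hV, hUV⟩ := LEq_mat G0 _ hmain
  refine ⟨e0, U, V, hU, hV, ?_⟩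
  have := congrArg (fun M : Matrix T T ℤ => M.map (Int.castRingHom ℚ)) hUV
  simp only [Matrix.map_mul] at this
  refine Eq.trans ?_ (this.trans ?_)
  · rfl
  · rw [Matrix.submatrix_diagonal_equiv, Matrix.diagonal_map (by simp)]
    congr 1

/-! ### Part B: the core divisibility lemma -/

section coreB

/-- `a ∈ p^k R` -/
def Cg {U : Type*} [CommRing U] (R : Subring U) (p k : ℕ) (a : U) : Prop := ∃ c ∈ R, a = (p : U) ^ k * c

variable {U : Type*} [CommRing U] {R P : Subring U} {p k k' : ℕ} {a b : U}

lemma Cg.zero : Cg R p k 0 := ⟨0, R.zero_mem, by simp⟩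

lemma Cg.add (ha : Cg R p k a) (hb : Cg R p k b) : Cg R p k (a + b) := by
  obtain ⟨c, hc, rfl⟩ := ha
  obtain ⟨d, hd, rfl⟩ := hb
  exact ⟨c + d, R.add_mem hc hd, by ring⟩

lemma Cg.neg (ha : Cg R p k a) : Cg R p k (-a) := by
  obtain ⟨c, hc, rfl⟩ := ha
  exact ⟨-c, R.neg_mem hc, by ring⟩

lemma Cg.sub (ha : Cg R p k a) (hb : Cg R p k b) : Cg R p k (a - b) := by
  rw [sub_eq_add_neg]; exact ha.add hb.neg

lemma Cg.mul (ha : Cg R p k a) (hb : Cg R p k' b) : Cg R p (k + k') (a * b) := by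
  obtain ⟨c, hc, rfl⟩ := ha
  obtain ⟨d, hd, rfl⟩ := hb
  exact ⟨c * d, R.mul_mem hc hd, by ring⟩

lemma Cg.of_mem (ha : a ∈ R) : Cg R p 0 a := ⟨a, ha, by simp⟩

lemma Cg.mem (ha : Cg R p k a) : a ∈ R := by
  obtain ⟨c, hc, rfl⟩ := ha
  exact R.mul_mem (R.pow_mem (natCast_mem R p) k) hc

lemma Cg.mono (ha : Cg R p k a) (h : k' ≤ k) : Cg R p k' a := by
  obtain ⟨c, hc, rfl⟩ := ha
  obtain ⟨d, rfl⟩ := Nat.exists_eq_add_of_le h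
  exact ⟨(p : U) ^ d * c, R.mul_mem (R.pow_mem (natCast_mem R p) d) hc, by ring⟩

lemma Cg.mul_left (ha : Cg R p k a) (hb : b ∈ R) : Cg R p k (b * a) := by
  simpa using (Cg.of_mem (p := p) hb).mul ha

lemma Cg.mul_right (ha : Cg R p k a) (hb : b ∈ R) : Cg R p k (a * b) := by
  simpa using ha.mul (Cg.of_mem (p := p) hb)

lemma Cg.pow (ha : Cg R p k a) (n : ℕ) : Cg R p (k * n) (a ^ n) := by
  obtain ⟨c, hc, rfl⟩ := ha
  exact ⟨c ^ n, R.pow_mem hc n, by ring⟩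

lemma Cg.ppow_mul (ha : Cg R p k a) (n : ℕ) : Cg R p (n + k) ((p : U) ^ n * a) := by
  obtain ⟨c, hc, rfl⟩ := ha
  exact ⟨c, hc, by ring⟩

lemma Cg.sum {ι : Type*} (s : Finset ι) (f : ι → U) (h : ∀ i ∈ s, Cg R p k (f i)) :
    Cg R p k (∑ i ∈ s, f i) := by
  induction s using Finset.induction_on with
  | empty => simpa using Cg.zero
  | insert a s ha ih =>
    rw [Finset.sum_insert ha]
    exact (h a (by simp)).add (ih fun i hi => h i (by simp [hi]))

lemma Cg.le (h : P ≤ R) (ha : Cg P p k a) : Cg R p k a := by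
  obtain ⟨c, hc, rfl⟩ := ha
  exact ⟨c, h hc, rfl⟩

lemma Cg.mul_sub {c d : U} (ha : Cg R p k (a - b)) (hc : Cg R p k (c - d)) (hb : b ∈ R) (hcR : c ∈ R) :
    Cg R p k (a * c - b * d) := by
  have : a * c - b * d = (a - b) * c + b * (c - d) := by ring
  rw [this]
  exact (ha.mul_right hcR).add (hc.mul_left hb)

lemma Cg.pow_sub (ha : Cg R p k (a - b)) (haR : a ∈ R) (hbR : b ∈ R) (n : ℕ) :
    Cg R p k (a ^ n - b ^ n) := by
  induction n with
  | zero => simpa using Cg.zero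
  | succ n ih =>
    rw [pow_succ, pow_succ]
    exact Cg.mul_sub ih ha (R.pow_mem hbR n) haR

lemma Cg.pow_p (hp : p.Prime) (hk : 1 ≤ k) (ha : Cg R p k (a - b)) (hb : b ∈ R) :
    Cg R p (k + 1) (a ^ p - b ^ p) := by
  obtain ⟨c, hc, h⟩ := ha
  have hab : a = b + (p : U) ^ k * c := by rw [← h]; ring
  have h1 := add_pow_prime_eq (R := R) hp ⟨b, hb⟩ (((p : R)) ^ k * ⟨c, hc⟩)
  have h2 := congrArg (R.subtype) h1
  simp only [map_add, map_mul, map_pow, Subring.subtype_apply, map_natCast] at h2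
  rw [hab, h2]
  have h3 : ∀ z : R, b ^ p + ((p : U) ^ k * c) ^ p + (p : U) * (b * ((p : U) ^ k * c) * (z : U)) - b ^ p
     = ((p : U) ^ k * c) ^ p + (p : U) * (b * ((p : U) ^ k * c) * (z : U)) := fun z => by ring
  have h4 : ∀ z : R, Cg R p (k + 1) (((p : U) ^ k * c) ^ p + (p : U) * (b * ((p : U) ^ k * c) * (z : U))) := by
    intro z
    refine Cg.add ?_ ?_
    · have : Cg R p k ((p : U) ^ k * c) := ⟨c, hc, rfl⟩
      refine (this.pow p).mono ?_
      have := hp.two_le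
      nlinarith
    · exact ⟨b * c * z, R.mul_mem (R.mul_mem hb hc) z.2, by ring⟩
  convert h4 _ using 1
  rotate_left
  · exact ∑ x ∈ Finset.Ioo 0 p, ⟨b, hb⟩ ^ (x - 1) * ((p : R) ^ k * ⟨c, hc⟩) ^ (p - x - 1) * (((p.choose x) / p : ℕ) : R)
  · simp only [← Subring.subtype_apply, map_sum, map_mul, map_pow, map_natCast]
    ring_nf

end coreB

section coreB2

variable {U : Type*} [CommRing U] {R P : Subring U} {p : ℕ} {ip : U}

lemma pcancel (hip : (p : U) * ip = 1) (n : ℕ) {a b : U} (h : (p : U) ^ n * a = (p : U) ^ n * b) : a = b := by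
  have h1 : ip ^ n * (p : U) ^ n = 1 := by rw [← mul_pow, mul_comm, hip, one_pow]
  calc a = ip ^ n * ((p : U) ^ n * a) := by rw [← mul_assoc, h1, one_mul]
    _ = b := by rw [h, ← mul_assoc, h1, one_mul]

lemma Cg.cancel (hip : (p : U) * ip = 1) {n k : ℕ} {a : U} (h : Cg R p (n + k) ((p : U) ^ n * a)) : Cg R p k a := by
  obtain ⟨c, hc, h⟩ := h
  refine ⟨c, hc, pcancel hip n ?_⟩
  rw [h]; ring

/-- iterated `p`-derivation-like differences -/
def Yf (p : ℕ) (ip : U) (Y : ℕ → U) : ℕ → ℕ → U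
  | 0, i => Y i
  | s + 1, i => ip * (Yf p ip Y s (i + 1) - (Yf p ip Y s i) ^ p)

lemma p_Yf (hip : (p : U) * ip = 1) (Y : ℕ → U) (s i : ℕ) :
    (p : U) * Yf p ip Y (s + 1) i = Yf p ip Y s (i + 1) - (Yf p ip Y s i) ^ p := by
  rw [Yf, ← mul_assoc, hip, one_mul]

lemma Yf_prop (hp : p.Prime) (hip : (p : U) * ip = 1) (φ : U →+* U) (hφR : ∀ a ∈ R, φ a ∈ R)
    (hφ : ∀ a ∈ R, Cg R p 1 (φ a - a ^ p)) (Y : ℕ → U) (hY : ∀ i, Y i ∈ R)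
    (hY1 : ∀ i, Cg R p (i + 1) (Y (i + 1) - φ (Y i))) (s : ℕ) :
    ∀ i, Yf p ip Y s i ∈ R ∧ Cg R p (i + 1) (Yf p ip Y s (i + 1) - φ (Yf p ip Y s i)) := by
  induction s with
  | zero => exact fun i => ⟨hY i, hY1 i⟩
  | succ s ih =>
    intro i
    have h1 : ∀ i, Yf p ip Y (s + 1) i ∈ R := by
      intro i
      have h2 : Cg R p 1 ((p : U) ^ 1 * Yf p ip Y (s + 1) i) := by
        rw [pow_one, p_Yf hip]
        have : Yf p ip Y s (i + 1) - (Yf p ip Y s i) ^ p = (Yf p ip Y s (i + 1) - φ (Yf p ip Y s i)) +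
          (φ (Yf p ip Y s i) - (Yf p ip Y s i) ^ p) := by ring
        rw [this]
        exact ((ih i).2.mono (by omega)).add (hφ _ (ih i).1)
      exact (Cg.cancel hip (k := 0) h2).mem
    refine ⟨h1 i, ?_⟩
    refine Cg.cancel hip (n := 1) ?_
    have : (p : U) ^ 1 * (Yf p ip Y (s + 1) (i + 1) - φ (Yf p ip Y (s + 1) i)) =
        (p : U) * Yf p ip Y (s + 1) (i + 1) - φ ((p : U) * Yf p ip Y (s + 1) i) := by
      rw [map_mul, map_natCast]; ring
    rw [this, p_Yf hip, p_Yf hip, map_sub, map_pow]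
    have h3 := (ih (i + 1)).2
    have h4 := Cg.pow_p hp (by omega) (ih i).2 (hφR _ (ih i).1)
    have : Yf p ip Y s (i + 1 + 1) - Yf p ip Y s (i + 1) ^ p - (φ (Yf p ip Y s (i + 1)) - φ (Yf p ip Y s i) ^ p)
      = (Yf p ip Y s (i + 1 + 1) - φ (Yf p ip Y s (i + 1))) - (Yf p ip Y s (i + 1) ^ p - φ (Yf p ip Y s i) ^ p) := by ring
    rw [this]
    exact (h3.mono (by omega)).sub (h4.mono (by omega))

/-- the exponent function -/
def Fe (p J : ℕ) : ℕ → ℕ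
  | 0 => J
  | n + 1 => p * Fe p J n + 1

lemma Fe_ge (hp : 2 ≤ p) {J : ℕ} (hJ : 1 ≤ J) (m : ℕ) : 2 * m + 1 ≤ Fe p J m ∧ J + m ≤ Fe p J m := by
  induction m with
  | zero => simp [Fe]; omega
  | succ m ih =>
    have : 2 * Fe p J m ≤ p * Fe p J m := Nat.mul_le_mul_right _ hp
    simp only [Fe]; omega

lemma b_div (hp : p.Prime) (hip : (p : U) * ip = 1) (r : ℕ) (b Y : ℕ → U) (hPR : P ≤ R)
    (hb : ∀ s, b s ∈ P) (hY : ∀ i, Y i ∈ R)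
    (hbY : ∀ i, (p : U) ^ r * Y i = ∑ s ∈ Finset.range (i + 1), (p : U) ^ s * b s ^ p ^ (i - s)) (i : ℕ) :
    i ≤ r → Cg R p (r - i) (b i) := by
  induction i using Nat.strong_induction_on with
  | _ i ih =>
    intro hi
    have h1 : (p : U) ^ i * b i = (p : U) ^ r * Y i - ∑ s ∈ Finset.range i, (p : U) ^ s * b s ^ p ^ (i - s) := by
      rw [hbY, Finset.sum_range_succ]; simp
    refine Cg.cancel hip (n := i) ?_
    rw [h1, show i + (r - i) = r by omega]
    refine Cg.sub ⟨_, hY i, rfl⟩ (Cg.sum _ _ fun s hs => ?_)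
    rw [Finset.mem_range] at hs
    have h2 := ((ih s hs (by omega)).pow (p ^ (i - s))).ppow_mul s
    refine h2.mono ?_
    have : 1 ≤ p ^ (i - s) := Nat.one_le_pow _ _ hp.pos
    have : (r - s) * 1 ≤ (r - s) * p ^ (i - s) := Nat.mul_le_mul_left _ this
    omega

lemma claimA (hp : p.Prime) (hip : (p : U) * ip = 1) (φ : U →+* U) (hφR : ∀ a ∈ R, φ a ∈ R)
    (hφ : ∀ a ∈ R, Cg R p 1 (φ a - a ^ p)) (r : ℕ) (b Y : ℕ → U) (hPR : P ≤ R)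
    (hb : ∀ s, b s ∈ P) (hY : ∀ i, Y i ∈ R)
    (hY1 : ∀ i, Cg R p (i + 1) (Y (i + 1) - φ (Y i)))
    (hbY : ∀ i, (p : U) ^ r * Y i = ∑ s ∈ Finset.range (i + 1), (p : U) ^ s * b s ^ p ^ (i - s))
    (J : ℕ) (hJ : 1 ≤ J) (hJr : J ≤ r) (s : ℕ) :
    ∀ m, 1 ≤ m → ∃ D ∈ R, (p : U) ^ (Fe p J (s + m) - m - 1) * D ∈ P ∧
      Cg R p (m + 1) (Yf p ip Y s (r - J + m) - D) := by
  have hYp := Yf_prop hp hip φ hφR hφ Y hY hY1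
  induction s with
  | zero =>
    intro m hm
    obtain ⟨hF1, hF2⟩ := Fe_ge hp.two_le hJ m
    have hF3 : J + 1 ≤ Fe p J m := by omega
    set e := Fe p J m - m - 1 with he
    rw [zero_add, ← he]
    set i := r - J + m with hi
    simp only [Yf]
    by_cases her : r ≤ e
    · refine ⟨Y i, hY i, ?_, by simpa using Cg.zero⟩
      have : (p : U) ^ e * Y i = (p : U) ^ (e - r) * ((p : U) ^ r * Y i) := by
        rw [← mul_assoc, ← pow_add]; congr 2; omega
      rw [this, hbY]
      refine P.mul_mem (P.pow_mem (natCast_mem P p) _) (P.sum_mem fun s _ => ?_)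
      exact P.mul_mem (P.pow_mem (natCast_mem P p) _) (P.pow_mem (hb s) _)
    · push Not at her
      -- the bad terms
      have hbad : ∀ t ∈ Finset.range (r - e), Cg R p (r + (m + 1)) ((p : U) ^ t * b t ^ p ^ (i - t)) := by
        intro t ht
        rw [Finset.mem_range] at ht
        have h2 := ((b_div hp hip r b Y hPR hb hY hbY t (by omega)).pow (p ^ (i - t))).ppow_mul t
        refine h2.mono ?_
        have : p ^ 1 ≤ p ^ (i - t) := Nat.pow_le_pow_right hp.pos (by omega)
        have : 2 ≤ p ^ (i - t) := le_trans (by simpa using hp.two_le) this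
        have : (r - t) * 2 ≤ (r - t) * p ^ (i - t) := Nat.mul_le_mul_left _ this
        omega
      obtain ⟨c, hc, hc1⟩ := Cg.sum _ _ hbad
      refine ⟨Y i - (p : U) ^ (m + 1) * c, R.sub_mem (hY i) (R.mul_mem (R.pow_mem (natCast_mem R p) _) hc), ?_,
        ⟨c, hc, by ring⟩⟩
      have hsplit : (p : U) ^ r * ((p : U) ^ e * (Y i - (p : U) ^ (m + 1) * c)) =
          (p : U) ^ r * ∑ t ∈ Finset.Ico (r - e) (i + 1), (p : U) ^ (t - (r - e)) * b t ^ p ^ (i - t) := by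
        have h1 : (p : U) ^ r * ((p : U) ^ e * (Y i - (p : U) ^ (m + 1) * c)) = (p : U) ^ e * ((p : U) ^ r * Y i -
          (p : U) ^ (r + (m + 1)) * c) := by ring
        rw [h1, ← hc1, hbY, ← Finset.sum_range_add_sum_Ico _ (show r - e ≤ i + 1 by omega), add_sub_cancel_left,
          Finset.mul_sum, Finset.mul_sum]
        refine Finset.sum_congr rfl fun t ht => ?_
        rw [Finset.mem_Ico] at ht
        rw [← mul_assoc, ← mul_assoc, ← pow_add, ← pow_add]
        congr 2; omega
      rw [pcancel hip r hsplit]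
      refine P.sum_mem fun s _ => ?_
      exact P.mul_mem (P.pow_mem (natCast_mem P p) _) (P.pow_mem (hb s) _)
  | succ s ih =>
    intro m hm
    obtain ⟨D1, hD1, hD1P, hD1c⟩ := ih (m + 1) (by omega)
    obtain ⟨D2, hD2, hD2P, hD2c⟩ := ih m hm
    have hFs : Fe p J (s + 1 + m) = p * Fe p J (s + m) + 1 := by
      rw [show s + 1 + m = (s + m) + 1 by omega]; rfl
    rw [show s + (m + 1) = s + 1 + m by omega] at hD1P
    obtain ⟨hF1, hF2⟩ := Fe_ge hp.two_le hJ (s + m)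
    set i := r - J + m with hi
    have hd : Cg R p (m + 2) ((p : U) * Yf p ip Y (s + 1) i - (D1 - D2 ^ p)) := by
      rw [p_Yf hip]
      have h4 := Cg.pow_p hp (by omega) hD2c hD2
      have : Yf p ip Y s (i + 1) - Yf p ip Y s i ^ p - (D1 - D2 ^ p) = (Yf p ip Y s (i + 1) - D1) -
        (Yf p ip Y s i ^ p - D2 ^ p) := by ring
      rw [this]
      exact Cg.sub hD1c h4
    have hpD : (p : U) * (ip * (D1 - D2 ^ p)) = D1 - D2 ^ p := by rw [← mul_assoc, hip, one_mul]
    have hc : Cg R p (m + 1) (Yf p ip Y (s + 1) i - ip * (D1 - D2 ^ p)) := by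
      refine Cg.cancel hip (n := 1) ?_
      rw [pow_one, mul_sub, hpD, show 1 + (m + 1) = m + 2 by omega]
      exact hd
    refine ⟨ip * (D1 - D2 ^ p), ?_, ?_, hc⟩
    · have := R.sub_mem (hYp (s + 1) i).1 hc.mem
      simpa using this
    · have hple : p * (Fe p J (s + m) - m - 1) ≤ Fe p J (s + 1 + m) - m - 1 - 1 := by
        rw [hFs]
        obtain ⟨x, hx⟩ := Nat.exists_eq_add_of_le (show m + 1 ≤ Fe p J (s + m) by omega)
        have h1 : Fe p J (s + m) - m - 1 = x := by omega
        have h2 := hp.two_le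
        rw [h1, hx]
        have : p * (m + 1 + x) = p * (m + 1) + p * x := by ring
        have : 2 * (m + 1) ≤ p * (m + 1) := Nat.mul_le_mul_right _ h2
        omega
      have hpos : 1 ≤ Fe p J (s + 1 + m) - m - 1 := by
        have : 2 * Fe p J (s + m) ≤ p * Fe p J (s + m) := Nat.mul_le_mul_right _ hp.two_le
        omega
      obtain ⟨e, he⟩ := Nat.exists_eq_add_of_le' hpos
      have he1 : Fe p J (s + 1 + m) - (m + 1) - 1 = e := by omega
      rw [he1] at hD1P
      rw [he, Nat.add_sub_cancel] at hple
      rw [he, pow_succ, mul_assoc, hpD, mul_sub]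
      refine P.sub_mem hD1P ?_
      obtain ⟨x, hx⟩ := Nat.exists_eq_add_of_le hple
      have : (p : U) ^ e * D2 ^ p = (p : U) ^ x * ((p : U) ^ (Fe p J (s + m) - m - 1) * D2) ^ p := by
        rw [hx, mul_pow, ← pow_mul]; ring
      rw [this]
      exact P.mul_mem (P.pow_mem (natCast_mem P p) _) (P.pow_mem hD2P _)

lemma claimB (hp : p.Prime) (hip : (p : U) * ip = 1) (φ : U →+* U) (hφR : ∀ a ∈ R, φ a ∈ R)
    (hφ : ∀ a ∈ R, Cg R p 1 (φ a - a ^ p)) (r : ℕ) (b Y : ℕ → U) (hPR : P ≤ R)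
    (hb : ∀ s, b s ∈ P) (hY : ∀ i, Y i ∈ R)
    (hY1 : ∀ i, Cg R p (i + 1) (Y (i + 1) - φ (Y i)))
    (hbY : ∀ i, (p : U) ^ r * Y i = ∑ s ∈ Finset.range (i + 1), (p : U) ^ s * b s ^ p ^ (i - s))
    (i : ℕ) (hi : i < r) (s : ℕ) :
    ∃ D ∈ R, ∃ σ : ℤˣ, (p : U) ^ (Fe p (r - i) s) * D ∈ P ∧
      Cg R p 1 (Yf p ip Y s i - D) ∧ Cg P p 1 ((p : U) ^ (Fe p (r - i) s) * D - ((σ : ℤ) : U) * b i ^ p ^ s) := by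
  have hYp := Yf_prop hp hip φ hφR hφ Y hY hY1
  induction s with
  | zero =>
    obtain ⟨D, hD, hbD⟩ := b_div hp hip r b Y hPR hb hY hbY i hi.le
    refine ⟨D, hD, 1, ?_, ?_, ?_⟩
    · simp only [Fe]; rw [← hbD]; exact hb i
    · simp only [Yf]
      refine Cg.cancel hip (n := r) ?_
      have h1 : (p : U) ^ r * (Y i - D) = ∑ s ∈ Finset.range i, (p : U) ^ s * b s ^ p ^ (i - s) := by
        have : (p : U) ^ r * D = (p : U) ^ i * b i := by
          rw [hbD, ← mul_assoc, ← pow_add]; congr 2; omega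
        rw [mul_sub, hbY, this, Finset.sum_range_succ]; simp
      rw [h1]
      refine Cg.sum _ _ fun t ht => ?_
      rw [Finset.mem_range] at ht
      have h2 := ((b_div hp hip r b Y hPR hb hY hbY t (by omega)).pow (p ^ (i - t))).ppow_mul t
      refine h2.mono ?_
      have : p ^ 1 ≤ p ^ (i - t) := Nat.pow_le_pow_right hp.pos (by omega)
      have : 2 ≤ p ^ (i - t) := le_trans (by simpa using hp.two_le) this
      have : (r - t) * 2 ≤ (r - t) * p ^ (i - t) := Nat.mul_le_mul_left _ this
      omega
    · simp only [Fe]; rw [← hbD]; simpa using Cg.zero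
  | succ s ih =>
    obtain ⟨D1, hD1, hD1P, hD1c⟩ := claimA hp hip φ hφR hφ r b Y hPR hb hY hY1 hbY (r - i) (by omega) (by omega) s 1 le_rfl
    obtain ⟨D2, hD2, σ, hD2P, hD2c, hσ⟩ := ih
    rw [show r - (r - i) + 1 = i + 1 by omega] at hD1c
    obtain ⟨hF1, hF2⟩ := Fe_ge hp.two_le (show 1 ≤ r - i by omega) s
    have hd : Cg R p 2 ((p : U) * Yf p ip Y (s + 1) i - (D1 - D2 ^ p)) := by
      rw [p_Yf hip]
      have h4 := Cg.pow_p hp (by omega) hD2c hD2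
      have : Yf p ip Y s (i + 1) - Yf p ip Y s i ^ p - (D1 - D2 ^ p) = (Yf p ip Y s (i + 1) - D1) -
        (Yf p ip Y s i ^ p - D2 ^ p) := by ring
      rw [this]
      exact Cg.sub hD1c h4
    have hpD : (p : U) * (ip * (D1 - D2 ^ p)) = D1 - D2 ^ p := by rw [← mul_assoc, hip, one_mul]
    have hc : Cg R p 1 (Yf p ip Y (s + 1) i - ip * (D1 - D2 ^ p)) := by
      refine Cg.cancel hip (n := 1) ?_
      rw [pow_one, mul_sub, hpD]
      exact hd
    have hval : (p : U) ^ (Fe p (r - i) (s + 1)) * (ip * (D1 - D2 ^ p)) = 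
        (p : U) * ((p : U) ^ (Fe p (r - i) (s + 1) - 1 - 1) * D1) - ((p : U) ^ (Fe p (r - i) s) * D2) ^ p := by
      have h2 : 2 * Fe p (r - i) s ≤ p * Fe p (r - i) s := Nat.mul_le_mul_right _ hp.two_le
      obtain ⟨e, he⟩ := Nat.exists_eq_add_of_le' (show 1 ≤ p * Fe p (r - i) s by omega)
      have h1 : Fe p (r - i) (s + 1) = e + 1 + 1 := by rw [← he]; rfl
      rw [h1, pow_succ, mul_assoc, hpD, mul_sub, mul_pow, ← pow_mul, mul_comm (Fe p (r - i) s), he]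
      simp only [Nat.add_sub_cancel]
      ring
    refine ⟨ip * (D1 - D2 ^ p), ?_, - σ ^ p, ?_, hc, ?_⟩
    · have := R.sub_mem (hYp (s + 1) i).1 hc.mem
      simpa using this
    · rw [hval]
      exact P.sub_mem (P.mul_mem (natCast_mem P p) hD1P) (P.pow_mem hD2P _)
    · rw [hval]
      have h5 := hσ.pow_sub hD2P (P.mul_mem (intCast_mem P _) (P.pow_mem (hb i) _)) p
      have h6 : Cg P p 1 ((p : U) * ((p : U) ^ (Fe p (r - i) (s + 1) - 1 - 1) * D1)) := ⟨_, hD1P, by ring⟩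
      convert h6.sub h5 using 1
      push_cast
      rw [mul_pow, ← pow_mul, pow_succ p s]
      ring

lemma claimT (hp : p.Prime) (hip : (p : U) * ip = 1) (φ : U →+* U) (hφR : ∀ a ∈ R, φ a ∈ R)
    (hφ : ∀ a ∈ R, Cg R p 1 (φ a - a ^ p)) (r : ℕ) (b Y : ℕ → U) (hPR : P ≤ R)
    (hb : ∀ s, b s ∈ P) (hY : ∀ i, Y i ∈ R)
    (hY1 : ∀ i, Cg R p (i + 1) (Y (i + 1) - φ (Y i)))
    (hbY : ∀ i, (p : U) ^ r * Y i = ∑ s ∈ Finset.range (i + 1), (p : U) ^ s * b s ^ p ^ (i - s))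
    (i : ℕ) (hi : i < r) (n : ℕ) : ∀ s : ℕ,
    ∃ D ∈ R, ∃ σ : ℤˣ, (p : U) ^ (Fe p (r - i) s * n + padicValNat p n.factorial) * D ∈ P ∧
      Cg P p 1 ((p : U) ^ (Fe p (r - i) s * n + padicValNat p n.factorial) * D - ((σ : ℤ) : U) * b i ^ (p ^ s * n)) := by
  haveI := Fact.mk hp
  induction n using Nat.strong_induction_on with
  | _ n ih =>
    intro s
    rcases Nat.eq_zero_or_pos n with rfl | hn
    · refine ⟨1, R.one_mem, 1, ?_, ?_⟩
      · simpa using P.one_mem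
      · simpa using Cg.zero
    · obtain ⟨D, hD, σ, hDP, hDc⟩ := ih (n / p) (Nat.div_lt_self hn hp.one_lt) (s + 1)
      obtain ⟨D', hD', σ', hDP', -, hDc'⟩ := claimB hp hip φ hφR hφ r b Y hPR hb hY hY1 hbY i hi s
      have hE : (p : U) ^ (Fe p (r - i) s * n + padicValNat p n.factorial) * (D' ^ (n % p) * D) =
          ((p : U) ^ (Fe p (r - i) s) * D') ^ (n % p) *
          ((p : U) ^ (Fe p (r - i) (s + 1) * (n / p) + padicValNat p (n / p).factorial) * D) := by
        have hv : padicValNat p n.factorial = padicValNat p (n / p).factorial + n / p := by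
          rw [← padicValNat_factorial_mul, ← padicValNat_factorial_mul_add _ (Nat.mod_lt n hp.pos), Nat.div_add_mod]
        have h1 : Fe p (r - i) s * n + padicValNat p n.factorial = Fe p (r - i) s * (n % p) + 
          (Fe p (r - i) (s + 1) * (n / p) + padicValNat p (n / p).factorial) := by
          rw [hv]
          have h3 : Fe p (r - i) (s + 1) = p * Fe p (r - i) s + 1 := rfl
          rw [h3]
          have h2 : Fe p (r - i) s * n = Fe p (r - i) s * (p * (n / p)) + Fe p (r - i) s * (n % p) := by
            rw [← mul_add, Nat.div_add_mod]
          rw [h2]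
          ring
        rw [h1]; ring
      refine ⟨D' ^ (n % p) * D, R.mul_mem (R.pow_mem hD' _) hD, σ' ^ (n % p) * σ, ?_, ?_⟩
      · rw [hE]
        exact P.mul_mem (P.pow_mem hDP' _) hDP
      · rw [hE]
        have h5 := hDc'.pow_sub hDP' (P.mul_mem (intCast_mem P _) (P.pow_mem (hb i) _)) (n % p)
        convert Cg.mul_sub h5 hDc (P.pow_mem (P.mul_mem (intCast_mem P _) (P.pow_mem (hb i) _)) _) hDP using 1
        have h7 : b i ^ (p ^ s * n) = (b i ^ (p ^ s)) ^ (n % p) * b i ^ (p ^ (s + 1) * (n / p)) := by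
          rw [← pow_mul, ← pow_add]
          congr 1
          conv_lhs => rw [← Nat.div_add_mod n p]
          ring
        rw [h7]
        push_cast
        ring

theorem coreB (hp : p.Prime) (hip : (p : U) * ip = 1) (φ : U →+* U) (hφR : ∀ a ∈ R, φ a ∈ R)
    (hφ : ∀ a ∈ R, Cg R p 1 (φ a - a ^ p)) (r : ℕ) (b Y : ℕ → U) (hPR : P ≤ R)
    (hb : ∀ s, b s ∈ P) (hY : ∀ i, Y i ∈ R)
    (hY1 : ∀ i, Cg R p (i + 1) (Y (i + 1) - φ (Y i)))
    (hbY : ∀ i, (p : U) ^ r * Y i = ∑ s ∈ Finset.range (i + 1), (p : U) ^ s * b s ^ p ^ (i - s))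
    (i : ℕ) (hi : i < r) (n : ℕ) :
    ∃ E ∈ P, Cg R p ((r - i) * n + padicValNat p n.factorial) E ∧ Cg P p 1 (E - b i ^ n) := by
  obtain ⟨D, hD, σ, h1, h2⟩ := claimT hp hip φ hφR hφ r b Y hPR hb hY hY1 hbY i hi n 0
  simp only [Fe, pow_zero, one_mul] at h1 h2
  rcases Int.units_eq_one_or σ with rfl | rfl
  · exact ⟨_, h1, ⟨D, hD, rfl⟩, by simpa using h2⟩
  · refine ⟨_, P.neg_mem h1, Cg.neg ⟨D, hD, rfl⟩, ?_⟩
    have := h2.neg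
    convert this using 1
    push_cast
    ring

end coreB2

/-! ### Part C: symmetric functions, with `X k` playing the role of the power sum `p_k` -/

section partC1

/-- `p`-integral rationals -/
def Kp (p : ℕ) [hp : Fact p.Prime] : Subring ℚ where
  carrier := {a | padicNorm p a ≤ 1}
  mul_mem' := by
    intro a b ha hb
    simp only [Set.mem_setOf_eq] at *
    rw [padicNorm.mul]
    exact mul_le_one₀ ha (padicNorm.nonneg _) hb
  one_mem' := by simp
  add_mem' := by
    intro a b ha hb
    exact le_trans padicNorm.nonarchimedean (max_le ha hb)
  zero_mem' := by simp
  neg_mem' := by intro a ha; simpa using ha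

abbrev UU := MvPolynomial ℕ ℚ

variable (p : ℕ) [hp : Fact p.Prime]

lemma mem_Kp {a : ℚ} : a ∈ Kp p ↔ padicNorm p a ≤ 1 := Iff.rfl

lemma inv_mem_Kp (n : ℕ) (h : ¬ p ∣ n) : (n : ℚ)⁻¹ ∈ Kp p := by
  have h1 := padicNorm.nat_eq_one_iff n |>.2 h
  have hn : (n : ℚ) ≠ 0 := by
    rintro h0
    rw [h0] at h1
    simp at h1
  have h2 := padicNorm.mul (p := p) (n : ℚ) (n : ℚ)⁻¹
  rw [mul_inv_cancel₀ hn, h1, one_mul, padicNorm.one] at h2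
  rw [mem_Kp, ← h2]

lemma mem_Kp_iff_den {a : ℚ} (ha : a ∈ Kp p) : ¬ p ∣ a.den := by
  intro h
  rw [mem_Kp] at ha
  have h1 : padicNorm p (a.den : ℚ) < 1 := padicNorm.nat_lt_one_iff _ |>.2 h
  have h2 : padicNorm p (a.num : ℚ) < 1 := by
    have : (a.num : ℚ) = a * a.den := (Rat.mul_den_eq_num a).symm
    rw [this, padicNorm.mul]
    exact lt_of_le_of_lt (mul_le_of_le_one_left (padicNorm.nonneg _) ha) h1
  rw [padicNorm.int_lt_one_iff] at h2
  have h3 := a.reduced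
  have h4 : p ∣ a.num.natAbs := Int.natCast_dvd.1 h2
  have := Nat.dvd_gcd h4 h
  rw [h3] at this
  exact hp.out.one_lt.ne' (Nat.dvd_one.1 this)

lemma fermat_Kp {a : ℚ} (ha : a ∈ Kp p) : ∃ c ∈ Kp p, a - a ^ p = p * c := by
  have hd := mem_Kp_iff_den p ha
  have hdvd : (p : ℤ) ∣ a.num * (a.den : ℤ) ^ (p - 1) - a.num ^ p := by
    rw [← ZMod.intCast_eq_intCast_iff_dvd_sub]
    push_cast
    rw [ZMod.pow_card, ZMod.pow_card_sub_one_eq_one, mul_one]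
    rwa [Ne, ZMod.natCast_eq_zero_iff]
  obtain ⟨c, hc⟩ := hdvd
  have hden : (a.den : ℚ) ≠ 0 := by exact_mod_cast a.den_nz
  refine ⟨c * ((a.den : ℚ)⁻¹) ^ p, (Kp p).mul_mem (intCast_mem _ _) ((Kp p).pow_mem (inv_mem_Kp p _ hd) _), ?_⟩
  have hc' : (a.num : ℚ) * (a.den : ℚ) ^ (p - 1) - (a.num : ℚ) ^ p = p * c := by exact_mod_cast hc
  rw [← mul_assoc, ← hc']
  have h1 : (a.den : ℚ) ^ p = a.den * (a.den : ℚ) ^ (p - 1) := by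
    rw [← pow_succ', Nat.sub_add_cancel hp.out.one_le]
  have h2 : (a.num : ℚ) = a * a.den := (Rat.mul_den_eq_num a).symm
  rw [h2, inv_pow, mul_pow]
  field_simp
  rw [h1]
  ring

/-- generic Witt coordinates of a ghost sequence -/
def wc {U : Type*} [CommRing U] (p : ℕ) (ip : U) (w : ℕ → U) (s : ℕ) : U :=
  ip ^ s * (w s - ∑ t : Fin s, (p : U) ^ (t : ℕ) * (wc p ip w t) ^ p ^ (s - t))
termination_by s
decreasing_by exact t.2

lemma wc_ghost {U : Type*} [CommRing U] (p : ℕ) (ip : U) (hip : (p : U) * ip = 1) (w : ℕ → U) (s : ℕ) :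
    w s = ∑ t ∈ Finset.range (s + 1), (p : U) ^ t * (wc p ip w t) ^ p ^ (s - t) := by
  rw [Finset.sum_range_succ]
  conv_rhs => arg 2; rw [wc]
  rw [Nat.sub_self, pow_zero, pow_one, ← mul_assoc, ← mul_pow, hip, one_pow, one_mul,
    Fin.sum_univ_eq_sum_range (fun t => (p : U) ^ t * (wc p ip w t) ^ p ^ (s - t))]
  ring

lemma wc_unique {U : Type*} [CommRing U] (p : ℕ) (ip : U) (hip : (p : U) * ip = 1) (w : ℕ → U) (y : ℕ → U) 
    (h : ∀ s, w s = ∑ t ∈ Finset.range (s + 1), (p : U) ^ t * (y t) ^ p ^ (s - t)) (s : ℕ) : wc p ip w s = y s := by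
  induction s using Nat.strong_induction_on with
  | _ s ih =>
    have h1 := wc_ghost p ip hip w s
    have h2 := h s
    rw [Finset.sum_range_succ] at h1 h2
    have h3 : ∑ t ∈ Finset.range s, (p : U) ^ t * (wc p ip w t) ^ p ^ (s - t) =
      ∑ t ∈ Finset.range s, (p : U) ^ t * (y t) ^ p ^ (s - t) := 
      Finset.sum_congr rfl fun t ht => by rw [ih t (Finset.mem_range.1 ht)]
    rw [h3] at h1
    rw [h1] at h2
    have h4 := add_left_cancel h2
    simp only [Nat.sub_self, pow_zero, pow_one] at h4
    exact pcancel hip s h4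

lemma wc_map {U V : Type*} [CommRing U] [CommRing V] (p : ℕ) (ip : U) (ip' : V) (hip : (p : U) * ip = 1)
    (hip' : (p : V) * ip' = 1) (f : U →+* V) (w : ℕ → U) (s : ℕ) :
    f (wc p ip w s) = wc p ip' (fun s => f (w s)) s := by
  symm
  apply wc_unique p ip' hip' _ (fun s => f (wc p ip w s))
  intro s
  rw [wc_ghost p ip hip w s, map_sum]
  simp

/-- inverse of `p` in the ring -/
def ip : UU := MvPolynomial.C ((p : ℚ)⁻¹)

lemma hip : (p : UU) * ip p = 1 := by
  rw [ip, ← map_natCast MvPolynomial.C, ← map_mul, mul_inv_cancel₀, map_one]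
  exact_mod_cast hp.out.ne_zero

/-- the Witt coordinates `x_{j p^s}` -/
def xx (j s : ℕ) : UU := wc p (ip p) (fun s => MvPolynomial.X (j * p ^ s)) s

/-- the Witt coordinate `x_k` -/
def xk (k : ℕ) : UU := xx p (k / p ^ padicValNat p k) (padicValNat p k)

lemma xk_mul (j s : ℕ) (hj : ¬ p ∣ j) : xk p (j * p ^ s) = xx p j s := by
  have h1 : padicValNat p (j * p ^ s) = s := by rw [mul_comm]; exact val_pm p hp.out s j hj
  rw [xk, h1, Nat.mul_div_cancel _ (pow_pos hp.out.pos _)]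

lemma exists_js (k : ℕ) (hk : k ≠ 0) : ∃ j s, ¬ p ∣ j ∧ j ≠ 0 ∧ k = j * p ^ s := by
  obtain ⟨s, j, hj, h⟩ := Nat.exists_eq_pow_mul_and_not_dvd hk p hp.out.ne_one
  exact ⟨j, s, hj, by rintro rfl; simp at hj, by rw [h, mul_comm]⟩

lemma xx_ghost (j s : ℕ) : (MvPolynomial.X (j * p ^ s) : UU) =
    ∑ t ∈ Finset.range (s + 1), (p : UU) ^ t * (xx p j t) ^ p ^ (s - t) :=
  wc_ghost p (ip p) (hip p) (fun s => MvPolynomial.X (j * p ^ s)) s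

/-- substitution `x_k ↦ y k` -/
def subx (y : ℕ → UU) : UU →ₐ[ℚ] UU := MvPolynomial.aeval fun k =>
  ∑ t ∈ Finset.range (padicValNat p k + 1), (p : UU) ^ t * (y ((k / p ^ padicValNat p k) * p ^ t)) ^ p ^ (padicValNat p k - t)

lemma subx_X (y : ℕ → UU) (j s : ℕ) (hj : ¬ p ∣ j) : subx p y (MvPolynomial.X (j * p ^ s)) = 
    ∑ t ∈ Finset.range (s + 1), (p : UU) ^ t * (y (j * p ^ t)) ^ p ^ (s - t) := by
  have h1 : padicValNat p (j * p ^ s) = s := by rw [mul_comm]; exact val_pm p hp.out s j hj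
  rw [subx, MvPolynomial.aeval_X, h1, Nat.mul_div_cancel _ (pow_pos hp.out.pos _)]

lemma subx_xx (y : ℕ → UU) (j s : ℕ) (hj : ¬ p ∣ j) : subx p y (xx p j s) = y (j * p ^ s) := by
  have := wc_map p (ip p) (ip p) (hip p) (hip p) (subx p y : UU →+* UU) (fun s => MvPolynomial.X (j * p ^ s)) s
  simp only [RingHom.coe_coe] at this
  rw [xx, this]
  apply wc_unique p (ip p) (hip p) _ (fun s => y (j * p ^ s))
  intro s
  exact subx_X p y j s hj

lemma subx_xk (y : ℕ → UU) (k : ℕ) (hk : k ≠ 0) : subx p y (xk p k) = y k := by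
  obtain ⟨j, s, hj, hj0, rfl⟩ := exists_js p k hk
  rw [xk_mul p j s hj, subx_xx p y j s hj]

/-- Frobenius `p_k ↦ p_{pk}` -/
def fr : UU →ₐ[ℚ] UU := MvPolynomial.aeval fun k => MvPolynomial.X (p * k)

/-- `K[x]` -/
def Sx : Subring UU := (Algebra.adjoin (Kp p) {f : UU | ∃ k, k ≠ 0 ∧ f = xk p k}).toSubring

/-- `K[x_k : l ∤ k]` -/
def Px (l : ℕ) : Subring UU := (Algebra.adjoin (Kp p) {f : UU | ∃ k, k ≠ 0 ∧ ¬ l ∣ k ∧ f = xk p k}).toSubring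

lemma xk_mem_Sx (k : ℕ) (hk : k ≠ 0) : xk p k ∈ Sx p := Algebra.subset_adjoin ⟨k, hk, rfl⟩

lemma xx_mem_Sx (j s : ℕ) (hj : ¬ p ∣ j) : xx p j s ∈ Sx p := by
  rw [← xk_mul p j s hj]
  exact xk_mem_Sx p _ (mul_ne_zero (by rintro rfl; simp at hj) (pow_ne_zero _ hp.out.ne_zero))

lemma xk_mem_Px (l k : ℕ) (hk : k ≠ 0) (h : ¬ l ∣ k) : xk p k ∈ Px p l := Algebra.subset_adjoin ⟨k, hk, h, rfl⟩

lemma Px_le (l : ℕ) : Px p l ≤ Sx p := by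
  have : Algebra.adjoin (Kp p) {f : UU | ∃ k, k ≠ 0 ∧ ¬ l ∣ k ∧ f = xk p k} ≤ 
    Algebra.adjoin (Kp p) {f : UU | ∃ k, k ≠ 0 ∧ f = xk p k} := by
    apply Algebra.adjoin_mono
    rintro f ⟨k, hk, _, rfl⟩
    exact ⟨k, hk, rfl⟩
  exact this

lemma C_mem_Sx {a : ℚ} (ha : a ∈ Kp p) : (MvPolynomial.C a : UU) ∈ Sx p := 
  Subalgebra.algebraMap_mem (Algebra.adjoin (Kp p) {f : UU | ∃ k, k ≠ 0 ∧ f = xk p k}) ⟨a, ha⟩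

lemma Cg.pow_pk {U : Type*} [CommRing U] {R : Subring U} {p : ℕ} {a b : U} (hp : p.Prime) {i : ℕ} (hi : 1 ≤ i) (ha : Cg R p i (a - b)) 
    (hb : b ∈ R) (k : ℕ) :
    Cg R p (k + i) (a ^ p ^ k - b ^ p ^ k) := by
  induction k with
  | zero => simpa using ha
  | succ k ih =>
    rw [pow_succ, pow_mul, pow_mul]
    exact (Cg.pow_p hp (by omega) ih (R.pow_mem hb _)).mono (by omega)

lemma fr_xx (j s : ℕ) (hj : ¬ p ∣ j) : Cg (Sx p) p 1 (fr p (xx p j s) - xx p j s ^ p) := by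
  induction s using Nat.strong_induction_on with
  | _ s ih =>
    refine Cg.cancel (hip p) (n := s) ?_
    have h1 : fr p (MvPolynomial.X (j * p ^ s)) = (MvPolynomial.X (j * p ^ (s + 1)) : UU) := by
      rw [fr, MvPolynomial.aeval_X]; congr 1; ring
    rw [xx_ghost p j s, xx_ghost p j (s + 1), map_sum, Finset.sum_range_succ, Finset.sum_range_succ,
      Finset.sum_range_succ] at h1
    simp only [map_mul, map_pow, map_natCast, Nat.sub_self, pow_zero, pow_one, Nat.add_sub_cancel_left] at h1
    have h2 : (p : UU) ^ s * (fr p (xx p j s) - xx p j s ^ p) = (p : UU) ^ (s + 1) * xx p j (s + 1) - 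
       ∑ t ∈ Finset.range s, (p : UU) ^ t * (fr p (xx p j t) ^ p ^ (s - t) - (xx p j t ^ p) ^ p ^ (s - t)) := by
      have h3 : ∀ t ∈ Finset.range s, (p : UU) ^ t * (fr p (xx p j t) ^ p ^ (s - t) - (xx p j t ^ p) ^ p ^ (s - t))
        = (p : UU) ^ t * fr p (xx p j t) ^ p ^ (s - t) - (p : UU) ^ t * xx p j t ^ p ^ (s + 1 - t) := by
        intro t ht
        rw [Finset.mem_range] at ht
        rw [← pow_mul, ← pow_succ', show s - t + 1 = s + 1 - t by omega]
        ring
      rw [Finset.sum_congr rfl h3, Finset.sum_sub_distrib]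
      linear_combination h1
    rw [h2]
    refine Cg.sub ⟨_, xx_mem_Sx p j _ hj, rfl⟩ (Cg.sum _ _ fun t ht => ?_)
    rw [Finset.mem_range] at ht
    have h4 := ((ih t ht).pow_pk hp.out le_rfl ((Sx p).pow_mem (xx_mem_Sx p j t hj) _) (s - t)).ppow_mul t
    exact h4.mono (by omega)

lemma Cg.add_pow_p {U : Type*} [CommRing U] {R : Subring U} {p : ℕ} {a b : U} (hp : p.Prime) (ha : a ∈ R) (hb : b ∈ R) :
    Cg R p 1 ((a + b) ^ p - (a ^ p + b ^ p)) := by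
  obtain ⟨c, hc⟩ := exists_add_pow_prime_eq (R := R) hp ⟨a, ha⟩ ⟨b, hb⟩
  have h2 := congrArg (R.subtype) hc
  simp only [map_add, map_mul, map_pow, Subring.subtype_apply, map_natCast] at h2
  exact ⟨a * b * c, R.mul_mem (R.mul_mem ha hb) c.2, by rw [h2]; ring⟩

lemma fr_Sx (f : UU) (hf : f ∈ Sx p) : fr p f ∈ Sx p ∧ Cg (Sx p) p 1 (fr p f - f ^ p) := by
  suffices h : Cg (Sx p) p 1 (fr p f - f ^ p) by
    refine ⟨?_, h⟩
    have := (Sx p).add_mem h.mem ((Sx p).pow_mem hf p)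
    simpa using this
  induction hf using Algebra.adjoin_induction with
  | mem x hx =>
    obtain ⟨k, hk, rfl⟩ := hx
    obtain ⟨j, s, hj, hj0, rfl⟩ := exists_js p k hk
    rw [xk_mul p j s hj]
    exact fr_xx p j s hj
  | algebraMap a =>
    obtain ⟨c, hc, h⟩ := fermat_Kp p a.2
    refine ⟨MvPolynomial.C c, C_mem_Sx p hc, ?_⟩
    have h1 : (algebraMap (Kp p) UU) a = MvPolynomial.C (a : ℚ) := rfl
    rw [h1, fr, MvPolynomial.aeval_C]
    have h2 : (algebraMap ℚ UU) (a : ℚ) = MvPolynomial.C (a : ℚ) := rfl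
    rw [h2, ← map_pow, ← map_sub, h, map_mul, map_natCast, pow_one]
  | add a b ha hb iha ihb =>
    rw [map_add]
    have := (iha.add ihb).sub (Cg.add_pow_p hp.out (R := Sx p) ha hb)
    convert this using 1
    ring
  | mul a b ha hb iha ihb =>
    rw [map_mul, mul_pow]
    refine Cg.mul_sub iha ihb ((Sx p).pow_mem ha _) ?_
    have := (Sx p).add_mem ihb.mem ((Sx p).pow_mem hb p)
    simpa using this

end partC1

section partC2
open PowerSeries

section hs
variable {A : Type*} [CommRing A] [Algebra ℚ A]

/-- Newton: from power sums to complete symmetric functions -/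
def hs (w : ℕ → A) : ℕ → A
  | 0 => 1
  | n + 1 => ((n + 1 : ℚ)⁻¹) • ∑ i : Fin (n + 1), w (i + 1) * hs w (n - i)
termination_by n => n
decreasing_by omega

lemma hs_zero (w : ℕ → A) : hs w 0 = 1 := by rw [hs]

lemma hs_succ (w : ℕ → A) (n : ℕ) : hs w (n + 1) =
   ((n + 1 : ℚ)⁻¹) • ∑ i ∈ Finset.range (n + 1), w (i + 1) * hs w (n - i) := by
  rw [hs, Fin.sum_univ_eq_sum_range (fun i => w (i + 1) * hs w (n - i))]

lemma hs_newton (w : ℕ → A) (n : ℕ) : ((n : A) + 1) * hs w (n + 1) =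
    ∑ i ∈ Finset.range (n + 1), w (i + 1) * hs w (n - i) := by
  rw [hs_succ]
  have : ((n : A) + 1) = algebraMap ℚ A (n + 1) := by simp
  rw [this, ← Algebra.smul_def, smul_smul, mul_inv_cancel₀ (by positivity), one_smul]

lemma hs_unique (w f : ℕ → A) (h0 : f 0 = 1) (h : ∀ n : ℕ, ((n : A) + 1) * f (n + 1) =
    ∑ i ∈ Finset.range (n + 1), w (i + 1) * f (n - i)) (n : ℕ) : hs w n = f n := by
  induction n using Nat.strong_induction_on with
  | _ n ih =>
    cases n with
    | zero => rw [hs_zero, h0]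
    | succ n =>
      rw [hs_succ]
      have h1 : ∑ i ∈ Finset.range (n + 1), w (i + 1) * hs w (n - i) =
         ∑ i ∈ Finset.range (n + 1), w (i + 1) * f (n - i) :=
         Finset.sum_congr rfl fun i hi => by rw [ih (n - i) (by omega)]
      rw [h1, ← h]
      have : ((n : A) + 1) = algebraMap ℚ A (n + 1) := by simp
      rw [this, ← Algebra.smul_def, smul_smul, inv_mul_cancel₀ (by positivity), one_smul]

lemma hs_congr (w w' : ℕ → A) (n : ℕ) (h : ∀ k, 1 ≤ k → k ≤ n → w k = w' k) : hs w n = hs w' n := by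
  induction n using Nat.strong_induction_on with
  | _ n ih =>
    cases n with
    | zero => rw [hs_zero, hs_zero]
    | succ n =>
      rw [hs_succ, hs_succ]
      congr 1
      refine Finset.sum_congr rfl fun i hi => ?_
      rw [Finset.mem_range] at hi
      rw [h (i + 1) (by omega) (by omega), ih (n - i) (by omega) fun k h1 h2 => h k h1 (by omega)]

lemma hs_map {B : Type*} [CommRing B] [Algebra ℚ B] (f : A →ₐ[ℚ] B) (w : ℕ → A) (n : ℕ) :
    f (hs w n) = hs (fun k => f (w k)) n := by
  symm
  apply hs_unique _ (fun n => f (hs w n))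
  · rw [hs_zero, map_one]
  · intro n
    have := congrArg f (hs_newton w n)
    simpa [map_sum] using this

lemma hs_ps (w : ℕ → A) (F : A⟦X⟧) (h0 : coeff 0 F = 1)
    (h : d⁄dX A F = PowerSeries.mk (fun n => w (n + 1)) * F) (n : ℕ) : hs w n = coeff n F := by
  apply hs_unique w (fun n => coeff n F) h0
  intro n
  have := congrArg (coeff n) h
  rw [coeff_derivative, coeff_mul, Finset.Nat.sum_antidiagonal_eq_sum_range_succ (fun i j => coeff i (mk fun n => w (n+1)) * coeff j F)] at this
  simp only [coeff_mk] at this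
  rw [mul_comm]; exact this

lemma hs_d (w : ℕ → A) : d⁄dX A (mk (hs w)) = PowerSeries.mk (fun n => w (n + 1)) * mk (hs w) := by
  ext n
  rw [coeff_derivative, coeff_mul, Finset.Nat.sum_antidiagonal_eq_sum_range_succ (fun i j => coeff i (mk fun n => w (n+1)) * coeff j (mk (hs w)))]
  simp only [coeff_mk]
  rw [mul_comm, hs_newton]

lemma hs_add (w w' : ℕ → A) (n : ℕ) : hs (fun k => w k + w' k) n =
    ∑ i ∈ Finset.HasAntidiagonal.antidiagonal n, hs w i.1 * hs w' i.2 := by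
  rw [hs_ps (fun k => w k + w' k) (mk (hs w) * mk (hs w'))]
  · rw [coeff_mul]; simp
  · simp [hs_zero]
  · rw [Derivation.leibniz, hs_d, hs_d]
    have : (mk fun n => w (n + 1) + w' (n + 1)) = (mk fun n => w (n + 1)) + mk fun n => w' (n + 1) := by
      ext; simp
    rw [this, smul_eq_mul, smul_eq_mul]
    ring

lemma hs_geom (k : ℕ) (hk : k ≠ 0) (a : A) (n : ℕ) :
    hs (fun m => if k ∣ m then (k : A) * a ^ (m / k) else 0) n = if k ∣ n then a ^ (n / k) else 0 := by
  apply hs_unique _ (fun n => if k ∣ n then a ^ (n / k) else 0)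
  · simp
  intro n
  by_cases hn : k ∣ n + 1
  · obtain ⟨m, hm⟩ := hn
    have hk1 : 0 < k := Nat.pos_of_ne_zero hk
    have hm0 : m ≠ 0 := by rintro rfl; simp at hm
    rw [if_pos ⟨m, hm⟩, hm, Nat.mul_div_cancel_left _ hk1]
    have h1 : ∀ i ∈ Finset.range (n + 1), ((if k ∣ i + 1 then (k : A) * a ^ ((i + 1) / k) else 0) * if k ∣ n - i then a ^ ((n - i) / k) else 0) =
       if k ∣ i + 1 then (k : A) * a ^ m else 0 := by
      intro i hi
      rw [Finset.mem_range] at hi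
      by_cases h : k ∣ i + 1
      · obtain ⟨c, hc⟩ := h
        have h2 : n - i = k * (m - c) := by rw [Nat.mul_sub, ← hm, ← hc]; omega
        have hcm : c ≤ m := by
          apply Nat.le_of_mul_le_mul_left _ hk1
          rw [← hc, ← hm]; omega
        rw [if_pos ⟨c, hc⟩, if_pos ⟨_, h2⟩, if_pos ⟨c, hc⟩, hc, h2, Nat.mul_div_cancel_left _ hk1, Nat.mul_div_cancel_left _ hk1, mul_assoc,
          ← pow_add, Nat.add_sub_cancel' hcm]
      · rw [if_neg h, if_neg h, zero_mul]
    rw [← hm, Finset.sum_congr rfl h1, ← Finset.sum_filter, Finset.sum_const]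
    have h2 : (Finset.filter (fun i => k ∣ i + 1) (Finset.range (n + 1))).card = m := by
      rw [Nat.card_multiples, hm, Nat.mul_div_cancel_left _ hk1]
    rw [h2, nsmul_eq_mul]
    have h3 : ((n : A) + 1) = (k * m : ℕ) := by rw [← hm]; push_cast; ring
    rw [h3]; push_cast; ring
  · rw [if_neg hn, mul_zero]
    symm
    apply Finset.sum_eq_zero
    intro i hi
    rw [Finset.mem_range] at hi
    by_cases h : k ∣ i + 1
    · have h3 : ¬ k ∣ n - i := fun h2 => ?_
      · rw [if_neg h3, mul_zero]
      apply hn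
      have := dvd_add h h2
      rwa [show i + 1 + (n - i) = n + 1 by omega] at this
    · rw [if_neg h, zero_mul]

/-- integrality of sums of geometric sequences -/
lemma hs_geom_sum_mem (R : Subring A) {ι : Type*} (s : Finset ι) (k : ι → ℕ) (hk : ∀ i ∈ s, k i ≠ 0) (a : ι → A) 
    (ha : ∀ i ∈ s, a i ∈ R) (n : ℕ) :
    hs (fun m => ∑ i ∈ s, if k i ∣ m then (k i : A) * a i ^ (m / k i) else 0) n ∈ R := by
  induction s using Finset.induction_on generalizing n with
  | empty =>
    cases n with
    | zero => rw [hs_zero]; exact R.one_mem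
    | succ n => rw [hs_succ]; simp
  | insert i s hi ih =>
    simp only [Finset.sum_insert hi]
    rw [hs_add]
    refine R.sum_mem fun j hj => R.mul_mem ?_ (ih (fun i hi => hk i (by simp [hi])) (fun i hi => ha i (by simp [hi])) _)
    rw [hs_geom _ (hk i (by simp))]
    split_ifs
    · exact R.pow_mem (ha i (by simp)) _
    · exact R.zero_mem

end hs

end partC2

section partC3

lemma Cg.nat {U : Type*} [CommRing U] (R : Subring U) (p k d : ℕ) (h : p ^ k ∣ d) : Cg R p k (d : U) := by
  obtain ⟨c, rfl⟩ := h
  exact ⟨c, natCast_mem R c, by push_cast; rfl⟩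

/-- big Witt coordinates -/
def XX (n : ℕ) : UU := ((n : ℚ)⁻¹) • (MvPolynomial.X n - ∑ d : n.properDivisors, ((d : ℕ) : UU) * XX d ^ (n / d))
termination_by n
decreasing_by exact (Nat.mem_properDivisors.1 d.2).2

lemma XX_def (n : ℕ) (hn : n ≠ 0) : (n : UU) * XX n = 
    MvPolynomial.X n - ∑ d ∈ n.properDivisors, (d : UU) * XX d ^ (n / d) := by
  rw [XX]
  have : (n : UU) = algebraMap ℚ UU n := by simp
  rw [this, ← Algebra.smul_def, smul_smul, mul_inv_cancel₀ (by exact_mod_cast hn), one_smul]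
  congr 1
  exact Finset.sum_coe_sort n.properDivisors (fun d => (d : UU) * XX d ^ (n / d))

lemma XX_sum (n : ℕ) (hn : n ≠ 0) : (MvPolynomial.X n : UU) = ∑ d ∈ n.divisors, (d : UU) * XX d ^ (n / d) := by
  rw [← Nat.insert_self_properDivisors hn, Finset.sum_insert Nat.self_notMem_properDivisors, Nat.div_self (Nat.pos_of_ne_zero hn), pow_one, XX_def n hn]
  ring

variable (p : ℕ) [hp : Fact p.Prime]

lemma smul_mem_Sx {a : ℚ} (ha : a ∈ Kp p) {f : UU} (hf : f ∈ Sx p) : a • f ∈ Sx p := by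
  rw [MvPolynomial.smul_eq_C_mul]
  exact (Sx p).mul_mem (C_mem_Sx p ha) hf

lemma of_nat_mul_mem_Sx {n : ℕ} (hn : ¬ p ∣ n) {f : UU} (hf : (n : UU) * f ∈ Sx p) : f ∈ Sx p := by
  have h := smul_mem_Sx p (inv_mem_Kp p n hn) hf
  have h0 : (n : ℚ) ≠ 0 := by
    have : n ≠ 0 := by rintro rfl; simp at hn
    exact_mod_cast this
  have : (n : UU) = algebraMap ℚ UU n := by simp
  rw [this, ← Algebra.smul_def, smul_smul, inv_mul_cancel₀ h0, one_smul] at h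
  exact h

lemma XX_mem (n : ℕ) (hn : n ≠ 0) : XX n ∈ Sx p := by
  induction n using Nat.strong_induction_on with
  | _ n ih =>
    obtain ⟨j, s, hj, hj0, rfl⟩ := exists_js p n hn
    apply of_nat_mul_mem_Sx p hj
    cases s with
    | zero =>
      rw [pow_zero, mul_one] at *
      rw [XX_def j hj0]
      refine (Sx p).sub_mem ?_ ((Sx p).sum_mem fun d hd => ?_)
      · have := xx_ghost p j 0
        simp at this
        rw [this]
        exact xx_mem_Sx p j 0 hj
      · rw [Nat.mem_properDivisors] at hd
        exact (Sx p).mul_mem (natCast_mem _ _) ((Sx p).pow_mem (ih d hd.2 (by rintro rfl; simp at hd; omega)) _)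
    | succ s =>
      suffices h : Cg (Sx p) p (s + 1 + 0) ((p : UU) ^ (s + 1) * ((j : UU) * XX (j * p ^ (s + 1)))) from (Cg.cancel (hip p) h).mem
      rw [add_zero]
      have h1 := XX_def _ hn
      have h2 : (p : UU) ^ (s + 1) * ((j : UU) * XX (j * p ^ (s + 1))) = ((j * p ^ (s + 1) : ℕ) : UU) * XX (j * p ^ (s + 1)) := by
        push_cast; ring
      rw [h2, h1]
      set n' := j * p ^ s with hn'
      have hn'0 : n' ≠ 0 := mul_ne_zero hj0 (pow_ne_zero _ hp.out.ne_zero)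
      have hnn : j * p ^ (s + 1) = p * n' := by rw [hn']; ring
      rw [hnn]
      have h3 : (MvPolynomial.X (p * n') : UU) = ∑ d ∈ n'.divisors, (d : UU) * (fr p (XX d)) ^ (n' / d) := by
        have : fr p (MvPolynomial.X n') = (MvPolynomial.X (p * n') : UU) := by
          rw [fr, MvPolynomial.aeval_X]
        rw [← this, XX_sum n' hn'0, map_sum]
        simp
      have hsub : n'.divisors ⊆ (p * n').properDivisors := by
        intro d hd
        rw [Nat.mem_divisors] at hd
        rw [Nat.mem_properDivisors]
        refine ⟨hd.1.mul_left p, lt_of_le_of_lt (Nat.le_of_dvd (Nat.pos_of_ne_zero hn'0) hd.1) ?_⟩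
        have := hp.out.two_le
        have := Nat.pos_of_ne_zero hn'0
        nlinarith
      rw [h3, ← Finset.sum_sdiff hsub]
      have h4 : ∑ d ∈ n'.divisors, (d : UU) * (fr p (XX d)) ^ (n' / d) - (∑ d ∈ (p * n').properDivisors \ n'.divisors, (d : UU) * XX d ^ (p * n' / d) +
         ∑ d ∈ n'.divisors, (d : UU) * XX d ^ (p * n' / d)) = ∑ d ∈ n'.divisors, (d : UU) * ((fr p (XX d)) ^ (n' / d) - (XX d ^ p) ^ (n' / d)) 
           - ∑ d ∈ (p * n').properDivisors \ n'.divisors, (d : UU) * XX d ^ (p * n' / d) := by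
        have : ∀ d ∈ n'.divisors, (d : UU) * XX d ^ (p * n' / d) = (d : UU) * (XX d ^ p) ^ (n' / d) := by
          intro d hd
          rw [Nat.mem_divisors] at hd
          rw [Nat.mul_div_assoc _ hd.1, pow_mul]
        rw [Finset.sum_congr rfl this]
        simp only [mul_sub, Finset.sum_sub_distrib]
        ring
      rw [h4]
      have hmem : ∀ d ∈ (p * n').properDivisors, XX d ∈ Sx p := by
        intro d hd
        rw [Nat.mem_properDivisors] at hd
        refine ih d (by rw [hnn]; exact hd.2) ?_
        rintro rfl
        have := zero_dvd_iff.1 hd.1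
        exact (mul_ne_zero hp.out.ne_zero hn'0) this
      refine Cg.sub (Cg.sum _ _ fun d hd => ?_) (Cg.sum _ _ fun d hd => ?_)
      · have hm := hmem d (hsub hd)
        rw [Nat.mem_divisors] at hd
        obtain ⟨e, he⟩ := hd.1
        have hd0 : d ≠ 0 := by rintro rfl; simp at he; exact hn'0 he
        have he0 : e ≠ 0 := by rintro rfl; simp at he; exact hn'0 he
        obtain ⟨d1, a, hd1, hd10, hda⟩ := exists_js p d hd0
        obtain ⟨e1, b, he1, he10, heb⟩ := exists_js p e he0
        have hab : a + b = s := by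
          have h5 : padicValNat p n' = s := by rw [hn', mul_comm]; exact val_pm p hp.out s j hj
          have h6 : n' = p ^ (a + b) * (d1 * e1) := by rw [he, hda, heb]; ring
          rw [h6, val_pm p hp.out (a + b) (d1 * e1) (fun h => (hp.out.dvd_mul.1 h).elim hd1 he1)] at h5
          exact h5
        rw [he, Nat.mul_div_cancel_left _ (Nat.pos_of_ne_zero hd0)]
        have h7 := (fr_Sx p _ hm).2
        have h8 := h7.pow_pk hp.out le_rfl ((Sx p).pow_mem hm p) b
        have h9 := h8.pow_sub ((Sx p).pow_mem (fr_Sx p _ hm).1 _) ((Sx p).pow_mem ((Sx p).pow_mem hm p) _) e1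
        rw [← pow_mul, ← pow_mul, mul_comm (p ^ b), ← heb] at h9
        exact ((Cg.nat (Sx p) p a d ⟨d1, by rw [hda, mul_comm]⟩).mul h9).mono (by omega)
      · rw [Finset.mem_sdiff] at hd
        have hm := hmem d hd.1
        refine (Cg.nat (Sx p) p (s + 1) d ?_).mul_right ((Sx p).pow_mem hm _)
        have hdn := (Nat.mem_properDivisors.1 hd.1).1
        have h5 : ¬ d ∣ n' := fun h => hd.2 (Nat.mem_divisors.2 ⟨h, hn'0⟩)
        have hd0 : d ≠ 0 := by
          rintro rfl
          exact (mul_ne_zero hp.out.ne_zero hn'0) (zero_dvd_iff.1 hdn)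
        obtain ⟨d1, a, hd1, hd10, hda⟩ := exists_js p d hd0
        by_cases has : s + 1 ≤ a
        · exact (pow_dvd_pow p has).trans ⟨d1, by rw [hda, mul_comm]⟩
        exfalso
        apply h5
        rw [hda, hn']
        refine mul_dvd_mul ?_ (pow_dvd_pow p (by omega))
        have h6 : d1 ∣ p ^ (s + 1) * j := by
          refine (Dvd.intro _ hda.symm).trans (hdn.trans ?_)
          rw [← hnn, mul_comm]
        refine Nat.Coprime.dvd_of_dvd_mul_left ?_ h6
        exact ((Nat.Prime.coprime_iff_not_dvd hp.out).2 hd1).symm.pow_right _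

/-- complete symmetric functions -/
def hh (n : ℕ) : UU := hs (fun k => MvPolynomial.X k) n

lemma hh_mem (n : ℕ) : hh n ∈ Sx p := by
  have h := hs_geom_sum_mem (Sx p) (Finset.Icc 1 n) id (fun i hi => by simp at hi; exact Nat.one_le_iff_ne_zero.1 hi.1) XX (fun i hi => XX_mem p i (by simp at hi; omega)) n
  rw [hh]
  convert h using 1
  apply hs_congr
  intro k hk1 hkn
  rw [XX_sum k (by omega), ← Finset.sum_filter]
  refine Finset.sum_congr ?_ fun _ _ => rfl
  ext d
  simp only [Nat.mem_divisors, Finset.mem_filter, Finset.mem_Icc, id]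
  constructor
  · rintro ⟨h1, h2⟩
    have := Nat.le_of_dvd (by omega) h1
    have := Nat.pos_of_dvd_of_pos h1 (by omega)
    exact ⟨⟨by omega, by omega⟩, h1⟩
  · rintro ⟨h1, h2⟩
    exact ⟨h2, by omega⟩

end partC3

section partC4
open MvPolynomial (X C coeff pderiv monomial)
variable (p : ℕ) [hp : Fact p.Prime]

/-- `K[h]` -/
def Shh : Subring UU := (Algebra.adjoin (Kp p) {f : UU | ∃ k, f = hh k}).toSubring

lemma hh_mem_Shh (k : ℕ) : hh k ∈ Shh p := Algebra.subset_adjoin ⟨k, rfl⟩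

lemma C_mem_Shh {a : ℚ} (ha : a ∈ Kp p) : (C a : UU) ∈ Shh p := 
  Subalgebra.algebraMap_mem (Algebra.adjoin (Kp p) {f : UU | ∃ k, f = hh k}) ⟨a, ha⟩

lemma adjoin_hom_mem {B : Type*} [CommRing B] [Algebra ℚ B] (s : Set UU) (φ : UU →ₐ[ℚ] B) (R : Subring B) 
    (hC : ∀ a ∈ Kp p, algebraMap ℚ B a ∈ R) (hs : ∀ f ∈ s, φ f ∈ R) (f : UU) (hf : f ∈ Algebra.adjoin (Kp p) s) : φ f ∈ R := by
  induction hf using Algebra.adjoin_induction with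
  | mem x hx => exact hs x hx
  | algebraMap a =>
    have h1 : (algebraMap (Kp p) UU) a = algebraMap ℚ UU (a : ℚ) := rfl
    rw [h1, AlgHom.commutes]
    exact hC _ a.2
  | add a b ha hb iha ihb => rw [map_add]; exact R.add_mem iha ihb
  | mul a b ha hb iha ihb => rw [map_mul]; exact R.mul_mem iha ihb

lemma subx_mem (y : ℕ → UU) (R : Subring UU) (hC : ∀ a ∈ Kp p, (C a : UU) ∈ R) (hy : ∀ k, k ≠ 0 → y k ∈ R) (f : UU) (hf : f ∈ Sx p) :
    subx p y f ∈ R := by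
  refine adjoin_hom_mem p _ (subx p y) R hC ?_ f hf
  rintro f ⟨k, hk, rfl⟩
  rw [subx_xk p y k hk]
  exact hy k hk

lemma subx_X_of (y : ℕ → UU) (k : ℕ) (hk : k ≠ 0) (h : ∀ i, i ∣ k → y i = xk p i) : subx p y (X k) = X k := by
  obtain ⟨j, s, hj, hj0, rfl⟩ := exists_js p k hk
  rw [subx_X p y j s hj, xx_ghost]
  refine Finset.sum_congr rfl fun t ht => ?_
  rw [Finset.mem_range] at ht
  rw [h (j * p ^ t) (mul_dvd_mul_left _ (pow_dvd_pow p (by omega))), xk_mul p j t hj]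

lemma hh_newton (n : ℕ) : ((n : UU) + 1) * hh (n + 1) = ∑ i ∈ Finset.range (n + 1), X (i + 1) * hh (n - i) := hs_newton _ n

lemma hh_fix (θ : UU →ₐ[ℚ] UU) (n : ℕ) (h : ∀ k, k ≠ 0 → k ≤ n → θ (X k) = X k) : θ (hh n) = hh n := by
  rw [hh, hs_map]
  exact hs_congr _ _ _ fun k h1 h2 => h k (by omega) h2

lemma xk_mem_Shh (n : ℕ) (hn : n ≠ 0) : xk p n ∈ Shh p := by
  induction n using Nat.strong_induction_on with
  | _ n ih =>
    obtain ⟨j, s, hj, hj0, hjs⟩ := exists_js p n hn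
    let y : ℕ → UU := fun k => if k < n then xk p k else 0
    have h1 : ∀ k, k ≠ 0 → k < n → subx p y (X k) = X k := by
      intro k hk hkn
      apply subx_X_of p y k hk
      intro i hi
      have := Nat.le_of_dvd (Nat.pos_of_ne_zero hk) hi
      exact if_pos (by omega)
    have h2 : subx p y (X n) = X n - (p : UU) ^ s * xk p n := by
      rw [hjs, subx_X p y j s hj, xx_ghost, Finset.sum_range_succ, Finset.sum_range_succ, xk_mul p j s hj]
      have : y (j * p ^ s) = 0 := if_neg (by rw [← hjs]; exact lt_irrefl _)
      rw [this]
      have h3 : ∀ t ∈ Finset.range s, (p : UU) ^ t * y (j * p ^ t) ^ p ^ (s - t) = (p : UU) ^ t * xx p j t ^ p ^ (s - t) := by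
        intro t ht
        rw [Finset.mem_range] at ht
        have : y (j * p ^ t) = xk p (j * p ^ t) := if_pos (by
          rw [hjs]
          exact Nat.mul_lt_mul_of_pos_left (Nat.pow_lt_pow_right hp.out.one_lt ht) (Nat.pos_of_ne_zero hj0))
        rw [this, xk_mul p j t hj]
      rw [Finset.sum_congr rfl h3]
      simp
    set g : UU := (j : UU) * hh n - xk p n with hg
    have hgS : g ∈ Sx p := (Sx p).sub_mem ((Sx p).mul_mem (natCast_mem _ _) (hh_mem p n)) (xk_mem_Sx p n hn)
    have h3 : (p : UU) ^ s * (j : UU) * (hh n - subx p y (hh n)) = (p : UU) ^ s * xk p n := by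
      obtain ⟨m, rfl⟩ := Nat.exists_eq_succ_of_ne_zero hn
      have h4 := hh_newton m
      rw [Finset.sum_range_succ] at h4
      have h5 := congrArg (subx p y) h4
      rw [map_add, map_sum] at h5
      have h6 : ∀ i ∈ Finset.range m, subx p y (X (i + 1) * hh (m - i)) = X (i + 1) * hh (m - i) := by
        intro i hi
        rw [Finset.mem_range] at hi
        rw [map_mul, h1 (i + 1) (by omega) (by omega), hh_fix]
        intro k hk hk2
        exact h1 k hk (by omega)
      rw [Finset.sum_congr rfl h6, map_mul, map_mul, h2] at h5
      have h7 : (p : UU) ^ s * (j : UU) = (m : UU) + 1 := by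
        have : (((m + 1 : ℕ)) : UU) = ((j * p ^ s : ℕ) : UU) := congrArg Nat.cast hjs
        push_cast at this
        rw [this]; ring
      rw [h7]
      simp only [Nat.sub_self, map_add, map_natCast, map_one] at h5 h4
      have h8 : (hh 0 : UU) = 1 := hs_zero _
      rw [h8] at h4 h5
      rw [map_one] at h5
      simp only [Nat.succ_eq_add_one] at *
      linear_combination h4 - h5
    have h4 : (j : UU) * (hh n - subx p y (hh n)) = xk p n := by
      rw [mul_assoc] at h3
      exact pcancel (hip p) s h3
    have h5 : subx p y g = g := by
      rw [hg, map_sub, map_mul, map_natCast, subx_xk p y n hn, show y n = 0 from if_neg (lt_irrefl _)]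
      linear_combination -h4
    have h6 : g ∈ Shh p := by
      rw [← h5]
      refine subx_mem p y _ (fun a ha => C_mem_Shh p ha) ?_ g hgS
      intro k hk
      by_cases hkn : k < n
      · rw [show y k = xk p k from if_pos hkn]
        exact ih k hkn hk
      · rw [show y k = 0 from if_neg hkn]
        exact (Shh p).zero_mem
    have : xk p n = (j : UU) * hh n - g := by rw [hg]; ring
    rw [this]
    exact (Shh p).sub_mem ((Shh p).mul_mem (natCast_mem _ _) (hh_mem_Shh p n)) h6

lemma Sx_le_Shh {f : UU} (hf : f ∈ Sx p) : f ∈ Shh p := by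
  have := adjoin_hom_mem p _ (AlgHom.id ℚ UU) (Shh p) (fun a ha => C_mem_Shh p ha) (by rintro f ⟨k, hk, rfl⟩; exact xk_mem_Shh p k hk) f hf
  simpa using this

lemma Shh_le_Sx {f : UU} (hf : f ∈ Shh p) : f ∈ Sx p := by
  have := adjoin_hom_mem p _ (AlgHom.id ℚ UU) (Sx p) (fun a ha => C_mem_Sx p ha) (by rintro f ⟨k, rfl⟩; exact hh_mem p k) f hf
  simpa using this

section ev
variable (ι : Type*) [Fintype ι]

/-- evaluation in finitely many variables -/
def evv : UU →ₐ[ℚ] MvPolynomial ι ℚ := MvPolynomial.aeval fun k => if k = 0 then 0 else ∑ i, X i ^ k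

/-- polynomials with coefficients in `K` -/
def KT : Subring (MvPolynomial ι ℚ) := (MvPolynomial.map (Kp p).subtype).range

lemma coeff_KT {f : MvPolynomial ι ℚ} (hf : f ∈ KT p ι) (a : ι →₀ ℕ) : coeff a f ∈ Kp p := by
  obtain ⟨g, rfl⟩ := hf
  rw [MvPolynomial.coeff_map]
  exact (coeff a g).2

lemma evv_hh (n : ℕ) : evv ι (hh n) ∈ KT p ι := by
  rw [hh, hs_map]
  have h := hs_geom_sum_mem (KT p ι) (Finset.univ : Finset ι) (fun _ => 1) (fun i hi => by simp) (fun i => X i) (fun i hi => ⟨X i, by simp⟩) n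
  convert h using 1
  apply hs_congr
  intro k hk _
  have hk0 : k ≠ 0 := by omega
  simp [evv, hk0]

lemma evv_mem {f : UU} (hf : f ∈ Sx p) : evv ι f ∈ KT p ι := by
  refine adjoin_hom_mem p _ (evv ι) (KT p ι) (fun a ha => ⟨C ⟨a, ha⟩, by simp⟩) ?_ f (Sx_le_Shh p hf)
  rintro f ⟨k, rfl⟩
  exact evv_hh p ι k
end ev

/-- the number `z_ν` -/
def zF (ν : ℕ →₀ ℕ) : ℚ := ν.prod fun k m => (k : ℚ) ^ m * (m.factorial : ℚ)

lemma zF_add (ν : ℕ →₀ ℕ) (k : ℕ) : zF (ν + Finsupp.single k 1) = zF ν * (k * (ν k + 1)) := by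
  have h : ∀ μ : ℕ →₀ ℕ, ∀ s : Finset ℕ, μ.support ⊆ s → zF μ = ∏ i ∈ s, ((i : ℚ) ^ μ i * ((μ i).factorial : ℚ)) := by
    intro μ s hs
    exact Finsupp.prod_of_support_subset _ hs _ (by simp)
  rw [h ν (insert k ν.support) (Finset.subset_insert _ _), h (ν + Finsupp.single k 1) (insert k ν.support) (by
    intro i hi
    by_cases hik : i = k
    · simp [hik]
    · have : Finsupp.single k 1 i = 0 := by rw [Finsupp.single_apply, if_neg (Ne.symm hik)]
      simp [this] at hi
      simp [hi])]
  rw [← Finset.mul_prod_erase (insert k ν.support) _ (Finset.mem_insert_self _ _), ← Finset.mul_prod_erase (insert k ν.support) _ (Finset.mem_insert_self _ _)]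
  have : ∏ i ∈ (insert k ν.support).erase k, ((i : ℚ) ^ ((ν + Finsupp.single k 1 : ℕ →₀ ℕ) i) * (((ν + Finsupp.single k 1 : ℕ →₀ ℕ) i).factorial : ℚ)) =
    ∏ i ∈ (insert k ν.support).erase k, ((i : ℚ) ^ ν i * ((ν i).factorial : ℚ)) := by
    refine Finset.prod_congr rfl fun i hi => ?_
    have h1 := Finset.ne_of_mem_erase hi
    have : Finsupp.single k 1 i = 0 := by rw [Finsupp.single_apply, if_neg (Ne.symm h1)]
    simp [this]
  rw [this]
  simp only [Finsupp.add_apply, Finsupp.single_eq_same, pow_succ, Nat.factorial_succ]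
  push_cast
  ring

/-- `k ∂/∂p_k` -/
def Dk (k : ℕ) : Derivation ℚ UU UU := (k : ℚ) • pderiv k

lemma zF_coeff (ν : ℕ →₀ ℕ) (k : ℕ) (f : UU) : zF (ν + Finsupp.single k 1) * coeff (ν + Finsupp.single k 1) f = zF ν * coeff ν (Dk k f) := by
  rw [Dk, Derivation.smul_apply, MvPolynomial.coeff_smul, MvPolynomial.coeff_pderiv, zF_add, smul_eq_mul]
  ring

lemma Dk_X (k i : ℕ) : Dk k (X i) = if i = k then (k : UU) else 0 := by
  rw [Dk, Derivation.smul_apply]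
  split_ifs with h
  · rw [h, MvPolynomial.pderiv_X_self, Algebra.smul_def]; simp
  · rw [MvPolynomial.pderiv_X_of_ne h, smul_zero]

lemma Dk_hh (k : ℕ) (hk : k ≠ 0) (n : ℕ) : Dk k (hh n) = if k ≤ n then hh (n - k) else 0 := by
  induction n using Nat.strong_induction_on with
  | _ n ih =>
    cases n with
    | zero =>
      have h8 : (hh 0 : UU) = 1 := hs_zero _
      rw [h8, if_neg (by omega), Derivation.map_one_eq_zero]
    | succ n =>
      have h1 := congrArg (Dk k) (hh_newton n)
      rw [Derivation.leibniz, map_sum] at h1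
      have h2 : Dk k ((n : UU) + 1) = 0 := by
        rw [map_add, Derivation.map_natCast, Derivation.map_one_eq_zero, add_zero]
      rw [h2, smul_zero, add_zero] at h1
      have h3 : ∀ i ∈ Finset.range (n + 1), Dk k (X (i + 1) * hh (n - i)) =
          X (i + 1) * (if k ≤ n - i then hh (n - i - k) else 0) + if i + 1 = k then (k : UU) * hh (n - i) else 0 := by
        intro i hi
        rw [Derivation.leibniz, ih (n - i) (by omega), Dk_X]
        simp only [smul_eq_mul]
        split_ifs <;> ring
      rw [Finset.sum_congr rfl h3, Finset.sum_add_distrib] at h1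
      have hne : ((n : UU) + 1) ≠ 0 := by exact_mod_cast Nat.succ_ne_zero n
      apply mul_left_cancel₀ hne
      rw [← smul_eq_mul, h1]
      by_cases hkn : k ≤ n + 1
      · rw [if_pos hkn]
        obtain ⟨m, rfl⟩ : ∃ m, k = m + 1 := ⟨k - 1, by omega⟩
        have h4 : ∑ i ∈ Finset.range (n + 1), (if i + 1 = m + 1 then ((m + 1 : ℕ) : UU) * hh (n - i) else 0) = ((m + 1 : ℕ) : UU) * hh (n - m) := by
          rw [Finset.sum_eq_single m]
          · simp
          · intro b _ hb; rw [if_neg (by omega)]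
          · intro h; simp at h; omega
        rw [h4]
        have h5 : ∑ i ∈ Finset.range (n + 1), X (i + 1) * (if m + 1 ≤ n - i then hh (n - i - (m + 1)) else 0) =
          ((n - m : ℕ) : UU) * hh (n - m) := by
          obtain ⟨c, hc⟩ : ∃ c, n = m + c := ⟨n - m, by omega⟩
          subst hc
          rw [Nat.add_sub_cancel_left]
          cases c with
          | zero =>
            simp only [Nat.cast_zero, zero_mul]
            apply Finset.sum_eq_zero
            intro i hi
            rw [if_neg (by omega), mul_zero]
          | succ c =>
            push_cast
            rw [hh_newton c]
            symm
            rw [← Finset.sum_subset (Finset.range_subset_range.2 (show c + 1 ≤ m + (c + 1) + 1 by omega))]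
            · refine Finset.sum_congr rfl fun i hi => ?_
              rw [Finset.mem_range] at hi
              rw [if_pos (by omega)]
              congr 2
              omega
            · intro i hi hi2
              rw [Finset.mem_range] at hi hi2
              rw [if_neg (by omega), mul_zero]
        rw [h5, show n + 1 - (m + 1) = n - m by omega, ← add_mul]
        congr 1
        have : ((n - m + (m + 1) : ℕ) : UU) = ((n + 1 : ℕ) : UU) := by congr 1; omega
        push_cast at this ⊢
        exact this
      · rw [if_neg hkn, mul_zero]
        rw [Finset.sum_eq_zero, Finset.sum_eq_zero, add_zero]
        · intro i hi
          rw [Finset.mem_range] at hi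
          rw [if_neg (by omega)]
        · intro i hi
          rw [if_neg (by omega), mul_zero]

lemma hh_const (n : ℕ) (hn : n ≠ 0) : coeff 0 (hh n) = 0 := by
  have h1 : coeff 0 (hh n) = (MvPolynomial.aeval (fun _ : ℕ => (0 : ℚ))) (hh n) := by
    rw [← MvPolynomial.constantCoeff_eq]
    have := MvPolynomial.aeval_zero' (R := ℚ) (S₁ := ℚ) (σ := ℕ) (hh n)
    rw [this]; rfl
  rw [h1, hh, hs_map]
  obtain ⟨m, rfl⟩ := Nat.exists_eq_succ_of_ne_zero hn
  rw [hs_succ]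
  simp

lemma deriv_prod {ι : Type*} (D : Derivation ℚ UU UU) (s : Finset ι) (f : ι → UU) :
    D (∏ i ∈ s, f i) = ∑ i ∈ s, D (f i) * ∏ j ∈ s.erase i, f j := by
  induction s using Finset.induction_on with
  | empty => simp
  | insert a s ha ih =>
    rw [Finset.prod_insert ha, Derivation.leibniz, ih, Finset.sum_insert ha, Finset.erase_insert ha, smul_eq_mul, smul_eq_mul, Finset.mul_sum,
      add_comm, mul_comm]
    congr 1
    refine Finset.sum_congr rfl fun i hi => ?_
    have hia : i ≠ a := by rintro rfl; exact ha hi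
    rw [Finset.erase_insert_of_ne hia.symm, Finset.prod_insert (fun h => ha (Finset.mem_of_mem_erase h))]
    ring

lemma Dk_prod {ι : Type*} [Fintype ι] (a : ι →₀ ℕ) (k : ℕ) (hk : k ≠ 0) :
    Dk k (∏ i, hh (a i)) = ∑ i, if k ≤ a i then ∏ j, hh ((a - Finsupp.single i k : ι →₀ ℕ) j) else 0 := by
  rw [deriv_prod]
  refine Finset.sum_congr rfl fun i _ => ?_
  rw [Dk_hh k hk]
  split_ifs with h
  · rw [← Finset.mul_prod_erase Finset.univ (fun j => hh ((a - Finsupp.single i k : ι →₀ ℕ) j)) (Finset.mem_univ i)]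
    simp only [Finsupp.tsub_apply, Finsupp.single_eq_same]
    congr 1
    refine Finset.prod_congr rfl fun j hj => ?_
    rw [Finsupp.single_apply, if_neg (Ne.symm (Finset.ne_of_mem_erase hj)), Nat.sub_zero]
  · rw [zero_mul]

lemma pairing {ι : Type*} [Fintype ι] (ν : ℕ →₀ ℕ) (h0 : ν 0 = 0) (a : ι →₀ ℕ) :
    zF ν * coeff ν (∏ i, hh (a i)) = coeff a (evv ι (monomial ν 1)) := by
  generalize hN : (ν.sum fun _ m => m) = N
  induction N generalizing ν a with
  | zero =>
    have hν : ν = 0 := by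
      ext i
      by_contra h
      have h1 : i ∈ ν.support := Finsupp.mem_support_iff.2 h
      have := Finset.sum_eq_zero_iff.1 hN i h1
      exact h this
    subst hν
    have h1 : evv ι (monomial (0 : ℕ →₀ ℕ) (1 : ℚ)) = 1 := by
      have : (monomial (0 : ℕ →₀ ℕ) (1 : ℚ)) = 1 := rfl
      rw [this, map_one]
    have h2 : zF 0 = 1 := by simp [zF]
    rw [h1, h2, one_mul, MvPolynomial.coeff_one, ← MvPolynomial.constantCoeff_eq, map_prod]
    split_ifs with h
    · rw [← h]
      apply Finset.prod_eq_one
      intro i _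
      have h8 : (hh 0 : UU) = 1 := hs_zero _
      rw [Finsupp.zero_apply, h8, map_one]
    · obtain ⟨i, hi⟩ : ∃ i, a i ≠ 0 := by
        by_contra hc
        push Not at hc
        exact h (Finsupp.ext fun i => (hc i).symm)
      apply Finset.prod_eq_zero (Finset.mem_univ i)
      rw [MvPolynomial.constantCoeff_eq]
      exact hh_const _ hi
  | succ N ih =>
    obtain ⟨k, hk⟩ : ∃ k, ν k ≠ 0 := by
      by_contra hc
      push Not at hc
      have : ν = 0 := Finsupp.ext hc
      rw [this] at hN
      simp at hN
    have hk0 : k ≠ 0 := by rintro rfl; exact hk h0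
    obtain ⟨μ, rfl⟩ : ∃ μ, ν = μ + Finsupp.single k 1 := by
      refine ⟨ν - Finsupp.single k 1, ?_⟩
      rw [tsub_add_cancel_of_le]
      rw [Finsupp.single_le_iff]
      omega
    rw [Finsupp.sum_add_index' (by simp) (by simp), Finsupp.sum_single_index rfl] at hN
    have hμ0 : μ 0 = 0 := by
      rw [Finsupp.add_apply] at h0; omega
    rw [zF_coeff, Dk_prod a k hk0, MvPolynomial.coeff_sum, Finset.mul_sum]
    have h1 : (monomial (μ + Finsupp.single k 1) (1 : ℚ)) = X k * monomial μ 1 := by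
      rw [MvPolynomial.X, MvPolynomial.monomial_mul, add_comm, one_mul]
    have h2 : evv ι (X k) = ∑ i, X i ^ k := by rw [evv, MvPolynomial.aeval_X, if_neg hk0]
    rw [h1, map_mul, h2, Finset.sum_mul, MvPolynomial.coeff_sum]
    refine Finset.sum_congr rfl fun i _ => ?_
    rw [MvPolynomial.X_pow_eq_monomial, MvPolynomial.coeff_monomial_mul', one_mul]
    simp only [Finsupp.single_le_iff]
    split_ifs with h
    · exact ih μ hμ0 _ (by omega)
    · simp

lemma evv_monomial_zero {ι : Type*} [Fintype ι] (ν : ℕ →₀ ℕ) (h0 : ν 0 ≠ 0) : evv ι (monomial ν 1) = 0 := by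
  obtain ⟨μ, rfl⟩ : ∃ μ, ν = μ + Finsupp.single 0 1 := by
    refine ⟨ν - Finsupp.single 0 1, ?_⟩
    rw [tsub_add_cancel_of_le]
    rw [Finsupp.single_le_iff]
    omega
  have h1 : (monomial (μ + Finsupp.single 0 1) (1 : ℚ)) = X 0 * monomial μ 1 := by
    rw [MvPolynomial.X, MvPolynomial.monomial_mul, add_comm, one_mul]
  rw [h1, map_mul, evv, MvPolynomial.aeval_X, if_pos rfl, zero_mul]

end partC4

section partD1
open MvPolynomial (X C coeff pderiv monomial)

lemma cycM_eq {n : ℕ} (g : Equiv.Perm (Fin n)) : cycM g = g.partition.parts := by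
  rw [Equiv.Perm.parts_partition, cycM, Fintype.card_fin]

lemma cycM_sum {n : ℕ} (g : Equiv.Perm (Fin n)) : (cycM g).sum = n := by
  rw [cycM_eq, g.partition.parts_sum, Fintype.card_fin]

lemma cycM_pos {n : ℕ} (g : Equiv.Perm (Fin n)) : ∀ i ∈ cycM g, 0 < i := by
  rw [cycM_eq]; intro i hi; exact g.partition.parts_pos hi

lemma cycM_inv {n : ℕ} (g : Equiv.Perm (Fin n)) : cycM g⁻¹ = cycM g := by
  rw [cycM, cycM, Equiv.Perm.cycleType_inv, Equiv.Perm.support_inv]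

/-- the partition attached to a permutation -/
def cycP {n : ℕ} (g : Equiv.Perm (Fin n)) : Nat.Partition n := ⟨cycM g, fun {i} hi => cycM_pos g i hi, cycM_sum g⟩

lemma filter_cycM {n : ℕ} (g : Equiv.Perm (Fin n)) : (cycM g).filter (fun i => 2 ≤ i) = g.cycleType := by
  rw [cycM_eq, Equiv.Perm.filter_parts_partition_eq_cycleType]

lemma part_decomp (μ : Multiset ℕ) (h : ∀ i ∈ μ, 0 < i) : μ = μ.filter (fun i => 2 ≤ i) + Multiset.replicate (μ.count 1) 1 := by
  ext i
  rw [Multiset.count_add, Multiset.count_filter, Multiset.count_replicate]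
  by_cases h1 : i = 1
  · subst h1; simp
  · rw [if_neg (fun h : 1 = i => h1 h.symm)]
    by_cases h2 : 2 ≤ i
    · rw [if_pos h2, add_zero]
    · rw [if_neg h2]
      have : i = 0 := by omega
      subst this
      rw [Multiset.count_eq_zero.2 (fun h3 => lt_irrefl _ (h 0 h3))]

lemma zF_eq (μ : Multiset ℕ) : zF μ.toFinsupp = ∏ i ∈ μ.toFinset, ((i : ℚ) ^ μ.count i * ((μ.count i).factorial : ℚ)) := rfl

lemma zF_ne (μ : Multiset ℕ) (h : 0 ∉ μ) : zF μ.toFinsupp ≠ 0 := by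
  rw [zF_eq, Finset.prod_ne_zero_iff]
  intro i hi
  rw [Multiset.mem_toFinset] at hi
  have : i ≠ 0 := by rintro rfl; exact h hi
  have h1 : (i : ℚ) ≠ 0 := by exact_mod_cast this
  have h2 : ((μ.count i).factorial : ℚ) ≠ 0 := by exact_mod_cast Nat.factorial_ne_zero _
  exact mul_ne_zero (pow_ne_zero _ h1) h2

lemma class_card {n : ℕ} (ν : Nat.Partition n) : 
    ((Finset.univ.filter (fun g : Equiv.Perm (Fin n) => cycP g = ν)).card : ℚ) * zF ν.parts.toFinsupp = (n.factorial : ℚ) := by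
  have hpos : ∀ i ∈ ν.parts, 0 < i := fun i hi => ν.parts_pos hi
  set m := ν.parts.filter (fun i => 2 ≤ i) with hm
  have hdec := part_decomp ν.parts hpos
  rw [← hm] at hdec
  have hsum : m.sum + ν.parts.count 1 = n := by
    have := congrArg Multiset.sum hdec
    rw [ν.parts_sum, Multiset.sum_add, Multiset.sum_replicate] at this
    simpa using this.symm
  have h1 : (Finset.univ.filter (fun g : Equiv.Perm (Fin n) => cycP g = ν)) = Finset.univ.filter (fun g => g.cycleType = m) := by
    ext g
    simp only [Finset.mem_filter, Finset.mem_univ, true_and]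
    constructor
    · rintro rfl
      rw [← filter_cycM, hm]; rfl
    · intro h
      rw [Nat.Partition.ext_iff]
      change cycM g = ν.parts
      have h2 : (cycM g).filter (fun i => 2 ≤ i) = m := by rw [filter_cycM, h]
      have h3 := part_decomp (cycM g) (cycM_pos g)
      rw [h2] at h3
      have h4 : m.sum + (cycM g).count 1 = n := by
        have := congrArg Multiset.sum h3
        rw [cycM_sum, Multiset.sum_add, Multiset.sum_replicate] at this
        simpa using this.symm
      have : (cycM g).count 1 = ν.parts.count 1 := by omega
      rw [h3, this, ← hdec]
  rw [h1]
  have h2 := Equiv.Perm.card_of_cycleType_mul_eq (Fin n) m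
  rw [if_pos ⟨by rw [Fintype.card_fin]; omega, by intro a ha; rw [hm, Multiset.mem_filter] at ha; exact ha.2⟩, Fintype.card_fin] at h2
  have h3 : zF ν.parts.toFinsupp = (((n - m.sum).factorial * m.prod * (∏ i ∈ m.toFinset, (m.count i).factorial) : ℕ) : ℚ) := by
    rw [zF_eq]
    have h4 : ∀ i ∈ m.toFinset, m.count i = ν.parts.count i := by
      intro i hi
      rw [Multiset.mem_toFinset, hm, Multiset.mem_filter] at hi
      rw [hm, Multiset.count_filter_of_pos hi.2]
    have h5 : ∏ i ∈ insert 1 m.toFinset, ((i : ℚ) ^ ν.parts.count i * ((ν.parts.count i).factorial : ℚ)) = 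
      ∏ i ∈ ν.parts.toFinset, ((i : ℚ) ^ ν.parts.count i * ((ν.parts.count i).factorial : ℚ)) := by
      symm
      apply Finset.prod_subset
      · intro i hi
        rw [Multiset.mem_toFinset] at hi
        rw [Finset.mem_insert, Multiset.mem_toFinset, hm, Multiset.mem_filter]
        have := hpos i hi
        by_cases h : i = 1
        · left; exact h
        · right; exact ⟨hi, by omega⟩
      · intro i _ hi
        rw [Multiset.mem_toFinset] at hi
        rw [Multiset.count_eq_zero.2 hi]; simp
    rw [← h5, Finset.prod_insert (by simp [hm]), show n - m.sum = ν.parts.count 1 by omega, Finset.prod_mul_distrib, Finset.prod_multiset_count m]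
    push_cast
    have h6 : ∏ i ∈ m.toFinset, (i : ℚ) ^ m.count i = ∏ i ∈ m.toFinset, (i : ℚ) ^ ν.parts.count i :=
      Finset.prod_congr rfl fun i hi => by rw [h4 i hi]
    have h7 : ∏ i ∈ m.toFinset, ((m.count i).factorial : ℚ) = ∏ i ∈ m.toFinset, ((ν.parts.count i).factorial : ℚ) :=
      Finset.prod_congr rfl fun i hi => by rw [h4 i hi]
    rw [h6, h7]
    simp [mul_assoc]
  rw [h3, ← Nat.cast_mul]
  congr 1

/-- class function attached to a symmetric function -/
def Phi (n : ℕ) : UU →ₗ[ℚ] (Equiv.Perm (Fin n) → ℚ) where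
  toFun f g := zF (cycM g).toFinsupp * coeff (cycM g).toFinsupp f
  map_add' := by intro f g; funext x; simp [mul_add]
  map_smul' := by intro c f; funext x; simp; ring

lemma Phi_apply (n : ℕ) (f : UU) (g : Equiv.Perm (Fin n)) : Phi n f g = zF (cycM g).toFinsupp * coeff (cycM g).toFinsupp f := rfl

lemma sp_Phi (n : ℕ) (f h : UU) : sp (Phi n f) (Phi n h) = 
    ∑ ν : Nat.Partition n, zF ν.parts.toFinsupp * (coeff ν.parts.toFinsupp f * coeff ν.parts.toFinsupp h) := by
  rw [sp]
  have h1 : ∀ g : Equiv.Perm (Fin n), Phi n f g * Phi n h g⁻¹ = 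
    (fun ν : Nat.Partition n => zF ν.parts.toFinsupp * zF ν.parts.toFinsupp * (coeff ν.parts.toFinsupp f * coeff ν.parts.toFinsupp h)) (cycP g) := by
    intro g
    rw [Phi_apply, Phi_apply, cycM_inv]
    change _ = zF (cycM g).toFinsupp * zF (cycM g).toFinsupp * (coeff (cycM g).toFinsupp f * coeff (cycM g).toFinsupp h)
    ring
  rw [Finset.sum_congr rfl fun g _ => h1 g, ← Finset.sum_fiberwise_of_maps_to (s := Finset.univ) (t := Finset.univ) (g := cycP) (fun _ _ => Finset.mem_univ _), Finset.mul_sum]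
  refine Finset.sum_congr rfl fun ν _ => ?_
  have h2 : ∀ g ∈ Finset.univ.filter (fun g : Equiv.Perm (Fin n) => cycP g = ν), (fun ν : Nat.Partition n => zF ν.parts.toFinsupp * zF ν.parts.toFinsupp * (coeff ν.parts.toFinsupp f * coeff ν.parts.toFinsupp h)) (cycP g) = 
    zF ν.parts.toFinsupp * zF ν.parts.toFinsupp * (coeff ν.parts.toFinsupp f * coeff ν.parts.toFinsupp h) := by
    intro g hg
    rw [Finset.mem_filter] at hg
    rw [hg.2]
  rw [Finset.sum_congr rfl h2, Finset.sum_const, nsmul_eq_mul, Fintype.card_perm, Fintype.card_fin]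
  have h3 := class_card ν
  have h4 : (n.factorial : ℚ) ≠ 0 := by exact_mod_cast Nat.factorial_ne_zero _
  rw [inv_mul_eq_iff_eq_mul₀ h4, ← h3]
  ring

lemma exists_cycP {n : ℕ} (ν : Nat.Partition n) : ∃ g : Equiv.Perm (Fin n), cycP g = ν := by
  by_contra hc
  push Not at hc
  have h := class_card ν
  rw [Finset.filter_eq_empty_iff.2 (fun g _ => hc g), Finset.card_empty, Nat.cast_zero, zero_mul] at h
  exact Nat.factorial_ne_zero n (by exact_mod_cast h.symm)

/-- weighted homogeneity -/
abbrev Hom (f : UU) (n : ℕ) : Prop := MvPolynomial.IsWeightedHomogeneous (id : ℕ → ℕ) f n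

lemma hom_X (k : ℕ) : Hom (X k) k := MvPolynomial.isWeightedHomogeneous_X ℚ id k

lemma hom_smul {f : UU} {n : ℕ} (c : ℚ) (h : Hom f n) : Hom (c • f) n := 
  (MvPolynomial.weightedHomogeneousSubmodule ℚ id n).smul_mem c h

lemma hom_hh (n : ℕ) : Hom (hh n) n := by
  induction n using Nat.strong_induction_on with
  | _ n ih =>
    cases n with
    | zero => rw [hh, hs_zero]; exact MvPolynomial.isWeightedHomogeneous_one ℚ _
    | succ n =>
      rw [hh, hs_succ]
      apply hom_smul
      apply MvPolynomial.IsWeightedHomogeneous.sum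
      intro i hi
      rw [Finset.mem_range] at hi
      have := (hom_X (i + 1)).mul (ih (n - i) (by omega))
      rwa [show i + 1 + (n - i) = n + 1 by omega] at this

lemma hom_xx (p : ℕ) [hp : Fact p.Prime] (j s : ℕ) : Hom (xx p j s) (j * p ^ s) := by
  induction s using Nat.strong_induction_on with
  | _ s ih =>
    rw [xx, wc, ip, ← map_pow, ← MvPolynomial.smul_eq_C_mul]
    apply hom_smul
    refine (hom_X _).sub ?_
    apply MvPolynomial.IsWeightedHomogeneous.sum
    intro t _
    rw [← map_natCast (MvPolynomial.C : ℚ →+* UU), ← map_pow, ← MvPolynomial.smul_eq_C_mul]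
    apply hom_smul
    have := (ih t t.2).pow (p ^ (s - t))
    have h2 : p ^ (s - (t : ℕ)) • (j * p ^ (t : ℕ)) = j * p ^ s := by
      rw [smul_eq_mul, mul_left_comm, ← pow_add, Nat.sub_add_cancel t.2.le]
    rw [h2] at this
    exact this

lemma hom_xk (p : ℕ) [hp : Fact p.Prime] (k : ℕ) (hk : k ≠ 0) : Hom (xk p k) k := by
  obtain ⟨j, s, hj, _, rfl⟩ := exists_js p k hk
  rw [xk_mul p j s hj]
  exact hom_xx p j s

lemma hom_mprod (m : Multiset ℕ) (f : ℕ → UU) (h : ∀ k ∈ m, Hom (f k) k) : Hom (m.map f).prod m.sum := by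
  induction m using Multiset.induction_on with
  | empty => simpa using MvPolynomial.isWeightedHomogeneous_one ℚ (id : ℕ → ℕ)
  | cons a m ih =>
    rw [Multiset.map_cons, Multiset.prod_cons, Multiset.sum_cons]
    exact (h a (by simp)).mul (ih fun k hk => h k (by simp [hk]))

lemma weight_toFinsupp (m : Multiset ℕ) : Finsupp.weight (id : ℕ → ℕ) m.toFinsupp = m.sum := by
  induction m using Multiset.induction_on with
  | empty => simp
  | cons a m ih =>
    rw [← Multiset.singleton_add, map_add, map_add, ih, Multiset.toFinsupp_singleton, Multiset.sum_add]
    simp [Finsupp.weight_single]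

lemma Phi_hom {f : UU} {m n : ℕ} (h : Hom f m) (hmn : m ≠ n) : Phi n f = 0 := by
  funext g
  rw [Phi_apply, h.coeff_eq_zero, mul_zero]; rfl
  rw [weight_toFinsupp, cycM_sum]
  exact fun h => hmn h.symm

end partD1

section partD2
open MvPolynomial (X C coeff pderiv monomial)

lemma prod_getD {M : Type*} [CommMonoid M] (L : List ℕ) (n : ℕ) (h : L.length = n) (F : ℕ → M) :
    ∏ j : Fin n, F (L.getD j 0) = (L.map F).prod := by
  subst h
  rw [← List.prod_ofFn]
  congr 1
  apply List.ext_getElem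
  · simp
  · intro i h1 h2
    simp at h2
    simp [h2]

lemma mprod_getD {M : Type*} [CommMonoid M] (m : Multiset ℕ) (F : ℕ → M) :
    ∏ j : Fin (Multiset.card m), F ((m.sort (· ≤ ·)).getD j 0) = (m.map F).prod := by
  rw [prod_getD _ _ (Multiset.length_sort _)]
  rw [← Multiset.prod_coe, ← Multiset.map_coe, Multiset.sort_eq]

/-- products of complete symmetric functions -/
def hM (m : Multiset ℕ) : UU := (m.map hh).prod

lemma hom_hM (m : Multiset ℕ) : Hom (hM m) m.sum := hom_mprod m hh fun k _ => hom_hh k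

lemma monomial_toFinsupp (m : Multiset ℕ) : (monomial m.toFinsupp (1 : ℚ) : UU) = (m.map X).prod := by
  induction m using Multiset.induction_on with
  | empty => simp
  | cons a m ih =>
    rw [Multiset.map_cons, Multiset.prod_cons, ← Multiset.singleton_add, map_add, Multiset.toFinsupp_singleton, ← ih, X, MvPolynomial.monomial_mul, one_mul]

lemma toFinsupp_surj (u : ℕ →₀ ℕ) : ∃ m : Multiset ℕ, u = m.toFinsupp := ⟨Finsupp.toMultiset u, by simp⟩

lemma Mcount_eq (lam nu : Multiset ℕ) (h0 : 0 ∉ nu) : (Mcount lam nu : ℚ) = zF nu.toFinsupp * coeff nu.toFinsupp (hM lam) := by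
  let a : Fin (Multiset.card lam) →₀ ℕ := Finsupp.equivFunOnFinite.symm fun i => (lam.sort (· ≤ ·)).getD i 0
  have h1 : hM lam = ∏ i, hh (a i) := (mprod_getD lam hh).symm
  rw [h1, pairing _ (by simpa using h0), monomial_toFinsupp, map_multiset_prod, Multiset.map_map, ← mprod_getD]
  have h2 : ∏ j : Fin (Multiset.card nu), (⇑(evv (Fin (Multiset.card lam))) ∘ X) ((nu.sort (· ≤ ·)).getD j 0) =
     ∏ j : Fin (Multiset.card nu), ∑ i : Fin (Multiset.card lam), (X i : MvPolynomial _ ℚ) ^ ((nu.sort (· ≤ ·)).getD j 0) := by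
    refine Finset.prod_congr rfl fun j _ => ?_
    have h3 : (nu.sort (· ≤ ·)).getD j 0 ≠ 0 := by
      have hj : (j : ℕ) < (nu.sort (· ≤ ·)).length := by rw [Multiset.length_sort]; exact j.2
      rw [List.getD_eq_getElem _ _ hj]
      intro h
      apply h0
      rw [← Multiset.mem_sort (· ≤ ·), ← h]
      exact List.getElem_mem _
    rw [Function.comp_apply, evv, MvPolynomial.aeval_X, if_neg h3]
  rw [h2, Finset.prod_univ_sum, MvPolynomial.coeff_sum]
  have h4 : ∀ f : Fin (Multiset.card nu) → Fin (Multiset.card lam), coeff a (∏ j, (X (f j) : MvPolynomial _ ℚ) ^ ((nu.sort (· ≤ ·)).getD j 0)) =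
    if (∀ i : Fin (Multiset.card lam), (∑ j ∈ Finset.univ.filter (fun j => f j = i), (nu.sort (· ≤ ·)).getD j 0)
        = (lam.sort (· ≤ ·)).getD i 0) then 1 else 0 := by
    intro f
    simp only [MvPolynomial.X_pow_eq_monomial]
    rw [← MvPolynomial.monomial_sum_one, MvPolynomial.coeff_monomial]
    congr 1
    rw [Finsupp.ext_iff]
    apply propext
    apply forall_congr'
    intro i
    rw [Finsupp.finset_sum_apply, Finset.sum_filter]
    simp only [Finsupp.single_apply]
    rfl
  rw [Finset.sum_congr rfl fun f _ => h4 f, ← Finset.sum_filter, Finset.sum_const, nsmul_eq_mul, mul_one, Mcount, Fintype.card_subtype]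
  congr 2

lemma pairing_sum {ι : Type*} [Fintype ι] (a : ι →₀ ℕ) (n : ℕ) (hn : ∑ i, a i = n) (g : UU) :
    ∑ ν : Nat.Partition n, zF ν.parts.toFinsupp * (coeff ν.parts.toFinsupp (∏ i, hh (a i)) * coeff ν.parts.toFinsupp g) = coeff a (evv ι g) := by
  have hhom : Hom (∏ i, hh (a i)) n := by
    have := MvPolynomial.IsWeightedHomogeneous.prod Finset.univ (fun i => hh (a i)) (fun i => a i) (w := (id : ℕ → ℕ)) (fun i _ => hom_hh (a i))
    rwa [hn] at this
  induction g using MvPolynomial.induction_on' with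
  | monomial u c =>
    have hc : (monomial u c : UU) = c • monomial u 1 := by rw [MvPolynomial.smul_monomial, smul_eq_mul, mul_one]
    rw [hc, map_smul, MvPolynomial.coeff_smul]
    by_cases h0 : u 0 = 0
    · rw [← pairing u h0]
      obtain ⟨m, rfl⟩ := toFinsupp_surj u
      have hm0 : 0 ∉ m := by simpa using h0
      by_cases hmn : m.sum = n
      · let μ : Nat.Partition n := ⟨m, fun {i} hi => Nat.pos_of_ne_zero (by rintro rfl; exact hm0 hi), hmn⟩
        rw [Finset.sum_eq_single μ]
        · rw [MvPolynomial.coeff_smul, MvPolynomial.coeff_monomial, if_pos rfl, smul_eq_mul, smul_eq_mul]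
          change zF m.toFinsupp * (coeff m.toFinsupp _ * _) = _
          ring
        · intro ν _ hν
          rw [MvPolynomial.coeff_smul, MvPolynomial.coeff_monomial, if_neg, smul_zero, mul_zero, mul_zero]
          intro h
          apply hν
          rw [Nat.Partition.ext_iff]
          exact (Multiset.toFinsupp.injective h).symm
        · simp
      · rw [hhom.coeff_eq_zero _ (by rw [weight_toFinsupp]; exact hmn), mul_zero, smul_zero]
        apply Finset.sum_eq_zero
        intro ν _
        rw [MvPolynomial.coeff_smul, MvPolynomial.coeff_monomial, if_neg, smul_zero, mul_zero, mul_zero]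
        intro h
        apply hmn
        rw [Multiset.toFinsupp.injective h, ν.parts_sum]
    · rw [evv_monomial_zero u h0, MvPolynomial.coeff_zero, smul_zero]
      apply Finset.sum_eq_zero
      intro ν _
      rw [MvPolynomial.coeff_smul, MvPolynomial.coeff_monomial, if_neg, smul_zero, mul_zero, mul_zero]
      rintro rfl
      apply h0
      rw [Multiset.toFinsupp_apply, Multiset.count_eq_zero]
      intro h
      exact lt_irrefl _ (ν.parts_pos h)
  | add f g hf hg =>
    rw [map_add, MvPolynomial.coeff_add, ← hf, ← hg, ← Finset.sum_add_distrib]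
    refine Finset.sum_congr rfl fun ν _ => ?_
    rw [MvPolynomial.coeff_add]; ring

variable (p : ℕ) [hp : Fact p.Prime]

lemma adjoin_span (y : ℕ → UU) (Q : ℕ → Prop) (s : Set UU) (hs : ∀ f ∈ s, ∃ k, Q k ∧ f = y k) (f : UU) (hf : f ∈ Algebra.adjoin (Kp p) s) :
    f ∈ Submodule.span (Kp p) {g : UU | ∃ m : Multiset ℕ, (∀ k ∈ m, Q k) ∧ g = (m.map y).prod} := by
  have h : f ∈ Subalgebra.toSubmodule (Algebra.adjoin (Kp p) s) := hf
  rw [Algebra.adjoin_eq_span] at h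
  refine Submodule.span_mono ?_ h
  intro g hg0
  have hg : g ∈ Submonoid.closure s := hg0
  clear hg0
  induction hg using Submonoid.closure_induction with
  | mem x hx =>
    obtain ⟨k, hk, rfl⟩ := hs x hx
    exact ⟨{k}, by simpa using hk, by simp⟩
  | one => exact ⟨0, by simp, by simp⟩
  | mul a b _ _ ha hb =>
    obtain ⟨m, hm, rfl⟩ := ha
    obtain ⟨m', hm', rfl⟩ := hb
    refine ⟨m + m', ?_, by simp⟩
    intro k hk
    rw [Multiset.mem_add] at hk
    exact hk.elim (hm k) (hm' k)

lemma sp_add_left {G : Type*} [Group G] [Fintype G] (f f' h : G → ℚ) : sp (f + f') h = sp f h + sp f' h := by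
  simp only [sp, Pi.add_apply, add_mul, Finset.sum_add_distrib, mul_add]

lemma sp_smul_left {G : Type*} [Group G] [Fintype G] (c : ℚ) (f h : G → ℚ) : sp (c • f) h = c * sp f h := by
  simp only [sp, Pi.smul_apply, smul_eq_mul, mul_assoc, ← Finset.mul_sum]
  ring

lemma sp_comm {G : Type*} [Group G] [Fintype G] (f h : G → ℚ) : sp f h = sp h f := by
  simp only [sp]
  congr 1
  rw [← Equiv.sum_comp (Equiv.inv G)]
  refine Finset.sum_congr rfl fun g _ => ?_
  simp [mul_comm]

/-- `sp` as a bilinear form -/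
def spB (G : Type*) [Group G] [Fintype G] : (G → ℚ) →ₗ[ℚ] (G → ℚ) →ₗ[ℚ] ℚ :=
  LinearMap.mk₂ ℚ sp sp_add_left (fun c f h => sp_smul_left c f h) 
    (fun f h h' => by rw [sp_comm, sp_add_left, sp_comm h, sp_comm h']) (fun c f h => by rw [sp_comm, sp_smul_left, sp_comm]; rfl)

lemma spB_apply {G : Type*} [Group G] [Fintype G] (f h : G → ℚ) : spB G f h = sp f h := rfl

lemma sp_hM (n : ℕ) (m : Multiset ℕ) (g : UU) (hg : g ∈ Sx p) : sp (Phi n (hM m)) (Phi n g) ∈ Kp p := by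
  by_cases hm : m.sum = n
  · rw [sp_Phi]
    let a : Fin (Multiset.card m) →₀ ℕ := Finsupp.equivFunOnFinite.symm fun i => (m.sort (· ≤ ·)).getD i 0
    have h1 : hM m = ∏ i, hh (a i) := (mprod_getD m hh).symm
    rw [h1, pairing_sum]
    · exact coeff_KT p _ (evv_mem p _ hg) a
    · have := mprod_getD m (fun k => Multiplicative.ofAdd k)
      have h2 := congrArg Multiplicative.toAdd this
      rw [toAdd_prod] at h2
      simp only [toAdd_ofAdd] at h2
      change ∑ i : Fin (Multiset.card m), (m.sort (· ≤ ·)).getD i 0 = n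
      rw [h2, toAdd_multiset_sum, Multiset.map_map]
      simpa using hm
  · rw [Phi_hom (hom_hM m) hm, ← spB_apply, map_zero, LinearMap.zero_apply]
    exact (Kp p).zero_mem

lemma sp_int (n : ℕ) (f g : UU) (hf : f ∈ Sx p) (hg : g ∈ Sx p) : sp (Phi n f) (Phi n g) ∈ Kp p := by
  have h := adjoin_span p hh (fun _ => True) _ (by rintro f ⟨k, rfl⟩; exact ⟨k, trivial, rfl⟩) f (Sx_le_Shh p hf)
  rw [← spB_apply]
  clear hf
  induction h using Submodule.span_induction with
  | mem x hx =>
    obtain ⟨m, _, rfl⟩ := hx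
    exact sp_hM p n m g hg
  | zero => rw [map_zero, map_zero, LinearMap.zero_apply]; exact (Kp p).zero_mem
  | add a b _ _ ha hb => rw [map_add, map_add, LinearMap.add_apply]; exact (Kp p).add_mem ha hb
  | smul c a _ ha =>
    have : c • a = (c : ℚ) • a := rfl
    rw [this, map_smul, map_smul, LinearMap.smul_apply]
    exact (Kp p).mul_mem c.2 ha

end partD2

section partD3
open MvPolynomial (X C coeff pderiv monomial)

lemma hM_filter (m : Multiset ℕ) : hM (m.filter (fun x => x ≠ 0)) = hM m := by
  induction m using Multiset.induction_on with
  | empty => simp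
  | cons a m ih =>
    by_cases ha : a = 0
    · subst ha
      rw [Multiset.filter_cons_of_neg _ (by simp), ih, hM, hM, Multiset.map_cons, Multiset.prod_cons, hh, hs_zero, one_mul]
    · rw [Multiset.filter_cons_of_pos _ (by simpa using ha)]
      simp only [hM, Multiset.map_cons, Multiset.prod_cons] at ih ⊢
      rw [ih]

lemma Phi_hM (n : ℕ) (m : Multiset ℕ) (g : Equiv.Perm (Fin n)) : Phi n (hM m) g = (Mcount m (cycM g) : ℚ) := by
  rw [Phi_apply, Mcount_eq]
  intro h
  exact lt_irrefl _ (cycM_pos g 0 h)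

/-- parts in decreasing order -/
def LL (lam : Multiset ℕ) : List ℕ := (lam.sort (· ≤ ·)).reverse

/-- the composition in the Jacobi-Trudi expansion -/
def aJT (lam : Multiset ℕ) (σ : Equiv.Perm (Fin (Multiset.card lam))) : Multiset ℕ :=
  Multiset.map (fun i : Fin (Multiset.card lam) => (LL lam).getD i 0 + (σ i : ℕ) - (i : ℕ)) Finset.univ.val

/-- the Jacobi-Trudi determinant -/
def sS (lam : Multiset ℕ) : UU := ∑ σ : Equiv.Perm (Fin (Multiset.card lam)),
   (((Equiv.Perm.sign σ : ℤ)) : ℚ) • (if ∀ i : Fin (Multiset.card lam), (i : ℕ) ≤ (LL lam).getD i 0 + (σ i : ℕ) then hM (aJT lam σ) else 0)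

lemma sFun_eq {n : ℕ} (lam : Nat.Partition n) : sFun lam = Phi n (sS lam.parts) := by
  funext g
  rw [sS, map_sum, Finset.sum_apply, sFun, sval]
  refine Finset.sum_congr rfl fun σ _ => ?_
  rw [map_smul, Pi.smul_apply, smul_eq_mul]
  congr 1
  have hc : (∀ i : Fin (Multiset.card lam.parts), (i : ℕ) ≤ ((lam.parts.sort (· ≤ ·)).reverse).getD i 0 + (σ i : ℕ)) ↔
     (∀ i : Fin (Multiset.card lam.parts), (i : ℕ) ≤ (LL lam.parts).getD i 0 + (σ i : ℕ)) := Iff.rfl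
  by_cases h : ∀ i : Fin (Multiset.card lam.parts), (i : ℕ) ≤ (LL lam.parts).getD i 0 + (σ i : ℕ)
  · rw [if_pos h, if_pos (hc.2 h), ← hM_filter, Phi_hM]
    rfl
  · rw [if_neg h, if_neg (fun h' => h (hc.1 h')), map_zero]; rfl

lemma LL_getD_map (lam : Multiset ℕ) : Multiset.map (fun i : Fin (Multiset.card lam) => (LL lam).getD i 0) Finset.univ.val = lam := by
  have h := prod_getD (M := Multiplicative (Multiset ℕ)) (LL lam) (Multiset.card lam) (by simp [LL]) (fun k => Multiplicative.ofAdd {k})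
  have h2 := congrArg Multiplicative.toAdd h
  rw [toAdd_prod] at h2
  simp only [toAdd_ofAdd] at h2
  have h3 : ∀ s : Multiset (Fin (Multiset.card lam)), Multiset.map (fun i : Fin (Multiset.card lam) => (LL lam).getD i 0) s = 
     (s.map fun i : Fin (Multiset.card lam) => ({(LL lam).getD i 0} : Multiset ℕ)).sum := by
    intro s
    induction s using Multiset.induction_on with
    | empty => simp
    | cons a s ih => rw [Multiset.map_cons, Multiset.map_cons, Multiset.sum_cons, ih, Multiset.singleton_add]
  rw [h3]
  refine Eq.trans h2 ?_
  have h4 : ∀ L : List ℕ, Multiplicative.toAdd (List.map (fun k => Multiplicative.ofAdd ({k} : Multiset ℕ)) L).prod = (L : Multiset ℕ) := by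
    intro L
    induction L with
    | nil => simp
    | cons a L ih =>
      rw [List.map_cons, List.prod_cons, toAdd_mul, toAdd_ofAdd, ih]; rfl
  rw [h4, LL, Multiset.coe_reverse, Multiset.sort_eq]

lemma aJT_one (lam : Multiset ℕ) : aJT lam 1 = lam := by
  conv_rhs => rw [← LL_getD_map lam]
  rw [aJT]
  refine Multiset.map_congr rfl fun i _ => ?_
  simp

lemma LL_anti (lam : Multiset ℕ) (i j : Fin (Multiset.card lam)) (h : i ≤ j) : (LL lam).getD j 0 ≤ (LL lam).getD i 0 := by
  have h1 : (LL lam).Pairwise (fun a b => b ≤ a) := by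
    rw [LL, List.pairwise_reverse]
    exact Multiset.pairwise_sort lam (· ≤ ·)
  have hl : (LL lam).length = Multiset.card lam := by simp [LL]
  rw [List.getD_eq_getElem _ _ (by rw [hl]; exact j.2), List.getD_eq_getElem _ _ (by rw [hl]; exact i.2)]
  rcases h.lt_or_eq with h | h
  · exact List.pairwise_iff_getElem.1 h1 _ _ _ _ h
  · subst h; exact le_rfl

/-- sum of squares -/
def ssq (m : Multiset ℕ) : ℕ := (m.map fun k => k ^ 2).sum

lemma aJT_sum (lam : Multiset ℕ) (σ : Equiv.Perm (Fin (Multiset.card lam))) 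
    (h : ∀ i : Fin (Multiset.card lam), (i : ℕ) ≤ (LL lam).getD i 0 + (σ i : ℕ)) : (aJT lam σ).sum = lam.sum := by
  have h1 : (aJT lam σ).sum = ∑ i : Fin (Multiset.card lam), ((LL lam).getD i 0 + (σ i : ℕ) - (i : ℕ)) := rfl
  have h2 : lam.sum = ∑ i : Fin (Multiset.card lam), (LL lam).getD i 0 := by
    conv_lhs => rw [← LL_getD_map lam]
    rfl
  have h3 : ∑ i : Fin (Multiset.card lam), ((LL lam).getD i 0 + (σ i : ℕ) - (i : ℕ)) + ∑ i : Fin (Multiset.card lam), (i : ℕ)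
     = ∑ i : Fin (Multiset.card lam), (LL lam).getD i 0 + ∑ i : Fin (Multiset.card lam), (σ i : ℕ) := by
    rw [← Finset.sum_add_distrib, ← Finset.sum_add_distrib]
    refine Finset.sum_congr rfl fun i _ => ?_
    have := h i
    omega
  rw [Equiv.sum_comp σ (fun i => (i : ℕ))] at h3
  rw [h1, h2]
  omega

lemma aJT_ssq (lam : Multiset ℕ) (σ : Equiv.Perm (Fin (Multiset.card lam))) (hσ : σ ≠ 1)
    (h : ∀ i : Fin (Multiset.card lam), (i : ℕ) ≤ (LL lam).getD i 0 + (σ i : ℕ)) : ssq lam < ssq (aJT lam σ) := by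
  have h1 : ssq (aJT lam σ) = ∑ i : Fin (Multiset.card lam), ((LL lam).getD i 0 + (σ i : ℕ) - (i : ℕ)) ^ 2 := by
    rw [ssq, aJT, Multiset.map_map]; rfl
  have h2 : ssq lam = ∑ i : Fin (Multiset.card lam), ((LL lam).getD i 0) ^ 2 := by
    conv_lhs => rw [← LL_getD_map lam]
    rw [ssq, Multiset.map_map]; rfl
  rw [h1, h2]
  let c : Fin (Multiset.card lam) → ℤ := fun i => ((LL lam).getD i 0 : ℤ) - (i : ℕ)
  have hc : StrictAnti c := by
    intro i j hij
    have := LL_anti lam i j hij.le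
    have h3 : (i : ℕ) < j := hij
    simp only [c]
    omega
  have key : ∑ i, c i * ((i : ℕ) : ℤ) < ∑ i, c i * ((σ i : ℕ) : ℤ) := by
    have hav : Antivary c (fun i : Fin (Multiset.card lam) => ((i : ℕ) : ℤ)) := by
      intro i j hij
      have hij' : ((i : ℕ) : ℤ) < ((j : ℕ) : ℤ) := hij
      have : (i : ℕ) < j := by exact_mod_cast hij'
      exact hc.antitone (Fin.le_of_lt this)
    refine (hav.sum_smul_lt_sum_smul_comp_perm_iff (σ := σ)).2 ?_
    intro hva
    apply hσ
    have hm : StrictMono σ := by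
      intro i j hij
      by_contra hcon
      have h5 : σ j < σ i := lt_of_le_of_ne (not_lt.1 hcon) (fun h => hij.ne' (σ.injective h))
      have := hva (i := j) (j := i) (by simpa using h5)
      exact absurd (hc hij) (not_lt.2 this)
    ext i
    have := congrArg (fun f : Fin (Multiset.card lam) ≃o Fin (Multiset.card lam) => f i) (Subsingleton.elim (StrictMono.orderIsoOfSurjective σ hm σ.surjective) (OrderIso.refl _))
    simpa using congrArg Fin.val this
  have h3 : (∑ i : Fin (Multiset.card lam), (((LL lam).getD i 0 + (σ i : ℕ) - (i : ℕ) : ℕ) : ℤ) ^ 2) = 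
     ∑ i, (c i + ((σ i : ℕ) : ℤ)) ^ 2 := by
    refine Finset.sum_congr rfl fun i _ => ?_
    rw [Nat.cast_sub (h i)]
    simp only [c]; push_cast; ring
  have h4 : (∑ i : Fin (Multiset.card lam), ((LL lam).getD i 0 : ℤ) ^ 2) = 
     ∑ i, (c i + ((i : ℕ) : ℤ)) ^ 2 := by
    refine Finset.sum_congr rfl fun i _ => ?_
    simp only [c]; push_cast; ring
  have h5 : (∑ i : Fin (Multiset.card lam), ((LL lam).getD i 0 : ℤ) ^ 2) < 
     (∑ i : Fin (Multiset.card lam), (((LL lam).getD i 0 + (σ i : ℕ) - (i : ℕ) : ℕ) : ℤ) ^ 2) := by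
    rw [h3, h4]
    simp only [add_sq, Finset.sum_add_distrib, mul_assoc, ← Finset.mul_sum]
    rw [Equiv.sum_comp σ (fun i => ((i : ℕ) : ℤ) ^ 2)]
    linarith
  exact_mod_cast h5

lemma ssq_le (m : Multiset ℕ) : ssq m ≤ m.sum ^ 2 := by
  induction m using Multiset.induction_on with
  | empty => simp [ssq]
  | cons a m ih =>
    rw [ssq, Multiset.map_cons, Multiset.sum_cons, Multiset.sum_cons]
    change a ^ 2 + ssq m ≤ _
    have h := Nat.zero_le (a * m.sum)
    have h2 : (a + m.sum) ^ 2 = a ^ 2 + m.sum ^ 2 + 2 * (a * m.sum) := by ring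
    omega

lemma sum_filter0 (m : Multiset ℕ) : (m.filter (fun x => x ≠ 0)).sum = m.sum := by
  induction m using Multiset.induction_on with
  | empty => simp
  | cons a m ih =>
    by_cases ha : a = 0
    · subst ha; rw [Multiset.filter_cons_of_neg _ (by simp), ih]; simp
    · rw [Multiset.filter_cons_of_pos _ (by simpa using ha)]; simp [ih]

lemma ssq_filter0 (m : Multiset ℕ) : ssq (m.filter (fun x => x ≠ 0)) = ssq m := by
  induction m using Multiset.induction_on with
  | empty => simp
  | cons a m ih =>
    by_cases ha : a = 0
    · subst ha; rw [Multiset.filter_cons_of_neg _ (by simp), ih]; simp [ssq]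
    · rw [Multiset.filter_cons_of_pos _ (by simpa using ha)]
      simp only [ssq, Multiset.map_cons, Multiset.sum_cons] at ih ⊢
      rw [ih]

lemma hM_virt_aux (n : ℕ) (N : ℕ) : ∀ m : Multiset ℕ, m.sum = n → n ^ 2 - ssq m = N → Phi n (hM m) ∈ VirtCharS n := by
  induction N using Nat.strong_induction_on with
  | _ N ih =>
    intro m hm hN
    rw [← hM_filter]
    let lam : Nat.Partition n := ⟨m.filter (fun x => x ≠ 0), fun {i} hi => Nat.pos_of_ne_zero (by simpa using (Multiset.mem_filter.1 hi).2), by rw [sum_filter0, hm]⟩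
    change Phi n (hM lam.parts) ∈ _
    have h1 : sFun lam ∈ VirtCharS n := Submodule.subset_span ⟨lam, rfl⟩
    have h2 := sFun_eq lam
    rw [sS, ← Finset.add_sum_erase _ _ (Finset.mem_univ (1 : Equiv.Perm (Fin (Multiset.card lam.parts)))), if_pos (by simp), aJT_one, map_add] at h2
    simp only [Equiv.Perm.sign_one, Units.val_one, Int.cast_one, one_smul] at h2
    rw [← sub_eq_iff_eq_add] at h2
    rw [← h2]
    refine Submodule.sub_mem _ h1 ?_
    rw [map_sum]
    refine Submodule.sum_mem _ fun σ hσ => ?_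
    rw [map_smul, Int.cast_smul_eq_zsmul]
    apply Submodule.smul_mem
    split_ifs with hc
    · have hs : (aJT lam.parts σ).sum = n := by rw [aJT_sum _ _ hc, lam.parts_sum]
      refine ih _ ?_ _ hs rfl
      have h3 := aJT_ssq lam.parts σ (Finset.ne_of_mem_erase hσ) hc
      have h4 := ssq_le (aJT lam.parts σ)
      rw [hs] at h4
      have h5 : ssq lam.parts = ssq m := ssq_filter0 m
      omega
    · rw [map_zero]; exact Submodule.zero_mem _

lemma hM_virt (n : ℕ) (m : Multiset ℕ) : Phi n (hM m) ∈ VirtCharS n := by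
  by_cases h : m.sum = n
  · exact hM_virt_aux n _ m h rfl
  · rw [Phi_hom (hom_hM m) h]; exact Submodule.zero_mem _

variable (p : ℕ) [hp : Fact p.Prime]

lemma hM_mem_Sx (m : Multiset ℕ) : hM m ∈ Sx p := by
  apply Subring.multiset_prod_mem
  intro a ha
  obtain ⟨k, _, rfl⟩ := Multiset.mem_map.1 ha
  exact hh_mem p k

lemma virt_lift (n : ℕ) (F : Equiv.Perm (Fin n) → ℚ) (hF : F ∈ VirtCharS n) : ∃ f ∈ Sx p, Hom f n ∧ F = Phi n f := by
  induction hF using Submodule.span_induction with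
  | mem x hx =>
    obtain ⟨lam, rfl⟩ := hx
    refine ⟨sS lam.parts, ?_, ?_, sFun_eq lam⟩
    · refine Subring.sum_mem _ fun σ _ => ?_
      rw [Int.cast_smul_eq_zsmul]
      apply Subring.zsmul_mem
      split_ifs
      · exact hM_mem_Sx p _
      · exact Subring.zero_mem _
    · refine (MvPolynomial.weightedHomogeneousSubmodule ℚ id n).sum_mem fun σ _ => ?_
      apply Submodule.smul_mem
      split_ifs with hc
      · have := hom_hM (aJT lam.parts σ)
        rwa [aJT_sum _ _ hc, lam.parts_sum] at this
      · exact Submodule.zero_mem _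
  | zero => exact ⟨0, Subring.zero_mem _, MvPolynomial.isWeightedHomogeneous_zero ℚ id n, by rw [map_zero]⟩
  | add a b _ _ ha hb =>
    obtain ⟨f, h1, h2, rfl⟩ := ha
    obtain ⟨g, h3, h4, rfl⟩ := hb
    exact ⟨f + g, Subring.add_mem _ h1 h3, h2.add h4, by rw [map_add]⟩
  | smul c a _ ha =>
    obtain ⟨f, h1, h2, rfl⟩ := ha
    refine ⟨(c : ℚ) • f, ?_, hom_smul _ h2, ?_⟩
    · rw [Int.cast_smul_eq_zsmul]; exact Subring.zsmul_mem _ h1 c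
    · rw [map_smul, Int.cast_smul_eq_zsmul]

lemma Sx_virt (n : ℕ) (f : UU) (hf : f ∈ Sx p) : ∃ N : ℕ, ¬ p ∣ N ∧ (N : ℤ) • Phi n f ∈ VirtCharS n := by
  have h := adjoin_span p hh (fun _ => True) _ (by rintro f ⟨k, rfl⟩; exact ⟨k, trivial, rfl⟩) f (Sx_le_Shh p hf)
  clear hf
  induction h using Submodule.span_induction with
  | mem x hx =>
    obtain ⟨m, _, rfl⟩ := hx
    exact ⟨1, hp.out.one_lt.ne' ∘ Nat.dvd_one.1, by rw [Nat.cast_one, one_smul]; exact hM_virt n m⟩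
  | zero => exact ⟨1, hp.out.one_lt.ne' ∘ Nat.dvd_one.1, by rw [map_zero, smul_zero]; exact Submodule.zero_mem _⟩
  | add a b _ _ ha hb =>
    obtain ⟨N, h1, h2⟩ := ha
    obtain ⟨M, h3, h4⟩ := hb
    refine ⟨N * M, hp.out.not_dvd_mul h1 h3, ?_⟩
    rw [map_add, smul_add, Nat.cast_mul]
    refine Submodule.add_mem _ ?_ ?_
    · rw [mul_comm, mul_smul]; exact Submodule.smul_mem _ _ h2
    · rw [mul_smul]; exact Submodule.smul_mem _ _ h4
  | smul c a _ ha =>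
    obtain ⟨N, h1, h2⟩ := ha
    refine ⟨(c : ℚ).den * N, hp.out.not_dvd_mul (mem_Kp_iff_den p c.2) h1, ?_⟩
    have h3 : c • a = (c : ℚ) • a := rfl
    have h4 : (((c : ℚ).den * N : ℕ) : ℤ) • Phi n (c • a) = (c : ℚ).num • (N : ℤ) • Phi n a := by
      rw [h3, map_smul]
      simp only [← Int.cast_smul_eq_zsmul ℚ, smul_smul]
      congr 1
      push_cast
      have := Rat.mul_den_eq_num (c : ℚ)
      rw [← this]; ring
    rw [h4]
    exact Submodule.smul_mem _ _ h2

end partD3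

section partD4
open MvPolynomial (X C coeff pderiv monomial)

/-- `l`-regular partitions -/
abbrev Reg (l n : ℕ) := {lam : Nat.Partition n // ∀ j ∈ lam.parts, ¬ l ∣ j}

/-- kill the power sums with index divisible by `l` -/
def piA (l : ℕ) : UU →ₐ[ℚ] UU := MvPolynomial.aeval fun k => if l ∣ k then 0 else X k

lemma piA_X (l k : ℕ) : piA l (X k) = if l ∣ k then 0 else X k := by rw [piA, MvPolynomial.aeval_X]

lemma piA_mon (l : ℕ) (m : Multiset ℕ) : piA l (monomial m.toFinsupp 1) = if (∃ j ∈ m, l ∣ j) then 0 else monomial m.toFinsupp 1 := by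
  rw [monomial_toFinsupp, map_multiset_prod, Multiset.map_map]
  split_ifs with h
  · obtain ⟨j, hj, hl⟩ := h
    apply Multiset.prod_eq_zero
    rw [Multiset.mem_map]
    exact ⟨j, hj, by rw [Function.comp_apply, piA_X, if_pos hl]⟩
  · congr 1
    refine Multiset.map_congr rfl fun j hj => ?_
    rw [Function.comp_apply, piA_X, if_neg (fun hl => h ⟨j, hj, hl⟩)]

lemma piA_coeff (l : ℕ) (m : Multiset ℕ) (f : UU) : coeff m.toFinsupp (piA l f) = if (∃ j ∈ m, l ∣ j) then 0 else coeff m.toFinsupp f := by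
  induction f using MvPolynomial.induction_on' with
  | monomial u c =>
    have hc : (monomial u c : UU) = c • monomial u 1 := by rw [MvPolynomial.smul_monomial, smul_eq_mul, mul_one]
    obtain ⟨m', rfl⟩ := toFinsupp_surj u
    rw [hc, map_smul, MvPolynomial.coeff_smul, MvPolynomial.coeff_smul, piA_mon]
    by_cases hm : m' = m
    · subst hm
      split_ifs
      · rw [MvPolynomial.coeff_zero, smul_zero]
      · rfl
    · have hm2 : m'.toFinsupp ≠ m.toFinsupp := fun h => hm (Multiset.toFinsupp.injective h)
      rw [MvPolynomial.coeff_monomial, if_neg hm2, smul_zero, ite_self]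
      split_ifs
      · rw [MvPolynomial.coeff_zero, smul_zero]
      · rw [MvPolynomial.coeff_monomial, if_neg hm2, smul_zero]
  | add f g hf hg =>
    rw [map_add, MvPolynomial.coeff_add, hf, hg, MvPolynomial.coeff_add]
    split_ifs
    · rw [add_zero]
    · rfl

lemma sp_piA (l n : ℕ) (f g : UU) (hg : piA l g = g) : sp (Phi n (piA l f)) (Phi n g) = sp (Phi n f) (Phi n g) := by
  rw [sp_Phi, sp_Phi]
  refine Finset.sum_congr rfl fun ν _ => ?_
  congr 1
  rw [← hg, piA_coeff, piA_coeff]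
  split_ifs
  · simp
  · rfl

variable (p : ℕ) [hp : Fact p.Prime]

lemma piA_xx (l j s : ℕ) (h : ¬ l ∣ j * p ^ s) : piA l (xx p j s) = xx p j s := by
  induction s using Nat.strong_induction_on with
  | _ s ih =>
    rw [xx, wc, ip, ← map_pow, map_mul, map_sub, piA_X, if_neg h, map_sum]
    congr 1
    · exact (piA l).commutes _
    congr 1
    refine Finset.sum_congr rfl fun t _ => ?_
    rw [map_mul, map_pow, map_pow, map_natCast]
    congr 2
    exact ih t t.2 (fun hd => h (hd.trans (Nat.mul_dvd_mul_left j (pow_dvd_pow p t.2.le))))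

lemma piA_xk (l k : ℕ) (hk : k ≠ 0) (h : ¬ l ∣ k) : piA l (xk p k) = xk p k := by
  obtain ⟨j, s, hj, hj0, rfl⟩ := exists_js p k hk
  rw [xk_mul p j s hj]
  exact piA_xx p l j s h

lemma piA_Px (l : ℕ) (f : UU) (hf : f ∈ Px p l) : piA l f = f := by
  refine adjoin_hom_mem p _ (AlgHom.id ℚ UU) (RingHom.eqLocus (piA l : UU →+* UU) (RingHom.id UU)) ?_ ?_ f hf
  · intro a _
    exact (piA l).commutes a
  · rintro f ⟨k, hk, h, rfl⟩
    exact piA_xk p l k hk h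

lemma Sx_le_Px0 (f : UU) (hf : f ∈ Sx p) : f ∈ Px p 0 := by
  have : Algebra.adjoin (Kp p) {f : UU | ∃ k, k ≠ 0 ∧ f = xk p k} ≤ 
    Algebra.adjoin (Kp p) {f : UU | ∃ k, k ≠ 0 ∧ ¬ 0 ∣ k ∧ f = xk p k} := by
    apply Algebra.adjoin_mono
    rintro f ⟨k, hk, rfl⟩
    exact ⟨k, hk, by simpa using hk, rfl⟩
  exact this hf

lemma C_mem_Px (l : ℕ) {a : ℚ} (ha : a ∈ Kp p) : (C a : UU) ∈ Px p l := 
  Subalgebra.algebraMap_mem (Algebra.adjoin (Kp p) {f : UU | ∃ k, k ≠ 0 ∧ ¬ l ∣ k ∧ f = xk p k}) ⟨a, ha⟩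

lemma Px_vanish (l n : ℕ) (f : UU) (hf : f ∈ Px p l) : Phi n f ∈ VanishSub l n := by
  intro g hg
  have hg : ∃ j ∈ cycM g, l ∣ j := hg
  rw [Phi_apply, ← piA_Px p l f hf, piA_coeff, if_pos hg, mul_zero]

lemma virt_vanish (l n : ℕ) (F : Equiv.Perm (Fin n) → ℚ) (h1 : F ∈ VirtCharS n) (h2 : F ∈ VanishSub l n) : ∃ f ∈ Px p l, F = Phi n f := by
  obtain ⟨f, hf, hfn, rfl⟩ := virt_lift p n F h1
  refine ⟨f, ?_, rfl⟩
  have hpi : piA l f = f := by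
    ext u
    obtain ⟨m, rfl⟩ := toFinsupp_surj u
    rw [piA_coeff]
    split_ifs with h
    · symm
      by_cases hm : m.sum = n
      · by_cases hm0 : 0 ∈ m
        · rw [← piA_Px p 0 f (Sx_le_Px0 p f hf), piA_coeff, if_pos ⟨0, hm0, dvd_rfl⟩]
        · let μ : Nat.Partition n := ⟨m, fun {i} hi => Nat.pos_of_ne_zero (by rintro rfl; exact hm0 hi), hm⟩
          obtain ⟨g, hg⟩ := exists_cycP μ
          have hg' : cycM g = m := congrArg Nat.Partition.parts hg
          have h3 : Phi n f g = 0 := h2 g (by rw [IsSingular, hg']; exact h)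
          rw [Phi_apply, hg'] at h3
          exact (mul_eq_zero.1 h3).resolve_left (zF_ne m hm0)
      · exact hfn.coeff_eq_zero _ (by rw [weight_toFinsupp]; exact hm)
    · rfl
  have h3 := subx_mem p (fun k => if l ∣ k then 0 else xk p k) (Px p l) (fun a ha => C_mem_Px p l ha) (by
    intro k hk
    split_ifs with h
    · exact Subring.zero_mem _
    · exact xk_mem_Px p l k hk h) f hf
  have h4 : (subx p (fun k => if l ∣ k then 0 else xk p k)).comp (piA l) = piA l := by
    apply MvPolynomial.algHom_ext
    intro k
    rw [AlgHom.comp_apply, piA_X]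
    split_ifs with h
    · rw [map_zero]
    · refine subx_X_of p _ k (by rintro rfl; simp at h) fun i hi => if_neg fun hl => h (hl.trans hi)
  have h5 := congrArg (fun φ => φ f) h4
  simp only [AlgHom.comp_apply] at h5
  rw [hpi] at h5
  rwa [h5] at h3

lemma Px_virt (l n : ℕ) (f : UU) (hf : f ∈ Px p l) : ∃ N : ℕ, ¬ p ∣ N ∧ (N : ℤ) • Phi n f ∈ VirtCharS n ⊓ VanishSub l n := by
  obtain ⟨N, h1, h2⟩ := Sx_virt p n f (Px_le p l hf)
  exact ⟨N, h1, h2, Submodule.smul_mem _ _ (Px_vanish p l n f hf)⟩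

/-- monomials in the Witt coordinates -/
def xM (m : Multiset ℕ) : UU := (m.map (xk p)).prod

lemma xM_mem (l : ℕ) (m : Multiset ℕ) (h : ∀ j ∈ m, j ≠ 0 ∧ ¬ l ∣ j) : xM p m ∈ Px p l := by
  apply Subring.multiset_prod_mem
  intro a ha
  obtain ⟨k, hk, rfl⟩ := Multiset.mem_map.1 ha
  exact xk_mem_Px p l k (h k hk).1 (h k hk).2

lemma xM_Reg {l n : ℕ} (lam : Reg l n) : xM p lam.1.parts ∈ Px p l := 
  xM_mem p l _ fun j hj => ⟨(lam.1.parts_pos hj).ne', lam.2 j hj⟩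

lemma Px_expand (l n : ℕ) (f : UU) (hf : f ∈ Px p l) : ∃ c : Reg l n → ℚ, (∀ x, c x ∈ Kp p) ∧ 
    Phi n f = ∑ x, c x • Phi n (xM p x.1.parts) := by
  have h := adjoin_span p (xk p) (fun k => k ≠ 0 ∧ ¬ l ∣ k) _ (by rintro f ⟨k, h1, h2, rfl⟩; exact ⟨k, ⟨h1, h2⟩, rfl⟩) f hf
  clear hf
  induction h using Submodule.span_induction with
  | mem x hx =>
    obtain ⟨m, hm, rfl⟩ := hx
    by_cases hmn : m.sum = n
    · let μ : Reg l n := ⟨⟨m, fun {i} hi => Nat.pos_of_ne_zero (hm i hi).1, hmn⟩, fun j hj => (hm j hj).2⟩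
      refine ⟨fun x => if x = μ then 1 else 0, ?_, ?_⟩
      · intro x; simp only; split_ifs
        · exact Subring.one_mem _
        · exact Subring.zero_mem _
      · rw [Finset.sum_eq_single μ]
        · simp only []
          rw [if_pos trivial, one_smul]; rfl
        · intro x _ hx; simp only []; rw [if_neg hx, zero_smul]
        · simp
    · refine ⟨fun _ => 0, fun _ => Subring.zero_mem _, ?_⟩
      rw [Phi_hom (hom_mprod m _ (fun k hk => hom_xk p k (hm k hk).1)) hmn]
      simp
  | zero => exact ⟨fun _ => 0, fun _ => Subring.zero_mem _, by simp⟩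
  | add a b _ _ ha hb =>
    obtain ⟨c, h1, h2⟩ := ha
    obtain ⟨d, h3, h4⟩ := hb
    refine ⟨fun x => c x + d x, fun x => Subring.add_mem _ (h1 x) (h3 x), ?_⟩
    simp only [add_smul, Finset.sum_add_distrib]
    rw [map_add, h2, h4]
  | smul k a _ ha =>
    obtain ⟨c, h1, h2⟩ := ha
    refine ⟨fun x => (k : ℚ) * c x, fun x => Subring.mul_mem _ k.2 (h1 x), ?_⟩
    have h3 : k • a = (k : ℚ) • a := rfl
    rw [h3, map_smul, h2, Finset.smul_sum]
    simp only [smul_smul]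

end partD4

section partC5
open MvPolynomial (X C coeff pderiv monomial)

lemma b_cong {U : Type*} [CommRing U] {P : Subring U} {p : ℕ} {ip : U} (hp : p.Prime) (hip : (p : U) * ip = 1) (r : ℕ) (ξ : ℕ → U) (hξ : ∀ s, ξ s ∈ P)
    (hξ0 : ∀ s, r ≤ s → ξ s = 0) (b : ℕ → U) 
    (hb : ∀ i, ∑ t ∈ Finset.range r, (p : U) ^ t * ξ t ^ p ^ (r + i - t) = ∑ s ∈ Finset.range (i + 1), (p : U) ^ s * b s ^ p ^ (i - s)) (s : ℕ) :
    Cg P p 1 (b s - ξ s ^ p ^ r) := by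
  induction s using Nat.strong_induction_on with
  | _ s ih =>
    refine Cg.cancel hip (n := s) ?_
    have h1 := hb s
    rw [Finset.sum_range_succ, Nat.sub_self, pow_zero, pow_one] at h1
    have h2 : (p : U) ^ s * b s = ∑ t ∈ Finset.range r, (p : U) ^ t * ξ t ^ p ^ (r + s - t) - ∑ t ∈ Finset.range s, (p : U) ^ t * b t ^ p ^ (s - t) := by
      rw [h1]; ring
    have h3 : Cg P p (s + 1) (∑ t ∈ Finset.range r, (p : U) ^ t * ξ t ^ p ^ (r + s - t) - ∑ t ∈ Finset.range (s + 1), (p : U) ^ t * ξ t ^ p ^ (r + s - t)) := by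
      rcases le_total r (s + 1) with h | h
      · have : ∑ t ∈ Finset.range (s + 1), (p : U) ^ t * ξ t ^ p ^ (r + s - t) = ∑ t ∈ Finset.range r, (p : U) ^ t * ξ t ^ p ^ (r + s - t) := by
          symm
          refine Finset.sum_subset (by simpa using h) fun t _ ht => ?_
          rw [hξ0 t (by simpa using ht), zero_pow (pow_ne_zero _ hp.ne_zero), mul_zero]
        rw [this, sub_self]; exact Cg.zero
      · rw [← Finset.sum_range_add_sum_Ico _ h, add_sub_cancel_left]
        refine Cg.sum _ _ fun t ht => ?_
        rw [Finset.mem_Ico] at ht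
        exact ((Cg.of_mem (P.pow_mem (hξ t) _)).ppow_mul t).mono (by omega)
    have h4 : Cg P p (s + 1) (∑ t ∈ Finset.range s, ((p : U) ^ t * ξ t ^ p ^ (r + s - t) - (p : U) ^ t * b t ^ p ^ (s - t))) := by
      refine Cg.sum _ _ fun t ht => ?_
      rw [Finset.mem_range] at ht
      have h5 := (Cg.pow_pk hp le_rfl (ih t ht) (P.pow_mem (hξ t) _) (s - t)).ppow_mul t
      rw [← pow_mul, ← pow_add, show r + (s - t) = r + s - t by omega] at h5
      rw [← mul_sub]
      have h6 := (h5.neg).mono (k' := s + 1) (by omega)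
      convert h6 using 1; ring
    have h7 : (p : U) ^ s * (b s - ξ s ^ p ^ r) = (∑ t ∈ Finset.range r, (p : U) ^ t * ξ t ^ p ^ (r + s - t) - ∑ t ∈ Finset.range (s + 1), (p : U) ^ t * ξ t ^ p ^ (r + s - t)) +
      (∑ t ∈ Finset.range s, ((p : U) ^ t * ξ t ^ p ^ (r + s - t) - (p : U) ^ t * b t ^ p ^ (s - t))) := by
      rw [mul_sub, h2, Finset.sum_sub_distrib, Finset.sum_range_succ _ s, Nat.add_sub_cancel]; ring
    rw [h7]
    exact h3.add h4

variable (p : ℕ) [hp : Fact p.Prime]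

/-- image of `Sx` under `piA` -/
def Rx (l : ℕ) : Subring UU := (Sx p).map (piA l : UU →+* UU)

lemma piA_mem_Rx (l : ℕ) {f : UU} (hf : f ∈ Sx p) : piA l f ∈ Rx p l := ⟨f, hf, rfl⟩

lemma Px_le_Rx (l : ℕ) : Px p l ≤ Rx p l := fun f hf => ⟨f, Px_le p l hf, piA_Px p l f hf⟩

lemma piA_fr (l : ℕ) (f : UU) : piA l (fr p (piA l f)) = piA l (fr p f) := by
  have : ((piA l).comp (fr p)).comp (piA l) = (piA l).comp (fr p) := by
    apply MvPolynomial.algHom_ext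
    intro k
    simp only [AlgHom.comp_apply]
    rw [piA_X]
    split_ifs with h
    · rw [map_zero, map_zero, fr, MvPolynomial.aeval_X, piA_X, if_pos (h.mul_left p)]
    · rfl
  exact congrArg (fun φ => φ f) this

lemma Cg_piA (l k : ℕ) {f : UU} (h : Cg (Sx p) p k f) : Cg (Rx p l) p k (piA l f) := by
  obtain ⟨c, hc, rfl⟩ := h
  exact ⟨piA l c, piA_mem_Rx p l hc, by rw [map_mul, map_pow, map_natCast]⟩

lemma not_dvd_of_lt (r m' j s : ℕ) (hj : ¬ p ∣ j) (hs : s < r) : ¬ p ^ r * m' ∣ j * p ^ s := by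
  intro h
  have h1 : p ^ (s + 1) ∣ j * p ^ s := ((pow_dvd_pow p hs).trans (dvd_mul_right _ _)).trans h
  rw [pow_succ, mul_comm j] at h1
  exact hj (Nat.dvd_of_mul_dvd_mul_left (pow_pos hp.out.pos s) h1)

lemma exists_Ej (r m' j : ℕ) (hj : ¬ p ∣ j) (hmj : m' ∣ j) (i : ℕ) (hi : i < r) (n : ℕ) : ∃ E ∈ Px p (p ^ r * m'), 
    Cg (Rx p (p ^ r * m')) p ((r - i) * n + padicValNat p n.factorial) E ∧ Cg (Px p (p ^ r * m')) p 1 (E - (xx p j i ^ p ^ r) ^ n) := by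
  set l := p ^ r * m' with hl
  have hj0 : j ≠ 0 := by rintro rfl; simp at hj
  have hpi : ∀ s, s < r → piA l (xx p j s) = xx p j s := fun s hs => piA_xx p l j s (not_dvd_of_lt p r m' j s hj hs)
  have hxP : ∀ s, s < r → xx p j s ∈ Px p l := by
    intro s hs
    rw [← xk_mul p j s hj]
    exact xk_mem_Px p l _ (mul_ne_zero hj0 (pow_ne_zero _ hp.out.ne_zero)) (not_dvd_of_lt p r m' j s hj hs)
  let ξ : ℕ → UU := fun s => if s < r then xx p j s else 0
  have hξ : ∀ s, ξ s ∈ Px p l := by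
    intro s
    simp only [ξ]
    split_ifs with h
    · exact hxP s h
    · exact Subring.zero_mem _
  have hξ0 : ∀ s, r ≤ s → ξ s = 0 := fun s hs => if_neg (by omega)
  let W : ℕ → UU := fun i => ∑ t ∈ Finset.range r, (p : UU) ^ t * ξ t ^ p ^ (r + i - t)
  let b : ℕ → UU := fun s => wc p (ip p) W s
  have hb : ∀ i, ∑ t ∈ Finset.range r, (p : UU) ^ t * ξ t ^ p ^ (r + i - t) = ∑ s ∈ Finset.range (i + 1), (p : UU) ^ s * b s ^ p ^ (i - s) := 
    fun i => wc_ghost p (ip p) (hip p) W i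
  have hbξ := b_cong hp.out (hip p) r ξ hξ hξ0 b hb
  have hbP : ∀ s, b s ∈ Px p l := by
    intro s
    have := Subring.add_mem _ (hbξ s).mem (Subring.pow_mem _ (hξ s) (p ^ r))
    simpa using this
  let Y : ℕ → UU := fun i => - ∑ t ∈ Finset.range (i + 1), (p : UU) ^ t * (piA l (xx p j (r + t))) ^ p ^ (i - t)
  have hφ : ∀ a ∈ Rx p l, Cg (Rx p l) p 1 (((piA l).comp (fr p) : UU →+* UU) a - a ^ p) := by
    rintro _ ⟨a, ha, rfl⟩
    have := Cg_piA p l 1 (fr_Sx p a ha).2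
    rw [map_sub, map_pow] at this
    change Cg (Rx p l) p 1 (piA l (fr p (piA l a)) - (piA l a) ^ p)
    rwa [piA_fr]
  have hφR : ∀ a ∈ Rx p l, ((piA l).comp (fr p) : UU →+* UU) a ∈ Rx p l := by
    intro a ha
    have := Subring.add_mem _ (hφ a ha).mem (Subring.pow_mem _ ha p)
    simpa using this
  have hyR : ∀ t, piA l (xx p j (r + t)) ∈ Rx p l := fun t => piA_mem_Rx p l (xx_mem_Sx p j _ hj)
  have hpR : ∀ k, (p : UU) ^ k ∈ Rx p l := fun k => Subring.pow_mem _ (natCast_mem _ p) k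
  have hY : ∀ i, Y i ∈ Rx p l := by
    intro i
    refine Subring.neg_mem _ (Subring.sum_mem _ fun t _ => Subring.mul_mem _ (hpR _) (Subring.pow_mem _ (hyR t) _))
  have hY1 : ∀ i, Cg (Rx p l) p (i + 1) (Y (i + 1) - ((piA l).comp (fr p) : UU →+* UU) (Y i)) := by
    intro i
    simp only [Y]
    rw [Finset.sum_range_succ, map_neg, map_sum]
    have h1 : -(∑ t ∈ Finset.range (i + 1), (p : UU) ^ t * (piA l (xx p j (r + t))) ^ p ^ (i + 1 - t) + (p : UU) ^ (i + 1) * (piA l (xx p j (r + (i + 1)))) ^ p ^ (i + 1 - (i + 1)))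
      - -∑ t ∈ Finset.range (i + 1), ((piA l).comp (fr p) : UU →+* UU) ((p : UU) ^ t * (piA l (xx p j (r + t))) ^ p ^ (i - t)) = 
      ∑ t ∈ Finset.range (i + 1), (p : UU) ^ t * ((((piA l).comp (fr p) : UU →+* UU) (piA l (xx p j (r + t)))) ^ p ^ (i - t) - ((piA l (xx p j (r + t))) ^ p) ^ p ^ (i - t)) 
       - (p : UU) ^ (i + 1) * (piA l (xx p j (r + (i + 1)))) ^ p ^ (i + 1 - (i + 1)) := by
      simp only [mul_sub, Finset.sum_sub_distrib, map_mul, map_pow, map_natCast]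
      have h2 : ∀ t ∈ Finset.range (i + 1), (p : UU) ^ t * (piA l (xx p j (r + t))) ^ p ^ (i + 1 - t) = (p : UU) ^ t * ((piA l (xx p j (r + t))) ^ p) ^ p ^ (i - t) := by
        intro t ht
        rw [Finset.mem_range] at ht
        rw [← pow_mul, ← pow_succ', show i - t + 1 = i + 1 - t by omega]
      rw [Finset.sum_congr rfl h2]
      ring
    rw [h1]
    refine Cg.sub (Cg.sum _ _ fun t ht => ?_) ((Cg.of_mem (Subring.pow_mem _ (hyR (i + 1)) _)).ppow_mul (i + 1) |>.mono (by omega))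
    rw [Finset.mem_range] at ht
    have h5 := (Cg.pow_pk hp.out le_rfl (hφ _ (hyR t)) (Subring.pow_mem _ (hyR t) p) (i - t)).ppow_mul t
    exact h5.mono (by omega)
  have hbY : ∀ i, (p : UU) ^ r * Y i = ∑ s ∈ Finset.range (i + 1), (p : UU) ^ s * b s ^ p ^ (i - s) := by
    intro i
    rw [← hb i]
    have h1 := congrArg (piA l) (xx_ghost p j (r + i))
    rw [piA_X, if_pos (mul_comm j _ ▸ mul_dvd_mul (pow_dvd_pow p (Nat.le_add_right r i)) hmj), map_sum, show r + i + 1 = r + (i + 1) by ring, Finset.sum_range_add] at h1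
    have h2 : ∑ t ∈ Finset.range r, piA l ((p : UU) ^ t * xx p j t ^ p ^ (r + i - t)) = ∑ t ∈ Finset.range r, (p : UU) ^ t * ξ t ^ p ^ (r + i - t) := by
      refine Finset.sum_congr rfl fun t ht => ?_
      rw [Finset.mem_range] at ht
      rw [map_mul, map_pow, map_pow, map_natCast, hpi t ht]
      simp only [ξ, if_pos ht]
    rw [h2] at h1
    rw [eq_neg_of_add_eq_zero_left h1.symm]
    simp only [Y]
    rw [mul_neg, Finset.mul_sum]
    congr 1
    refine Finset.sum_congr rfl fun t ht => ?_
    rw [map_mul, map_pow, map_pow, map_natCast, pow_add, mul_assoc, show r + i - (r + t) = i - t by omega]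
  obtain ⟨E, hE, h1, h2⟩ := coreB hp.out (hip p) _ hφR hφ r b Y (Px_le_Rx p l) hbP hY hY1 hbY i hi n
  refine ⟨E, hE, h1, ?_⟩
  have h3 := (hbξ i).pow_sub (hbP i) (Subring.pow_mem _ (hξ i) _) n
  have h4 := h2.add h3
  simp only [ξ, if_pos hi] at h4
  convert h4 using 1
  ring

/-- exponent attached to one part size -/
def Xe (r m' k c : ℕ) : ℕ := if m' ∣ k then (r - padicValNat p k) * (c / p ^ r) + padicValNat p (c / p ^ r).factorial else 0

/-- exponent attached to a multiset -/
def Xw (r m' : ℕ) (m : Multiset ℕ) : ℕ := ∑ k ∈ m.toFinset, Xe p r m' k (m.count k)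

lemma exists_Ek (r m' k c : ℕ) (hpm : ¬ p ∣ m') (hk : k ≠ 0) (hl : ¬ p ^ r * m' ∣ k) : ∃ E ∈ Px p (p ^ r * m'), 
    Cg (Rx p (p ^ r * m')) p (Xe p r m' k c) E ∧ Cg (Px p (p ^ r * m')) p 1 (E - xk p k ^ c) := by
  by_cases hm : m' ∣ k
  · obtain ⟨j, i, hj, hj0, rfl⟩ := exists_js p k hk
    have hv : padicValNat p (j * p ^ i) = i := by rw [mul_comm]; exact val_pm p hp.out i j hj
    have hmj : m' ∣ j := by
      refine Nat.Coprime.dvd_of_dvd_mul_right ?_ hm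
      exact ((Nat.Prime.coprime_iff_not_dvd hp.out).2 hpm).symm.pow_right i
    have hi : i < r := by
      by_contra h
      apply hl
      rw [mul_comm j]
      exact mul_dvd_mul (pow_dvd_pow p (by omega)) hmj
    obtain ⟨E, hE, h1, h2⟩ := exists_Ej p r m' j hj hmj i hi (c / p ^ r)
    have hx := xk_mem_Px p _ _ hk hl
    refine ⟨E * xk p (j * p ^ i) ^ (c % p ^ r), Subring.mul_mem _ hE (Subring.pow_mem _ hx _), ?_, ?_⟩
    · rw [Xe, if_pos hm, hv]
      exact h1.mul_right (Px_le_Rx p _ (Subring.pow_mem _ hx _))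
    · have h3 := h2.mul_right (Subring.pow_mem _ hx (c % p ^ r))
      convert h3 using 1
      rw [xk_mul p j i hj, sub_mul, ← pow_mul, ← pow_add, Nat.div_add_mod]
  · refine ⟨xk p k ^ c, Subring.pow_mem _ (xk_mem_Px p _ k hk hl) _, ?_, by rw [sub_self]; exact Cg.zero⟩
    rw [Xe, if_neg hm]
    exact Cg.of_mem (Px_le_Rx p _ (Subring.pow_mem _ (xk_mem_Px p _ k hk hl) _))

lemma exists_E (r m' : ℕ) (hpm : ¬ p ∣ m') (m : Multiset ℕ) (h : ∀ k ∈ m, k ≠ 0 ∧ ¬ p ^ r * m' ∣ k) : ∃ E ∈ Px p (p ^ r * m'), 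
    Cg (Rx p (p ^ r * m')) p (Xw p r m' m) E ∧ Cg (Px p (p ^ r * m')) p 1 (E - xM p m) := by
  rw [xM, Finset.prod_multiset_map_count, Xw]
  have h' : ∀ k ∈ m.toFinset, k ≠ 0 ∧ ¬ p ^ r * m' ∣ k := fun k hk => h k (Multiset.mem_toFinset.1 hk)
  generalize m.toFinset = s at h'
  induction s using Finset.induction_on with
  | empty => exact ⟨1, Subring.one_mem _, by simpa using Cg.of_mem (Subring.one_mem _), by simpa using Cg.zero⟩
  | insert a s ha ih =>
    obtain ⟨E, h1, h2, h3⟩ := ih fun k hk => h' k (by simp [hk])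
    obtain ⟨F, h4, h5, h6⟩ := exists_Ek p r m' a (m.count a) hpm (h' a (by simp)).1 (h' a (by simp)).2
    rw [Finset.sum_insert ha, Finset.prod_insert ha]
    refine ⟨F * E, Subring.mul_mem _ h4 h1, h5.mul h2, ?_⟩
    refine Cg.mul_sub h6 h3 (Subring.pow_mem _ (xk_mem_Px p _ a (h' a (by simp)).1 (h' a (by simp)).2) _) h1

end partC5

section partE1

/-- number of regular partitions -/
def cR (l n : ℕ) : ℕ := Fintype.card (Reg l n)

lemma card_ge (l n k t : ℕ) (hk : k ≠ 0) (hl : ¬ l ∣ k) : 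
    Fintype.card {x : Reg l n // t ≤ x.1.parts.count k} = if t * k ≤ n then cR l (n - t * k) else 0 := by
  split_ifs with h
  · rw [cR]
    apply Fintype.card_congr
    refine ⟨fun x => ⟨⟨x.1.1.parts - Multiset.replicate t k, ?_, ?_⟩, ?_⟩, fun y => ⟨⟨⟨y.1.parts + Multiset.replicate t k, ?_, ?_⟩, ?_⟩, ?_⟩, ?_, ?_⟩
    · intro i hi
      exact x.1.1.parts_pos (Multiset.mem_of_le (Multiset.sub_le_self _ _) hi)
    · have h1 : Multiset.replicate t k ≤ x.1.1.parts := Multiset.le_count_iff_replicate_le.1 x.2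
      have h2 := congrArg Multiset.sum (Multiset.sub_add_cancel h1)
      rw [Multiset.sum_add, Multiset.sum_replicate, x.1.1.parts_sum, smul_eq_mul] at h2
      omega
    · intro j hj
      exact x.1.2 j (Multiset.mem_of_le (Multiset.sub_le_self _ _) hj)
    · intro i hi
      rw [Multiset.mem_add] at hi
      rcases hi with hi | hi
      · exact y.1.parts_pos hi
      · rw [Multiset.eq_of_mem_replicate hi]; omega
    · rw [Multiset.sum_add, Multiset.sum_replicate, y.1.parts_sum, smul_eq_mul]; omega
    · intro j hj
      rw [Multiset.mem_add] at hj
      rcases hj with hi | hi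
      · exact y.2 j hi
      · rw [Multiset.eq_of_mem_replicate hi]; exact hl
    · simp only []
      rw [Multiset.count_add, Multiset.count_replicate_self]; omega
    · intro x
      apply Subtype.ext; apply Subtype.ext; apply Nat.Partition.ext
      exact Multiset.sub_add_cancel (Multiset.le_count_iff_replicate_le.1 x.2)
    · intro y
      apply Subtype.ext; apply Nat.Partition.ext
      exact Multiset.add_sub_cancel_right
  · rw [Fintype.card_eq_zero_iff]
    refine ⟨fun x => h ?_⟩
    have h1 : Multiset.replicate t k ≤ x.1.1.parts := Multiset.le_count_iff_replicate_le.1 x.2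
    have h2 := congrArg Multiset.sum (Multiset.sub_add_cancel h1)
    rw [Multiset.sum_add, Multiset.sum_replicate, x.1.1.parts_sum, smul_eq_mul] at h2
    omega

lemma count_le_n {n : ℕ} (x : Nat.Partition n) (k : ℕ) (hk : k ≠ 0) : x.parts.count k * k ≤ n := by
  have h1 : Multiset.replicate (x.parts.count k) k ≤ x.parts := Multiset.le_count_iff_replicate_le.1 le_rfl
  have h2 := congrArg Multiset.sum (Multiset.sub_add_cancel h1)
  rw [Multiset.sum_add, Multiset.sum_replicate, x.parts_sum, smul_eq_mul] at h2
  omega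

lemma count_le_n' {n : ℕ} (x : Nat.Partition n) (k : ℕ) : x.parts.count k ≤ n := by
  by_cases hk : k = 0
  · subst hk
    rw [Multiset.count_eq_zero.2]
    · omega
    · intro h; exact lt_irrefl _ (x.parts_pos h)
  · have := count_le_n x k hk
    nlinarith [Nat.pos_of_ne_zero hk]

/-- the counting function `S(M)` -/
def SM (l n M : ℕ) : ℕ := ∑ a ∈ Finset.Icc 1 n, if a * M ≤ n then cR l (n - a * M) else 0

lemma SM_zero (l n M : ℕ) (h : n < M) : SM l n M = 0 := by
  apply Finset.sum_eq_zero
  intro a ha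
  rw [Finset.mem_Icc] at ha
  rw [if_neg]
  nlinarith

lemma div_eq_sum (c N n : ℕ) (hN : N ≠ 0) (hc : c ≤ n) : c / N = ∑ a ∈ Finset.Icc 1 n, if a * N ≤ c then 1 else 0 := by
  rw [Finset.sum_boole]
  have : (Finset.Icc 1 n).filter (fun a => a * N ≤ c) = Finset.Icc 1 (c / N) := by
    ext a
    rw [Finset.mem_filter, Finset.mem_Icc, Finset.mem_Icc, Nat.le_div_iff_mul_le (Nat.pos_of_ne_zero hN)]
    constructor
    · rintro ⟨⟨h1, h2⟩, h3⟩; exact ⟨h1, h3⟩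
    · rintro ⟨h1, h3⟩
      refine ⟨⟨h1, ?_⟩, h3⟩
      have := Nat.pos_of_ne_zero hN
      nlinarith
  rw [this]; simp

lemma sum_div (l n k N : ℕ) (hk : k ≠ 0) (hl : ¬ l ∣ k) (hN : N ≠ 0) : ∑ x : Reg l n, x.1.parts.count k / N = SM l n (N * k) := by
  rw [Finset.sum_congr rfl fun x _ => div_eq_sum (x.1.parts.count k) N n hN (count_le_n' x.1 k), Finset.sum_comm, SM]
  refine Finset.sum_congr rfl fun a _ => ?_
  rw [Finset.sum_boole, ← mul_assoc, ← card_ge l n k (a * N) hk hl, Fintype.card_subtype]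
  rfl

lemma reindex (n N : ℕ) (hN : N ≠ 0) (f S : ℕ → ℕ) (hS : ∀ M, n < M → S M = 0) : 
    ∑ k ∈ Finset.Icc 1 n, f k * S (N * k) = ∑ M ∈ Finset.Icc 1 n, (if N ∣ M then f (M / N) else 0) * S M := by
  have hN' := Nat.pos_of_ne_zero hN
  simp only [ite_mul, zero_mul]
  rw [← Finset.sum_filter]
  have h1 : ∑ k ∈ Finset.Icc 1 n, f k * S (N * k) = ∑ k ∈ (Finset.Icc 1 n).filter (fun k => N * k ≤ n), f k * S (N * k) := by
    rw [Finset.sum_filter]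
    refine Finset.sum_congr rfl fun k _ => ?_
    split_ifs with h
    · rfl
    · rw [hS _ (by omega), mul_zero]
  rw [h1]
  refine Finset.sum_bij (fun k _ => N * k) ?_ ?_ ?_ ?_
  · intro k hk
    rw [Finset.mem_filter, Finset.mem_Icc] at hk ⊢
    refine ⟨⟨?_, hk.2⟩, dvd_mul_right _ _⟩
    nlinarith
  · intro a _ b _ h
    exact Nat.eq_of_mul_eq_mul_left hN' h
  · intro M hM
    rw [Finset.mem_filter, Finset.mem_Icc] at hM
    obtain ⟨k, rfl⟩ := hM.2
    refine ⟨k, ?_, rfl⟩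
    rw [Finset.mem_filter, Finset.mem_Icc]
    have h2 : 0 < k := by
      rcases Nat.eq_zero_or_pos k with h | h
      · subst h; omega
      · exact h
    refine ⟨⟨h2, ?_⟩, hM.1.2⟩
    nlinarith
  · intro k _
    rw [Nat.mul_div_cancel_left _ hN']

variable (p : ℕ) [hp : Fact p.Prime]

lemma fact_val (c n : ℕ) (hc : c ≤ n) : padicValNat p c.factorial = ∑ i ∈ Finset.Icc 1 n, c / p ^ i := by
  rw [padicValNat_factorial (b := n + 1)]
  · rfl
  · exact lt_of_le_of_lt (Nat.log_le_self p c) (by omega)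

/-- coefficient identity -/
lemma coef_id (r m' n M : ℕ) (hpm : ¬ p ∣ m') (hM1 : 1 ≤ M) (hMn : M ≤ n) :
    (∑ i ∈ Finset.Icc 1 n, if p ^ i ∣ M then (if p ^ r * m' ∣ M / p ^ i then 0 else 1) else 0) = 
    (if p ^ r * m' ∣ M then 0 else padicValNat p M) + 
    (if p ^ r ∣ M then (if p ^ r * m' ∣ M / p ^ r then 0 else if m' ∣ M / p ^ r then r - padicValNat p (M / p ^ r) else 0) else 0) +
    ∑ i ∈ Finset.Icc 1 n, (if p ^ r * p ^ i ∣ M then (if p ^ r * m' ∣ M / (p ^ r * p ^ i) then 0 else if m' ∣ M / (p ^ r * p ^ i) then 1 else 0) else 0) := by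
  obtain ⟨j, v, hj, hj0, rfl⟩ := exists_js p M (by omega)
  have hv : ∀ v, padicValNat p (j * p ^ v) = v := fun v => by rw [mul_comm]; exact val_pm p hp.out v j hj
  have hpp := hp.out.pos
  have hd : ∀ i, p ^ i ∣ j * p ^ v ↔ i ≤ v := by
    intro i
    rw [padicValNat_dvd_iff_le (mul_ne_zero hj0 (pow_ne_zero _ hp.out.ne_zero)), hv]
  have hm : ∀ t, m' ∣ j * p ^ t ↔ m' ∣ j := by
    intro t
    refine ⟨fun h => Nat.Coprime.dvd_of_dvd_mul_right (((Nat.Prime.coprime_iff_not_dvd hp.out).2 hpm).symm.pow_right t) h, fun h => h.mul_right _⟩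
  have hl : ∀ t, p ^ r * m' ∣ j * p ^ t ↔ (m' ∣ j ∧ r ≤ t) := by
    intro t
    constructor
    · intro h
      refine ⟨(hm t).1 ((dvd_mul_left _ _).trans h), ?_⟩
      by_contra hc
      exact not_dvd_of_lt p r m' j t hj (by omega) h
    · rintro ⟨h1, h2⟩
      rw [mul_comm j]
      exact mul_dvd_mul (pow_dvd_pow p h2) h1
  have hq : ∀ i, i ≤ v → j * p ^ v / p ^ i = j * p ^ (v - i) := by
    intro i hi
    rw [Nat.mul_div_assoc _ (pow_dvd_pow p hi), Nat.pow_div hi hpp]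
  have hvn : v ≤ n := by
    have h1 : v < p ^ v := Nat.lt_pow_self hp.out.one_lt
    have h2 : p ^ v ≤ j * p ^ v := Nat.le_mul_of_pos_left _ (Nat.pos_of_ne_zero hj0)
    omega
  have e1 : (∑ i ∈ Finset.Icc 1 n, if p ^ i ∣ j * p ^ v then (if p ^ r * m' ∣ j * p ^ v / p ^ i then 0 else 1) else 0) =
     ∑ i ∈ Finset.Icc 1 n, if i ≤ v ∧ ¬ (m' ∣ j ∧ r ≤ v - i) then 1 else 0 := by
    refine Finset.sum_congr rfl fun i _ => ?_
    by_cases h : i ≤ v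
    · rw [if_pos ((hd i).2 h), hq i h]
      by_cases h2 : m' ∣ j ∧ r ≤ v - i
      · rw [if_pos ((hl _).2 h2), if_neg (fun h => h.2 h2)]
      · rw [if_neg (fun h => h2 ((hl _).1 h)), if_pos ⟨h, h2⟩]
    · rw [if_neg (fun h' => h ((hd i).1 h')), if_neg (fun h' => h h'.1)]
  have e2 : ∑ i ∈ Finset.Icc 1 n, (if p ^ r * p ^ i ∣ j * p ^ v then (if p ^ r * m' ∣ j * p ^ v / (p ^ r * p ^ i) then 0 else if m' ∣ j * p ^ v / (p ^ r * p ^ i) then 1 else 0) else 0) =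
     ∑ i ∈ Finset.Icc 1 n, if m' ∣ j ∧ r + i ≤ v ∧ ¬ (r ≤ v - (r + i)) then 1 else 0 := by
    refine Finset.sum_congr rfl fun i _ => ?_
    rw [← pow_add]
    by_cases h : r + i ≤ v
    · rw [if_pos ((hd _).2 h), hq _ h]
      by_cases h3 : m' ∣ j
      · by_cases h2 : r ≤ v - (r + i)
        · rw [if_pos ((hl _).2 ⟨h3, h2⟩), if_neg (fun h => h.2.2 h2)]
        · rw [if_neg (fun h => h2 ((hl _).1 h).2), if_pos ((hm _).2 h3), if_pos ⟨h3, h, h2⟩]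
      · rw [if_neg (fun h => h3 ((hl _).1 h).1), if_neg (fun h => h3 ((hm _).1 h)), if_neg (fun h => h3 h.1)]
    · rw [if_neg (fun h' => h ((hd _).1 h')), if_neg (fun h' => h h'.2.1)]
  rw [e1, e2, hv, Finset.sum_boole, Finset.sum_boole]
  by_cases h3 : m' ∣ j
  · have f1 : (Finset.Icc 1 n).filter (fun i => i ≤ v ∧ ¬ (m' ∣ j ∧ r ≤ v - i)) = Finset.Icc (v + 1 - min r v) v := by
      ext i
      simp only [Finset.mem_filter, Finset.mem_Icc, h3, true_and]
      omega
    have f2 : (Finset.Icc 1 n).filter (fun i => m' ∣ j ∧ r + i ≤ v ∧ ¬ (r ≤ v - (r + i))) = Finset.Icc (max 1 (v + 1 - 2 * r)) (v - r) := by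
      ext i
      simp only [Finset.mem_filter, Finset.mem_Icc, h3, true_and]
      omega
    rw [f1, f2, Nat.card_Icc, Nat.card_Icc]
    by_cases h4 : r ≤ v
    · rw [if_pos ((hl _).2 ⟨h3, h4⟩), if_pos ((hd _).2 h4), hq _ h4, hv]
      by_cases h5 : r ≤ v - r
      · rw [if_pos ((hl _).2 ⟨h3, h5⟩)]
        simp only [Nat.cast_id]
        omega
      · rw [if_neg (fun h => h5 ((hl _).1 h).2), if_pos ((hm _).2 h3)]
        simp only [Nat.cast_id]
        omega
    · rw [if_neg (fun h => h4 ((hl _).1 h).2), if_neg (fun h => h4 ((hd _).1 h))]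
      simp only [Nat.cast_id]
      omega
  · have f1 : (Finset.Icc 1 n).filter (fun i => i ≤ v ∧ ¬ (m' ∣ j ∧ r ≤ v - i)) = Finset.Icc 1 v := by
      ext i
      simp only [Finset.mem_filter, Finset.mem_Icc, h3, false_and, not_false_eq_true, and_true]
      omega
    have f2 : (Finset.Icc 1 n).filter (fun i => m' ∣ j ∧ r + i ≤ v ∧ ¬ (r ≤ v - (r + i))) = ∅ := by
      ext i
      simp [h3]
    rw [f1, f2, if_neg (fun h => h3 ((hl _).1 h).1)]
    by_cases h4 : r ≤ v
    · rw [if_pos ((hd _).2 h4), hq _ h4, if_neg (fun h => h3 ((hl _).1 h).1), if_neg (fun h => h3 ((hm _).1 h))]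
      simp
    · rw [if_neg (fun h => h4 ((hd _).1 h))]
      simp

end partE1

section partE2
variable (p : ℕ) [hp : Fact p.Prime]

lemma toFinset_sum {n : ℕ} (x : Nat.Partition n) (F : ℕ → ℕ → ℕ) (hF : ∀ k, F k 0 = 0) : 
    ∑ k ∈ x.parts.toFinset, F k (x.parts.count k) = ∑ k ∈ Finset.Icc 1 n, F k (x.parts.count k) := by
  refine Finset.sum_subset ?_ ?_
  · intro k hk
    rw [Multiset.mem_toFinset] at hk
    have h1 := x.parts_pos hk
    have h2 := count_le_n x k h1.ne'
    have h3 := Multiset.one_le_count_iff_mem.2 hk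
    rw [Finset.mem_Icc]
    exact ⟨h1, by nlinarith⟩
  · intro k _ hk
    rw [Multiset.mem_toFinset] at hk
    rw [Multiset.count_eq_zero.2 hk, hF]

lemma Xe_zero (r m' k : ℕ) : Xe p r m' k 0 = 0 := by simp [Xe]

lemma Reg_count_zero {l n : ℕ} (x : Reg l n) (k : ℕ) (h : l ∣ k) : x.1.parts.count k = 0 :=
  Multiset.count_eq_zero.2 fun hk => x.2 k hk h

lemma val_identity (r m' n : ℕ) (hpm : ¬ p ∣ m') : 
    ∑ x : Reg (p ^ r * m') n, ∑ k ∈ Finset.Icc 1 n, padicValNat p (x.1.parts.count k).factorial = 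
    ∑ x : Reg (p ^ r * m') n, ∑ k ∈ Finset.Icc 1 n, padicValNat p k * x.1.parts.count k + ∑ x : Reg (p ^ r * m') n, Xw p r m' x.1.parts := by
  set l := p ^ r * m' with hl
  have hpp : ∀ i, p ^ i ≠ 0 := fun i => pow_ne_zero _ hp.out.ne_zero
  have e1 : ∑ x : Reg l n, ∑ k ∈ Finset.Icc 1 n, padicValNat p (x.1.parts.count k).factorial = 
      ∑ i ∈ Finset.Icc 1 n, ∑ k ∈ Finset.Icc 1 n, (if l ∣ k then 0 else 1) * SM l n (p ^ i * k) := by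
    rw [Finset.sum_comm, Finset.sum_comm (s := Finset.Icc 1 n) (t := Finset.Icc 1 n)]
    refine Finset.sum_congr rfl fun k hk => ?_
    rw [Finset.mem_Icc] at hk
    by_cases h : l ∣ k
    · simp [h, Reg_count_zero _ k h]
    · rw [Finset.sum_congr rfl fun x _ => fact_val p _ n (count_le_n' x.1 k), Finset.sum_comm]
      refine Finset.sum_congr rfl fun i _ => ?_
      rw [if_neg h, one_mul, sum_div l n k _ (by omega) h (hpp i)]
  have e2 : ∑ x : Reg l n, ∑ k ∈ Finset.Icc 1 n, padicValNat p k * x.1.parts.count k = 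
     ∑ k ∈ Finset.Icc 1 n, (if l ∣ k then 0 else padicValNat p k) * SM l n k := by
    rw [Finset.sum_comm]
    refine Finset.sum_congr rfl fun k hk => ?_
    rw [Finset.mem_Icc] at hk
    by_cases h : l ∣ k
    · simp [h, Reg_count_zero _ k h]
    · have := sum_div l n k 1 (by omega) h one_ne_zero
      simp only [Nat.div_one, one_mul] at this
      rw [if_neg h, ← Finset.mul_sum, this]
  have e3 : ∑ x : Reg l n, Xw p r m' x.1.parts = 
     ∑ k ∈ Finset.Icc 1 n, (if l ∣ k then 0 else if m' ∣ k then r - padicValNat p k else 0) * SM l n (p ^ r * k) + 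
     ∑ i ∈ Finset.Icc 1 n, ∑ k ∈ Finset.Icc 1 n, (if l ∣ k then 0 else if m' ∣ k then 1 else 0) * SM l n (p ^ r * p ^ i * k) := by
    rw [Finset.sum_congr rfl fun x _ => toFinset_sum x.1 (Xe p r m') (Xe_zero p r m'), Finset.sum_comm, Finset.sum_comm (s := Finset.Icc 1 n) (t := Finset.Icc 1 n), ← Finset.sum_add_distrib]
    refine Finset.sum_congr rfl fun k hk => ?_
    rw [Finset.mem_Icc] at hk
    by_cases h : l ∣ k
    · simp [h, Reg_count_zero _ k h, Xe_zero]
    · by_cases h2 : m' ∣ k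
      · simp only [Xe, if_neg h, if_pos h2, one_mul]
        rw [Finset.sum_add_distrib, ← Finset.mul_sum, sum_div l n k _ (by omega) h (hpp r)]
        congr 1
        rw [Finset.sum_congr rfl fun x _ => fact_val p _ n ((Nat.div_le_self _ _).trans (count_le_n' x.1 k)), Finset.sum_comm]
        refine Finset.sum_congr rfl fun i _ => ?_
        simp only [Nat.div_div_eq_div_mul]
        rw [sum_div l n k _ (by omega) h (mul_ne_zero (hpp r) (hpp i))]
      · simp [h, h2, Xe]
  have hS := SM_zero l n
  rw [e1, e2, e3, reindex n _ (hpp r) _ (SM l n) hS]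
  rw [Finset.sum_congr rfl fun i _ => reindex n (p ^ i) (hpp i) _ (SM l n) hS, 
    Finset.sum_congr rfl fun i _ => reindex n (p ^ r * p ^ i) (mul_ne_zero (hpp r) (hpp i)) _ (SM l n) hS]
  conv_lhs => rw [Finset.sum_comm]
  conv_rhs => rw [Finset.sum_comm (s := Finset.Icc 1 n) (t := Finset.Icc 1 n)]
  rw [← add_assoc, ← Finset.sum_add_distrib, ← Finset.sum_add_distrib]
  refine Finset.sum_congr rfl fun M hM => ?_
  rw [Finset.mem_Icc] at hM
  rw [← Finset.sum_mul, ← Finset.sum_mul, ← add_mul, ← add_mul]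
  congr 1
  exact coef_id p r m' n M hpm hM.1 hM.2

end partE2

section partE3

/-- Statistic of a multiset. -/
def Bf (K : ℕ → Prop) (g : ℕ → ℕ) (N : ℕ) (m : Multiset ℕ) : ℕ → ℕ :=
  fun k => if K k then m.count (g k) / N else 0

lemma Bf_fib (l n : ℕ) (K : ℕ → Prop) (g : ℕ → ℕ) (N : ℕ) (hN : 0 < N)
    (hK : ∀ k, K k → k ≠ 0 ∧ k ≤ g k ∧ ¬ l ∣ g k) (hinj : ∀ a b, K a → K b → g a = g b → a = b)
    (hNg : ∀ k, N * g k = l * k) (β : ℕ → ℕ) :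
    Fintype.card {x : Reg l n // Bf K g N x.1.parts = β} =
      if (∀ k, β k ≠ 0 → K k ∧ k ≤ n) ∧ ∑ k ∈ Finset.Icc 1 n, l * k * β k ≤ n then
        Fintype.card {x : Reg l (n - ∑ k ∈ Finset.Icc 1 n, l * k * β k) // Bf K g N x.1.parts = 0}
      else 0 := by
  set w := ∑ k ∈ Finset.Icc 1 n, l * k * β k with hw
  set D : Multiset ℕ := ∑ k ∈ Finset.Icc 1 n, Multiset.replicate (N * β k) (g k) with hD
  have hDsum : D.sum = w := by
    rw [hD, hw, Multiset.sum_sum]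
    refine Finset.sum_congr rfl fun k _ => ?_
    rw [Multiset.sum_replicate, smul_eq_mul, ← hNg]; ring
  have hDcount : ∀ a, D.count a = ∑ k ∈ Finset.Icc 1 n, if g k = a then N * β k else 0 := by
    intro a
    rw [hD, Multiset.count_sum']
    refine Finset.sum_congr rfl fun k _ => ?_
    rw [Multiset.count_replicate]
  have hDmem : ∀ a ∈ D, ∃ k ∈ Finset.Icc 1 n, g k = a ∧ β k ≠ 0 := by
    intro a ha
    have h1 : D.count a ≠ 0 := Multiset.count_ne_zero.2 ha
    rw [hDcount] at h1
    obtain ⟨k, hk, h2⟩ := Finset.exists_ne_zero_of_sum_ne_zero h1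
    refine ⟨k, hk, ?_⟩
    split_ifs at h2 with h3
    · exact ⟨h3, fun h => h2 (by rw [h, mul_zero])⟩
    · exact absurd rfl h2
  have hDg : (∀ k, β k ≠ 0 → K k ∧ k ≤ n) → ∀ j, K j → D.count (g j) = N * β j := by
    intro hv j hj
    rw [hDcount, Finset.sum_eq_single j]
    · simp
    · intro b _ hbj
      split_ifs with h
      · by_cases hb : β b = 0
        · rw [hb, mul_zero]
        · exact absurd (hinj b j (hv b hb).1 hj h) hbj
      · rfl
    · intro hjn
      have : β j = 0 := by
        by_contra h
        exact hjn (Finset.mem_Icc.2 ⟨Nat.one_le_iff_ne_zero.2 (hK j hj).1, (hv j h).2⟩)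
      simp [this]
  have hle : (∀ k, β k ≠ 0 → K k ∧ k ≤ n) → ∀ x : Reg l n, Bf K g N x.1.parts = β → D ≤ x.1.parts := by
    intro hv x hx
    rw [Multiset.le_iff_count]
    intro a
    by_cases ha : a ∈ D
    · obtain ⟨k, hk, rfl, hb⟩ := hDmem a ha
      rw [hDg hv k (hv k hb).1, ← hx]
      simp only [Bf, if_pos (hv k hb).1]
      exact Nat.mul_div_le _ _
    · rw [Multiset.count_eq_zero_of_notMem ha]; exact Nat.zero_le _
  split_ifs with h
  · obtain ⟨hv, hwn⟩ := h
    have hle' := hle hv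
    have hDg' := hDg hv
    apply Fintype.card_congr
    refine ⟨fun x => ⟨⟨⟨x.1.1.parts - D, ?_, ?_⟩, ?_⟩, ?_⟩, fun y => ⟨⟨⟨y.1.1.parts + D, ?_, ?_⟩, ?_⟩, ?_⟩, ?_, ?_⟩
    · intro i hi
      exact x.1.1.parts_pos (Multiset.mem_of_le (Multiset.sub_le_self _ _) hi)
    · have h2 := congrArg Multiset.sum (Multiset.sub_add_cancel (hle' x.1 x.2))
      rw [Multiset.sum_add, x.1.1.parts_sum, hDsum] at h2
      omega
    · intro j hj
      exact x.1.2 j (Multiset.mem_of_le (Multiset.sub_le_self _ _) hj)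
    · funext k
      simp only [Bf]
      split_ifs with hk
      · have h3 := congrFun x.2 k
        simp only [Bf, if_pos hk] at h3
        rw [Multiset.count_sub, hDg' k hk, ← h3, Nat.sub_mul_div, Nat.sub_self]; rfl
      · rfl
    · intro i hi
      rw [Multiset.mem_add] at hi
      rcases hi with hi | hi
      · exact y.1.1.parts_pos hi
      · obtain ⟨k, hk, rfl, hb⟩ := hDmem i hi
        have := hK k (hv k hb).1
        omega
    · rw [Multiset.sum_add, y.1.1.parts_sum, hDsum]; omega
    · intro j hj
      rw [Multiset.mem_add] at hj
      rcases hj with hi | hi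
      · exact y.1.2 j hi
      · obtain ⟨k, hk, rfl, hb⟩ := hDmem j hi
        exact (hK k (hv k hb).1).2.2
    · funext k
      simp only [Bf]
      split_ifs with hk
      · have h3 := congrFun y.2 k
        simp only [Bf, if_pos hk, Pi.zero_apply] at h3
        rw [Multiset.count_add, hDg' k hk, Nat.add_mul_div_left _ _ hN, h3, zero_add]
      · by_contra hne
        exact hk (hv k (Ne.symm hne)).1
    · intro x
      apply Subtype.ext; apply Subtype.ext; apply Nat.Partition.ext
      exact Multiset.sub_add_cancel (hle' x.1 x.2)
    · intro y
      apply Subtype.ext; apply Subtype.ext; apply Nat.Partition.ext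
      exact Multiset.add_sub_cancel_right
  · rw [Fintype.card_eq_zero_iff]
    refine ⟨fun x => h ?_⟩
    have hv : ∀ k, β k ≠ 0 → K k ∧ k ≤ n := by
      intro k hk
      rw [← x.2] at hk
      simp only [Bf] at hk
      split_ifs at hk with h1
      · refine ⟨h1, ?_⟩
        have h2 : x.1.1.parts.count (g k) ≠ 0 := by
          intro h; rw [h, Nat.zero_div] at hk; exact hk rfl
        have h3 := hK k h1
        have h4 := count_le_n x.1.1 (g k) (by omega)
        have h5 : 1 * g k ≤ x.1.1.parts.count (g k) * g k := Nat.mul_le_mul_right _ (by omega)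
        omega
      · exact absurd rfl hk
    refine ⟨hv, ?_⟩
    have h2 := congrArg Multiset.sum (Multiset.sub_add_cancel (hle hv x.1 x.2))
    rw [Multiset.sum_add, x.1.1.parts_sum, hDsum] at h2
    omega

lemma Bf_card (l : ℕ) (hl : 0 < l) (K : ℕ → Prop) (g₁ g₂ : ℕ → ℕ) (N₁ N₂ : ℕ) (hN₁ : 0 < N₁) (hN₂ : 0 < N₂)
    (hK₁ : ∀ k, K k → k ≠ 0 ∧ k ≤ g₁ k ∧ ¬ l ∣ g₁ k) (hinj₁ : ∀ a b, K a → K b → g₁ a = g₁ b → a = b)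
    (hNg₁ : ∀ k, N₁ * g₁ k = l * k)
    (hK₂ : ∀ k, K k → k ≠ 0 ∧ k ≤ g₂ k ∧ ¬ l ∣ g₂ k) (hinj₂ : ∀ a b, K a → K b → g₂ a = g₂ b → a = b)
    (hNg₂ : ∀ k, N₂ * g₂ k = l * k) (n : ℕ) : ∀ (β : ℕ → ℕ),
    Fintype.card {x : Reg l n // Bf K g₁ N₁ x.1.parts = β} =
    Fintype.card {x : Reg l n // Bf K g₂ N₂ x.1.parts = β} := by
  induction n using Nat.strong_induction_on with
  | _ n ih =>
  have hne : ∀ β : ℕ → ℕ, β ≠ 0 → Fintype.card {x : Reg l n // Bf K g₁ N₁ x.1.parts = β} =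
    Fintype.card {x : Reg l n // Bf K g₂ N₂ x.1.parts = β} := by
    intro β hβ
    rw [Bf_fib l n K g₁ N₁ hN₁ hK₁ hinj₁ hNg₁, Bf_fib l n K g₂ N₂ hN₂ hK₂ hinj₂ hNg₂]
    split_ifs with h
    · apply ih
      obtain ⟨k, hk⟩ := Function.ne_iff.1 hβ
      have hk' : β k ≠ 0 := hk
      obtain ⟨h1, h2⟩ := h.1 k hk'
      have h3 : k ∈ Finset.Icc 1 n := Finset.mem_Icc.2 ⟨Nat.one_le_iff_ne_zero.2 (hK₁ k h1).1, h2⟩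
      have h4 := Finset.single_le_sum (f := fun k => l * k * β k) (fun _ _ => Nat.zero_le _) h3
      have h5 : 0 < l * k * β k := Nat.mul_pos (Nat.mul_pos hl (Nat.pos_of_ne_zero (hK₁ k h1).1)) (Nat.pos_of_ne_zero hk')
      have := h.2
      omega
    · rfl
  intro β
  by_cases hβ : β = 0
  · subst hβ
    set T : Finset (ℕ → ℕ) := insert 0 (Finset.univ.image (fun x : Reg l n => Bf K g₁ N₁ x.1.parts) ∪
      Finset.univ.image (fun x : Reg l n => Bf K g₂ N₂ x.1.parts)) with hT
    have e1 := Finset.card_eq_sum_card_fiberwise (s := Finset.univ) (t := T) (f := fun x : Reg l n => Bf K g₁ N₁ x.1.parts)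
      (by intro x _; simp [hT])
    have e2 := Finset.card_eq_sum_card_fiberwise (s := Finset.univ) (t := T) (f := fun x : Reg l n => Bf K g₂ N₂ x.1.parts)
      (by intro x _; simp [hT])
    simp only [← Fintype.card_subtype] at e1 e2
    rw [e1] at e2
    have h0 : (0 : ℕ → ℕ) ∈ T := Finset.mem_insert_self _ _
    rw [← Finset.add_sum_erase _ _ h0, ← Finset.add_sum_erase _ _ h0,
      Finset.sum_congr rfl (fun b hb => hne b (Finset.ne_of_mem_erase hb))] at e2
    exact Nat.add_right_cancel e2
  · exact hne β hβ

lemma Bf_equiv (l : ℕ) (hl : 0 < l) (K : ℕ → Prop) (g₁ g₂ : ℕ → ℕ) (N₁ N₂ : ℕ) (hN₁ : 0 < N₁) (hN₂ : 0 < N₂)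
    (hK₁ : ∀ k, K k → k ≠ 0 ∧ k ≤ g₁ k ∧ ¬ l ∣ g₁ k) (hinj₁ : ∀ a b, K a → K b → g₁ a = g₁ b → a = b)
    (hNg₁ : ∀ k, N₁ * g₁ k = l * k)
    (hK₂ : ∀ k, K k → k ≠ 0 ∧ k ≤ g₂ k ∧ ¬ l ∣ g₂ k) (hinj₂ : ∀ a b, K a → K b → g₂ a = g₂ b → a = b)
    (hNg₂ : ∀ k, N₂ * g₂ k = l * k) (n : ℕ) : ∃ e : Reg l n ≃ Reg l n, ∀ x,
      Bf K g₂ N₂ (e x).1.parts = Bf K g₁ N₁ x.1.parts := by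
  have h := Bf_card l hl K g₁ g₂ N₁ N₂ hN₁ hN₂ hK₁ hinj₁ hNg₁ hK₂ hinj₂ hNg₂ n
  exact ⟨Equiv.ofFiberEquiv (f := fun x : Reg l n => Bf K g₁ N₁ x.1.parts) (g := fun x : Reg l n => Bf K g₂ N₂ x.1.parts)
    (fun c => Fintype.equivOfCardEq (h c)), fun x => Equiv.ofFiberEquiv_map
    (f := fun x : Reg l n => Bf K g₁ N₁ x.1.parts) (g := fun x : Reg l n => Bf K g₂ N₂ x.1.parts) _ x⟩

end partE3

section partE4
variable (p : ℕ) [hp : Fact p.Prime]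

lemma piPart_ne (m : ℕ) (S : Finset ℕ) : piPart m S ≠ 0 := by
  rw [piPart, Finset.prod_ne_zero_iff]
  intro q hq
  exact pow_ne_zero _ (Nat.prime_of_mem_primeFactors (Finset.mem_filter.1 hq).1).ne_zero

lemma piPart_val (m : ℕ) (S : Finset ℕ) :
    padicValNat p (piPart m S) = if p ∈ S then padicValNat p m else 0 := by
  rw [← Nat.factorization_def _ hp.out, ← Nat.factorization_def _ hp.out, piPart, Nat.factorization_prod_apply]
  · have h1 : ∀ q ∈ m.primeFactors.filter (fun q => q ∈ S), (q ^ m.factorization q).factorization p =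
        if q = p then m.factorization q else 0 := by
      intro q hq
      have := Nat.prime_of_mem_primeFactors (Finset.mem_filter.1 hq).1
      rw [this.factorization_pow, Finsupp.single_apply]
    rw [Finset.sum_congr rfl h1, Finset.sum_ite_eq']
    simp only [Finset.mem_filter]
    by_cases hS : p ∈ S
    · by_cases hm : p ∈ m.primeFactors
      · simp [hS, hm]
      · rw [if_neg (fun h => hm h.1), if_pos hS]
        exact (Finsupp.notMem_support_iff.1 (by rwa [Nat.support_factorization])).symm
    · simp [hS]
  · intro q hq
    exact pow_ne_zero _ (Nat.prime_of_mem_primeFactors (Finset.mem_filter.1 hq).1).ne_zero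

lemma val_lgcd (r m' k : ℕ) (hpm : ¬ p ∣ m') (hk : k ≠ 0) :
    padicValNat p (p ^ r * m' / Nat.gcd (p ^ r * m') k) = r - padicValNat p k := by
  have hm : m' ≠ 0 := by rintro rfl; simp at hpm
  have hl : p ^ r * m' ≠ 0 := mul_ne_zero (pow_ne_zero _ hp.out.ne_zero) hm
  have h1 := val_pm p hp.out r m' hpm
  rw [← Nat.factorization_def _ hp.out] at h1 ⊢
  rw [Nat.factorization_div (Nat.gcd_dvd_left _ _), Finsupp.tsub_apply, Nat.factorization_gcd hl hk,
    Finsupp.inf_apply, h1, Nat.factorization_def _ hp.out]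
  omega

/-- `rEll` as a natural number. -/
def dL (l n : ℕ) (lam : Multiset ℕ) : ℕ :=
  ∏ k ∈ (Finset.range (n + 1)).filter (fun k => 0 < k),
    ((l / Nat.gcd l k) ^ (lam.count k / l) *
      piPart (Nat.factorial (lam.count k / l)) (Nat.primeFactors (l / Nat.gcd l k)))

lemma rEll_eq (l n : ℕ) (lam : Multiset ℕ) : rEll l n lam = (dL l n lam : ℚ) := by
  rw [rEll, dL, Nat.cast_prod]

lemma lgcd_ne (l k : ℕ) (hl : 0 < l) : l / Nat.gcd l k ≠ 0 :=
  (Nat.div_pos (Nat.le_of_dvd hl (Nat.gcd_dvd_left _ _)) (Nat.gcd_pos_of_pos_left _ hl)).ne'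

lemma dL_ne (l n : ℕ) (hl : 0 < l) (lam : Multiset ℕ) : dL l n lam ≠ 0 := by
  rw [dL, Finset.prod_ne_zero_iff]
  intro k _
  exact mul_ne_zero (pow_ne_zero _ (lgcd_ne l k hl)) (piPart_ne _ _)

/-- the regularity predicate at `p`. -/
def Kr (r k : ℕ) : Prop := k ≠ 0 ∧ ¬ p ^ r ∣ k

/-- valuation summand -/
def Ps (r k b : ℕ) : ℕ := (r - padicValNat p k) * b + padicValNat p b.factorial

lemma filt_eq (n : ℕ) : (Finset.range (n + 1)).filter (fun k => 0 < k) = Finset.Icc 1 n := by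
  ext k; simp only [Finset.mem_filter, Finset.mem_range, Finset.mem_Icc]; omega

lemma dL_val (r m' n : ℕ) (hpm : ¬ p ∣ m') (lam : Multiset ℕ) :
    padicValNat p (dL (p ^ r * m') n lam) =
      ∑ k ∈ Finset.Icc 1 n, Ps p r k (Bf (Kr p r) (fun k => k) (p ^ r * m') lam k) := by
  have hm : m' ≠ 0 := by rintro rfl; simp at hpm
  have hl : 0 < p ^ r * m' := Nat.pos_of_ne_zero (mul_ne_zero (pow_ne_zero _ hp.out.ne_zero) hm)
  rw [dL, filt_eq, ← Nat.factorization_def _ hp.out, Nat.factorization_prod_apply]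
  · refine Finset.sum_congr rfl fun k hk => ?_
    rw [Finset.mem_Icc] at hk
    have hk0 : k ≠ 0 := by omega
    rw [Nat.factorization_def _ hp.out, padicValNat.mul (pow_ne_zero _ (lgcd_ne _ k hl)) (piPart_ne _ _),
      padicValNat.pow, piPart_val, val_lgcd p r m' k hpm hk0]
    have hmem : p ∈ (p ^ r * m' / Nat.gcd (p ^ r * m') k).primeFactors ↔ padicValNat p k < r := by
      rw [← Nat.support_factorization, Finsupp.mem_support_iff, Nat.factorization_def _ hp.out, val_lgcd p r m' k hpm hk0]
      omega
    have hdv := padicValNat_dvd_iff_le (p := p) (n := r) hk0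
    by_cases h : padicValNat p k < r
    · have hK : Kr p r k := ⟨hk0, fun h' => by have := hdv.1 h'; omega⟩
      simp only [Ps, Bf, if_pos hK, if_pos (hmem.2 h)]
      ring
    · have hK : ¬ Kr p r k := fun h' => h'.2 (hdv.2 (by omega))
      simp only [Ps, Bf, if_neg hK, if_neg (fun h' => h (hmem.1 h'))]
      rw [Nat.sub_eq_zero_of_le (by omega)]
      simp
  · intro k _
    exact mul_ne_zero (pow_ne_zero _ (lgcd_ne _ k hl)) (piPart_ne _ _)

lemma Xw_val (r m' n : ℕ) (hpm : ¬ p ∣ m') (x : Reg (p ^ r * m') n) :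
    Xw p r m' x.1.parts = ∑ k ∈ Finset.Icc 1 n, Ps p r k (Bf (Kr p r) (fun k => m' * k) (p ^ r) x.1.parts k) := by
  have hm : m' ≠ 0 := by rintro rfl; simp at hpm
  rw [Xw, toFinset_sum x.1 (Xe p r m') (Xe_zero p r m')]
  have h1 := reindex n m' hm (fun _ => 1) (fun M => Xe p r m' M (x.1.parts.count M)) (by
    intro M hM
    have h2 : x.1.parts.count M = 0 := by
      have := count_le_n x.1 M (by omega)
      by_contra h
      have : 1 * M ≤ x.1.parts.count M * M := Nat.mul_le_mul_right _ (by omega)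
      omega
    simp only [h2, Xe_zero])
  simp only [one_mul] at h1
  have h2 : ∀ M ∈ Finset.Icc 1 n, (if m' ∣ M then 1 else 0) * Xe p r m' M (x.1.parts.count M) = Xe p r m' M (x.1.parts.count M) := by
    intro M _
    split_ifs with h
    · rw [one_mul]
    · simp [Xe, h]
  rw [Finset.sum_congr rfl h2] at h1
  rw [← h1]
  refine Finset.sum_congr rfl fun k hk => ?_
  rw [Finset.mem_Icc] at hk
  have hk0 : k ≠ 0 := by omega
  by_cases hK : Kr p r k
  · simp only [Ps, Bf, if_pos hK, Xe, if_pos (dvd_mul_right m' k)]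
    rw [padicValNat.mul hm hk0, padicValNat.eq_zero_of_not_dvd hpm, zero_add]
  · have hd : p ^ r ∣ k := by
      by_contra h; exact hK ⟨hk0, h⟩
    rw [Reg_count_zero x (m' * k) (by rw [mul_comm]; exact mul_dvd_mul_left m' hd), Xe_zero]
    simp [Ps, Bf, hK]

lemma stat_equiv (r m' n : ℕ) (hpm : ¬ p ∣ m') : ∃ e : Reg (p ^ r * m') n ≃ Reg (p ^ r * m') n, ∀ x,
    padicNorm p ((p : ℚ) ^ Xw p r m' x.1.parts) = padicNorm p (dL (p ^ r * m') n (e x).1.parts : ℚ) := by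
  have hm : m' ≠ 0 := by rintro rfl; simp at hpm
  have hq : 0 < p ^ r := Nat.pos_of_ne_zero (pow_ne_zero _ hp.out.ne_zero)
  have hl : 0 < p ^ r * m' := Nat.mul_pos hq (Nat.pos_of_ne_zero hm)
  obtain ⟨e, he⟩ := Bf_equiv (p ^ r * m') hl (Kr p r) (fun k => m' * k) (fun k => k) (p ^ r) (p ^ r * m') hq hl
    (fun k hk => ⟨hk.1, Nat.le_mul_of_pos_left _ (Nat.pos_of_ne_zero hm), fun h => hk.2 (by
      rw [mul_comm] at h; exact Nat.dvd_of_mul_dvd_mul_left (Nat.pos_of_ne_zero hm) h)⟩)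
    (fun a b _ _ h => Nat.eq_of_mul_eq_mul_left (Nat.pos_of_ne_zero hm) h) (fun k => by ring)
    (fun k hk => ⟨hk.1, le_rfl, fun h => hk.2 ((dvd_mul_right _ _).trans h)⟩) (fun a b _ _ h => h) (fun k => rfl) n
  refine ⟨e, fun x => ?_⟩
  have h1 : padicValNat p (dL (p ^ r * m') n (e x).1.parts) = Xw p r m' x.1.parts := by
    rw [dL_val p r m' n hpm, Xw_val p r m' n hpm]
    refine Finset.sum_congr rfl fun k _ => ?_
    rw [he]
  rw [padicNorm.eq_zpow_of_nonzero (p := p) (q := (dL (p ^ r * m') n (e x).1.parts : ℚ)) (by exact_mod_cast dL_ne _ n hl _), padicValRat.of_nat, h1,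
    padicNorm.eq_zpow_of_nonzero (pow_ne_zero _ (by exact_mod_cast hp.out.ne_zero)),
    padicValRat.pow, padicValRat.self hp.out.one_lt, mul_one]

end partE4

section partE5
open MvPolynomial (X C coeff pderiv monomial)
variable (p : ℕ) [hp : Fact p.Prime]

/-- Gram matrices. -/
def gram {G : Type*} [Group G] [Fintype G] {I J : Type*} (u : I → (G → ℚ)) (v : J → (G → ℚ)) : Matrix I J ℚ :=
  Matrix.of fun i j => sp (u i) (v j)

lemma gram_left {G : Type*} [Group G] [Fintype G] {I J L : Type*} [Fintype J] (u : I → (G → ℚ)) (v : J → (G → ℚ))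
    (w : L → (G → ℚ)) (A : Matrix I J ℚ) (h : ∀ i, u i = ∑ j, A i j • v j) : gram u w = A * gram v w := by
  ext i k
  rw [gram, Matrix.of_apply, h, ← spB_apply, map_sum, LinearMap.sum_apply, Matrix.mul_apply]
  refine Finset.sum_congr rfl fun j _ => ?_
  rw [map_smul, LinearMap.smul_apply, smul_eq_mul]; rfl

lemma gram_transpose {G : Type*} [Group G] [Fintype G] {I J : Type*} (u : I → (G → ℚ)) (v : J → (G → ℚ)) :
    (gram u v).transpose = gram v u := by
  ext i j
  exact sp_comm _ _

lemma gram_right {G : Type*} [Group G] [Fintype G] {I J L : Type*} [Fintype J] (u : I → (G → ℚ)) (v : J → (G → ℚ))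
    (w : L → (G → ℚ)) (A : Matrix I J ℚ) (h : ∀ i, u i = ∑ j, A i j • v j) : gram w u = gram w v * A.transpose := by
  rw [← gram_transpose, gram_left u v w A h, Matrix.transpose_mul, gram_transpose]

/-- length filtration -/
def FL (l L : ℕ) : Submodule ℚ UU :=
  Submodule.span ℚ {f | ∃ m : Multiset ℕ, (∀ k ∈ m, k ≠ 0 ∧ ¬ l ∣ k) ∧ L ≤ Multiset.card m ∧ f = xM p m}

lemma FL_mul (l L M : ℕ) (f g : UU) (hf : f ∈ FL p l L) (hg : g ∈ FL p l M) : f * g ∈ FL p l (L + M) := by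
  have h := Submodule.mul_mem_mul hf hg
  rw [FL, FL, Submodule.span_mul_span] at h
  refine Submodule.span_mono ?_ h
  rintro _ ⟨_, ⟨a, ha, hL, rfl⟩, _, ⟨b, hb, hM, rfl⟩, rfl⟩
  refine ⟨a + b, ?_, ?_, ?_⟩
  · intro k hk
    rcases Multiset.mem_add.1 hk with h | h
    · exact ha k h
    · exact hb k h
  · rw [Multiset.card_add]; omega
  · simp only [xM, Multiset.map_add, Multiset.prod_add]

lemma FL_anti (l L M : ℕ) (h : L ≤ M) : FL p l M ≤ FL p l L := by
  refine Submodule.span_mono ?_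
  rintro _ ⟨a, ha, hL, rfl⟩
  exact ⟨a, ha, h.trans hL, rfl⟩

lemma FL_xM (l : ℕ) (m : Multiset ℕ) (h : ∀ k ∈ m, k ≠ 0 ∧ ¬ l ∣ k) : xM p m ∈ FL p l (Multiset.card m) :=
  Submodule.subset_span ⟨m, h, le_rfl, rfl⟩

lemma pow_mul_smul (t : ℕ) (f : UU) : (p : UU) ^ t * f = ((p : ℚ) ^ t) • f := by
  rw [MvPolynomial.smul_eq_C_mul, map_pow, map_natCast]

lemma FL_X (l k : ℕ) (hk : k ≠ 0) (hl : ¬ l ∣ k) :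
    (X k : UU) - ((p : ℚ) ^ padicValNat p k) • xk p k ∈ FL p l 2 := by
  obtain ⟨j, s, hj, hj0, rfl⟩ := exists_js p k hk
  have hv : padicValNat p (j * p ^ s) = s := by rw [mul_comm]; exact val_pm p hp.out s j hj
  rw [hv, xk_mul p j s hj, xx_ghost, Finset.sum_range_succ, Nat.sub_self, pow_zero, pow_one, pow_mul_smul, add_sub_cancel_right]
  refine Submodule.sum_mem _ fun t ht => ?_
  rw [Finset.mem_range] at ht
  rw [pow_mul_smul]
  refine Submodule.smul_mem _ _ (Submodule.subset_span ⟨Multiset.replicate (p ^ (s - t)) (j * p ^ t), ?_, ?_, ?_⟩)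
  · intro k hk
    rw [Multiset.eq_of_mem_replicate hk]
    exact ⟨mul_ne_zero hj0 (pow_ne_zero _ hp.out.ne_zero), fun h => hl (h.trans (mul_dvd_mul_left j (pow_dvd_pow p ht.le)))⟩
  · rw [Multiset.card_replicate]
    calc 2 ≤ p := hp.out.two_le
      _ = p ^ 1 := (pow_one p).symm
      _ ≤ p ^ (s - t) := Nat.pow_le_pow_right hp.out.pos (by omega)
  · rw [xM, Multiset.map_replicate, Multiset.prod_replicate, xk_mul p j t hj]

lemma FL_prod (l : ℕ) (m : Multiset ℕ) (h : ∀ k ∈ m, k ≠ 0 ∧ ¬ l ∣ k) :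
    (m.map X).prod - ((p : ℚ) ^ (m.map (padicValNat p)).sum) • xM p m ∈ FL p l (Multiset.card m + 1) := by
  induction m using Multiset.induction_on with
  | empty => simp [xM]
  | cons k m ih =>
    have h1 : ∀ k ∈ m, k ≠ 0 ∧ ¬ l ∣ k := fun j hj => h j (Multiset.mem_cons_of_mem hj)
    have hk := h k (Multiset.mem_cons_self k m)
    have ih := ih h1
    have hf := FL_X p l k hk.1 hk.2
    have hxk : xk p k ∈ FL p l 1 := by
      have := FL_xM p l {k} (by intro j hj; rw [Multiset.mem_singleton.1 hj]; exact hk)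
      simpa [xM] using this
    rw [Multiset.map_cons, Multiset.prod_cons, Multiset.map_cons, Multiset.sum_cons, Multiset.card_cons]
    have hx : xM p (k ::ₘ m) = xk p k * xM p m := by simp [xM]
    rw [hx]
    set P : UU := (m.map X).prod
    set S := (m.map (padicValNat p)).sum
    have hP : P ∈ FL p l (Multiset.card m) := by
      have h2 := FL_anti p l _ _ (Nat.le_succ _) ih
      have h3 := Submodule.add_mem _ h2 (Submodule.smul_mem _ ((p : ℚ) ^ S) (FL_xM p l m h1))
      rwa [sub_add_cancel] at h3
    have e : X k * P - ((p : ℚ) ^ (padicValNat p k + S)) • (xk p k * xM p m) =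
        (X k - ((p : ℚ) ^ padicValNat p k) • xk p k) * P +
        ((p : ℚ) ^ padicValNat p k) • (xk p k * (P - ((p : ℚ) ^ S) • xM p m)) := by
      simp only [MvPolynomial.smul_eq_C_mul, pow_add, map_mul]
      ring
    rw [e]
    refine Submodule.add_mem _ ?_ (Submodule.smul_mem _ _ ?_)
    · have := FL_mul p l _ _ _ _ hf hP
      rwa [show 2 + Multiset.card m = Multiset.card m + 1 + 1 by omega] at this
    · have := FL_mul p l _ _ _ _ hxk ih
      rwa [show 1 + (Multiset.card m + 1) = Multiset.card m + 1 + 1 by omega] at this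

lemma FL_expand (l n L : ℕ) (f : UU) (hf : f ∈ FL p l L) : ∃ c : Reg l n → ℚ,
    (∀ x, c x ≠ 0 → L ≤ Multiset.card x.1.parts) ∧ Phi n f = ∑ x, c x • Phi n (xM p x.1.parts) := by
  rw [FL] at hf
  induction hf using Submodule.span_induction with
  | mem x hx =>
    obtain ⟨m, hm, hL, rfl⟩ := hx
    by_cases hmn : m.sum = n
    · let μ : Reg l n := ⟨⟨m, fun {i} hi => Nat.pos_of_ne_zero (hm i hi).1, hmn⟩, fun j hj => (hm j hj).2⟩
      refine ⟨fun x => if x = μ then 1 else 0, ?_, ?_⟩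
      · intro x; simp only; split_ifs with h
        · intro _; rw [h]; exact hL
        · intro h; exact absurd rfl h
      · rw [Finset.sum_eq_single μ]
        · simp only []
          rw [if_pos trivial, one_smul]
        · intro x _ hx; simp only []; rw [if_neg hx, zero_smul]
        · simp
    · refine ⟨fun _ => 0, fun _ h => absurd rfl h, ?_⟩
      rw [xM, Phi_hom (hom_mprod m _ (fun k hk => hom_xk p k (hm k hk).1)) hmn]
      simp
  | zero => exact ⟨fun _ => 0, fun _ h => absurd rfl h, by simp⟩
  | add a b _ _ ha hb =>
    obtain ⟨c, h1, h2⟩ := ha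
    obtain ⟨d, h3, h4⟩ := hb
    refine ⟨fun x => c x + d x, fun x hx => ?_, ?_⟩
    · by_cases hc : c x = 0
      · exact h3 x (by intro hd; simp [hc, hd] at hx)
      · exact h1 x hc
    · simp only [add_smul, Finset.sum_add_distrib]
      rw [map_add, h2, h4]
  | smul k a _ ha =>
    obtain ⟨c, h1, h2⟩ := ha
    refine ⟨fun x => k * c x, fun x hx => h1 x (right_ne_zero_of_mul hx), ?_⟩
    rw [map_smul, h2, Finset.smul_sum]
    simp only [smul_smul]

lemma det_tri {I : Type*} [Fintype I] [DecidableEq I] (b : I → ℕ) (M : Matrix I I ℚ)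
    (h : ∀ i j, i ≠ j → b j ≤ b i → M i j = 0) : M.det = ∏ i, M i i := by
  have hb : M.BlockTriangular b := fun i j hij => h i j (by rintro rfl; exact lt_irrefl _ hij) hij.le
  rw [hb.det]
  have h1 : ∀ a, (M.toSquareBlock b a).det = ∏ i : {i // b i = a}, M i i := by
    intro a
    have : M.toSquareBlock b a = Matrix.diagonal fun i : {i // b i = a} => M i i := by
      ext i j
      rw [Matrix.diagonal_apply]
      split_ifs with hij
      · subst hij; rfl
      · exact h i j (fun e => hij (Subtype.ext e)) (by rw [i.2, j.2])
    rw [this, Matrix.det_diagonal]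
  rw [Finset.prod_congr rfl fun a _ => h1 a]
  rw [← Finset.prod_fiberwise_of_maps_to (g := b) (t := Finset.univ.image b) (fun i _ => Finset.mem_image_of_mem _ (Finset.mem_univ i))]
  refine Finset.prod_congr rfl fun a _ => ?_
  rw [Finset.prod_subtype (p := fun i => b i = a)]
  intro i; simp

lemma exists_C (l n : ℕ) : ∃ A : Matrix (Reg l n) (Reg l n) ℚ,
    (∀ x, Phi n ((x.1.parts.map X).prod) = ∑ y, A x y • Phi n (xM p y.1.parts)) ∧
    A.det = ∏ x : Reg l n, (p : ℚ) ^ (x.1.parts.map (padicValNat p)).sum := by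
  have h : ∀ x : Reg l n, ∃ c : Reg l n → ℚ, (∀ y, c y ≠ 0 → Multiset.card x.1.parts + 1 ≤ Multiset.card y.1.parts) ∧
      Phi n ((x.1.parts.map X).prod) = ((p : ℚ) ^ (x.1.parts.map (padicValNat p)).sum) • Phi n (xM p x.1.parts) +
        ∑ y, c y • Phi n (xM p y.1.parts) := by
    intro x
    obtain ⟨c, h1, h2⟩ := FL_expand p l n _ _ (FL_prod p l x.1.parts (fun j hj => ⟨(x.1.parts_pos hj).ne', x.2 j hj⟩))
    refine ⟨c, h1, ?_⟩
    rw [← h2, map_sub, map_smul]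
    abel
  choose c h1 h2 using h
  refine ⟨Matrix.of fun x y => (if x = y then (p : ℚ) ^ (x.1.parts.map (padicValNat p)).sum else 0) + c x y, ?_, ?_⟩
  · intro x
    rw [h2]
    simp only [Matrix.of_apply, add_smul, Finset.sum_add_distrib, ite_smul, zero_smul, Finset.sum_ite_eq, Finset.mem_univ, if_true]
  · rw [det_tri (fun x : Reg l n => Multiset.card x.1.parts)]
    · refine Finset.prod_congr rfl fun x _ => ?_
      have : c x x = 0 := by
        by_contra h; have := h1 x x h; omega
      simp [this]
    · intro x y hxy hle
      have : c x y = 0 := by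
        by_contra h; have := h1 x y h; omega
      simp [this, hxy]

lemma sp_X (n : ℕ) (x y : Nat.Partition n) : sp (Phi n ((x.parts.map X).prod)) (Phi n ((y.parts.map X).prod)) =
    if x = y then zF x.parts.toFinsupp else 0 := by
  rw [sp_Phi, ← monomial_toFinsupp, ← monomial_toFinsupp]
  simp only [MvPolynomial.coeff_monomial, EmbeddingLike.apply_eq_iff_eq]
  have e : ∀ a b : Nat.Partition n, a.parts = b.parts ↔ a = b := fun a b => Nat.Partition.ext_iff.symm
  simp only [e]
  rw [Finset.sum_eq_single x]
  · by_cases h : x = y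
    · subst h; simp
    · simp [h, Ne.symm h]
  · intro b _ hb
    simp [Ne.symm hb]
  · simp

lemma val_zMult (n : ℕ) (x : Nat.Partition n) : padicValNat p (zMult x.parts) =
    ∑ k ∈ Finset.Icc 1 n, padicValNat p k * x.parts.count k + ∑ k ∈ Finset.Icc 1 n, padicValNat p (x.parts.count k).factorial := by
  have hne : ∀ i ∈ x.parts.toFinset, i ^ x.parts.count i * (x.parts.count i).factorial ≠ 0 := by
    intro i hi
    exact mul_ne_zero (pow_ne_zero _ (x.parts_pos (Multiset.mem_toFinset.1 hi)).ne') (Nat.factorial_ne_zero _)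
  rw [zMult, ← Nat.factorization_def _ hp.out, Nat.factorization_prod_apply hne, ← Finset.sum_add_distrib,
    ← toFinset_sum x (fun k c => padicValNat p k * c + padicValNat p c.factorial) (by simp)]
  refine Finset.sum_congr rfl fun i hi => ?_
  have h0 := (x.parts_pos (Multiset.mem_toFinset.1 hi)).ne'
  rw [Nat.factorization_def _ hp.out, padicValNat.mul (pow_ne_zero _ h0) (Nat.factorial_ne_zero _), padicValNat.pow, mul_comm]

lemma zMult_ne (n : ℕ) (x : Nat.Partition n) : zMult x.parts ≠ 0 := by
  rw [zMult, Finset.prod_ne_zero_iff]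
  intro i hi
  exact mul_ne_zero (pow_ne_zero _ (x.parts_pos (Multiset.mem_toFinset.1 hi)).ne') (Nat.factorial_ne_zero _)

lemma zF_zMult (m : Multiset ℕ) : zF m.toFinsupp = (zMult m : ℚ) := by
  rw [zF_eq, zMult]; push_cast; rfl

lemma map_val_sum (n : ℕ) (x : Nat.Partition n) : (x.parts.map (padicValNat p)).sum =
    ∑ k ∈ Finset.Icc 1 n, padicValNat p k * x.parts.count k := by
  rw [← toFinset_sum x (fun k c => padicValNat p k * c) (by simp), Finset.sum_multiset_map_count]
  simp [mul_comm]

lemma norm_nat (a v : ℕ) (ha : a ≠ 0) (h : padicValNat p a = v) : padicNorm p (a : ℚ) = padicNorm p ((p : ℚ) ^ v) := by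
  rw [padicNorm.eq_zpow_of_nonzero (p := p) (q := (a : ℚ)) (by exact_mod_cast ha), padicValRat.of_nat, h,
    padicNorm.eq_zpow_of_nonzero (pow_ne_zero _ (by exact_mod_cast hp.out.ne_zero)),
    padicValRat.pow, padicValRat.self hp.out.one_lt, mul_one]

lemma det_Gx (r m' n : ℕ) (hpm : ¬ p ∣ m') :
    padicNorm p (gram (fun x : Reg (p ^ r * m') n => Phi n (xM p x.1.parts)) (fun x => Phi n (xM p x.1.parts))).det =
      padicNorm p (∏ x : Reg (p ^ r * m') n, (p : ℚ) ^ Xw p r m' x.1.parts) := by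
  set l := p ^ r * m' with hl
  obtain ⟨A, hA, hdet⟩ := exists_C p l n
  set v := fun x : Reg l n => Phi n (xM p x.1.parts)
  set u := fun x : Reg l n => Phi n ((x.1.parts.map X).prod)
  have e1 : gram u u = A * gram v v * A.transpose := by
    rw [gram_left u v u A hA, gram_right u v v A hA, Matrix.mul_assoc]
  have e2 : gram u u = Matrix.diagonal fun x : Reg l n => (zMult x.1.parts : ℚ) := by
    ext x y
    rw [gram, Matrix.of_apply, sp_X, Matrix.diagonal_apply, zF_zMult]
    simp only [Subtype.ext_iff]
  have e3 := congrArg Matrix.det (e2.symm.trans e1)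
  rw [Matrix.det_diagonal, Matrix.det_mul, Matrix.det_mul, Matrix.det_transpose, hdet, Finset.prod_pow_eq_pow_sum, ← Nat.cast_prod] at e3
  rw [Finset.prod_pow_eq_pow_sum]
  have hv := val_identity p r m' n hpm
  rw [← hl] at hv
  have hZ : padicValNat p (∏ x : Reg l n, zMult x.1.parts) =
      ∑ x : Reg l n, (x.1.parts.map (padicValNat p)).sum + ∑ x : Reg l n, Xw p r m' x.1.parts + ∑ x : Reg l n, (x.1.parts.map (padicValNat p)).sum := by
    rw [← Nat.factorization_def _ hp.out, Nat.factorization_prod_apply (fun x _ => zMult_ne n x.1),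
      Finset.sum_congr rfl fun x _ => (Nat.factorization_def _ hp.out).trans (val_zMult p n x.1), Finset.sum_add_distrib, hv]
    simp only [map_val_sum]
    ring
  have h4 := norm_nat p _ _ (Finset.prod_ne_zero_iff.2 fun (x : Reg l n) _ => zMult_ne n x.1) hZ
  rw [e3, pow_add, pow_add] at h4
  simp only [padicNorm.mul] at h4
  have hne : ∀ a : ℕ, padicNorm p ((p : ℚ) ^ a) ≠ 0 := fun a => padicNorm.nonzero (pow_ne_zero _ (by exact_mod_cast hp.out.ne_zero))
  exact mul_left_cancel₀ (hne _) (mul_right_cancel₀ (hne _) h4)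

end partE5

section partF1
open MvPolynomial (X C coeff pderiv monomial)
variable (p : ℕ) [hp : Fact p.Prime]

lemma det_mem_Kp {I : Type*} [Fintype I] [DecidableEq I] (M : Matrix I I ℚ) (h : ∀ i j, M i j ∈ Kp p) : M.det ∈ Kp p := by
  rw [Matrix.det_apply]
  refine Subring.sum_mem _ fun σ _ => ?_
  rw [Units.smul_def]
  exact Subring.zsmul_mem _ (Subring.prod_mem _ fun i _ => h _ _) _

lemma mul_mem_Kp {I J L : Type*} [Fintype J] (A : Matrix I J ℚ) (B : Matrix J L ℚ) (hA : ∀ i j, A i j ∈ Kp p)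
    (hB : ∀ i j, B i j ∈ Kp p) (i : I) (k : L) : (A * B) i k ∈ Kp p := by
  rw [Matrix.mul_apply]
  exact Subring.sum_mem _ fun j _ => Subring.mul_mem _ (hA _ _) (hB _ _)

lemma p_mem_Kp (z : ℚ) (hz : z ∈ Kp p) : padicNorm p (p * z) < 1 := by
  rw [padicNorm.mul]
  have h1 : padicNorm p (p : ℚ) < 1 := padicNorm.padicNorm_p_lt_one_of_prime
  have h2 : padicNorm p z ≤ 1 := hz
  have h3 := padicNorm.nonneg (p := p) (p : ℚ)
  nlinarith

lemma det_one_add {I : Type*} [Fintype I] [DecidableEq I] (M : Matrix I I ℚ) (h : ∀ i j, M i j ∈ Kp p) :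
    padicNorm p (1 + (p : ℚ) • M).det = 1 := by
  let M' : Matrix I I (Kp p) := Matrix.of fun i j => ⟨M i j, h i j⟩
  let I' : Ideal (Kp p) := Ideal.span {(p : Kp p)}
  have e1 : (1 + (p : Kp p) • M').map (Ideal.Quotient.mk I') = 1 := by
    ext i j
    have h0 : Ideal.Quotient.mk I' (p : Kp p) = 0 := Ideal.Quotient.eq_zero_iff_mem.2 (Ideal.mem_span_singleton_self _)
    simp only [Matrix.map_apply, Matrix.add_apply, Matrix.smul_apply, smul_eq_mul, map_add, map_mul, h0, zero_mul, add_zero]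
    rw [Matrix.one_apply, Matrix.one_apply]
    split_ifs <;> simp
  have e2 : Ideal.Quotient.mk I' (1 + (p : Kp p) • M').det = 1 := by
    rw [RingHom.map_det, RingHom.mapMatrix_apply, e1, Matrix.det_one]
  have e3 : (1 + (p : Kp p) • M').det - 1 ∈ I' := by
    rw [← Ideal.Quotient.eq_zero_iff_mem, map_sub, e2, map_one, sub_self]
  obtain ⟨z, hz⟩ := Ideal.mem_span_singleton'.1 e3
  have e4 : (1 + (p : ℚ) • M).det = 1 + p * (z : ℚ) := by
    have h1 : (1 + (p : ℚ) • M) = (Kp p).subtype.mapMatrix (1 + (p : Kp p) • M') := by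
      ext i j
      simp only [RingHom.mapMatrix_apply, Matrix.map_apply, Matrix.add_apply, Matrix.smul_apply, smul_eq_mul, map_add, map_mul, map_natCast]
      rw [Matrix.one_apply, Matrix.one_apply]
      split_ifs <;> simp [M']
    rw [h1, ← RingHom.map_det]
    have h2 : (1 + (p : Kp p) • M').det = 1 + z * p := by rw [hz]; ring
    rw [h2]
    simp [mul_comm]
  rw [e4, padicNorm.add_eq_max_of_ne, padicNorm.one]
  · exact max_eq_left (p_mem_Kp p _ z.2).le
  · rw [padicNorm.one]; exact (p_mem_Kp p _ z.2).ne'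

lemma norm_one_of_mul (a b : ℚ) (ha : a ∈ Kp p) (hb : b ∈ Kp p) (h : padicNorm p (a * b) = 1) : padicNorm p a = 1 := by
  rw [padicNorm.mul] at h
  have h1 : padicNorm p a ≤ 1 := ha
  have h2 : padicNorm p b ≤ 1 := hb
  have h3 := padicNorm.nonneg (p := p) a
  nlinarith [padicNorm.nonneg (p := p) b]

lemma exists_NQ (r m' n : ℕ) (hpm : ¬ p ∣ m') : ∃ N Q : Matrix (Reg (p ^ r * m') n) (Reg (p ^ r * m') n) ℚ,
    (∀ x y, N x y ∈ Kp p) ∧ (∀ x y, Q x y ∈ Kp p) ∧ padicNorm p N.det = 1 ∧ padicNorm p Q.det = 1 ∧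
    N * gram (fun x : Reg (p ^ r * m') n => Phi n (xM p x.1.parts)) (fun x => Phi n (xM p x.1.parts)) =
      Matrix.diagonal (fun x : Reg (p ^ r * m') n => (p : ℚ) ^ Xw p r m' x.1.parts) * Q := by
  have hd := det_Gx p r m' n hpm
  set l := p ^ r * m' with hl
  have hE : ∀ x : Reg l n, ∃ E ∈ Px p l, Cg (Rx p l) p (Xw p r m' x.1.parts) E ∧ Cg (Px p l) p 1 (E - xM p x.1.parts) :=
    fun x => exists_E p r m' hpm x.1.parts (fun j hj => ⟨(x.1.parts_pos hj).ne', x.2 j hj⟩)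
  choose E hEP hE1 hE2 using hE
  set v := fun x : Reg l n => Phi n (xM p x.1.parts) with hv
  have h1 : ∀ x : Reg l n, ∃ c : Reg l n → ℚ, (∀ y, c y ∈ Kp p) ∧ Phi n (E x) = v x + (p : ℚ) • ∑ y, c y • v y := by
    intro x
    obtain ⟨f, hf, h⟩ := hE2 x
    obtain ⟨c, hc, hc2⟩ := Px_expand p l n f hf
    refine ⟨c, hc, ?_⟩
    rw [← hc2, ← map_smul, hv, ← map_add]
    congr 1
    rw [pow_mul_smul, pow_one] at h
    rw [← h]; ring
  choose c hc hc2 using h1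
  have h2 : ∀ x : Reg l n, ∃ f ∈ Sx p, Phi n (E x) = ((p : ℚ) ^ Xw p r m' x.1.parts) • Phi n (piA l f) := by
    intro x
    obtain ⟨_, ⟨f, hf, rfl⟩, h⟩ := hE1 x
    refine ⟨f, hf, ?_⟩
    rw [h, pow_mul_smul, map_smul]; rfl
  choose D hD hD2 using h2
  let N : Matrix (Reg l n) (Reg l n) ℚ := 1 + (p : ℚ) • Matrix.of c
  let Q : Matrix (Reg l n) (Reg l n) ℚ := gram (fun x => Phi n (piA l (D x))) v
  have hpK : (p : ℚ) ∈ Kp p := by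
    exact_mod_cast natCast_mem (Kp p) p
  have hN : ∀ x y, N x y ∈ Kp p := by
    intro x y
    simp only [N, Matrix.add_apply, Matrix.smul_apply, Matrix.of_apply, smul_eq_mul]
    refine Subring.add_mem _ ?_ (Subring.mul_mem _ hpK (hc x y))
    rw [Matrix.one_apply]; split_ifs
    · exact Subring.one_mem _
    · exact Subring.zero_mem _
  have hQ : ∀ x y, Q x y ∈ Kp p := by
    intro x y
    have := sp_int p n (D x) (xM p y.1.parts) (hD x) (Px_le p l (xM_Reg p y))
    rwa [← sp_piA l n (D x) _ (piA_Px p l _ (xM_Reg p y))] at this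
  have hNd : padicNorm p N.det = 1 := det_one_add p _ hc
  have e1 : gram (fun x => Phi n (E x)) v = N * gram v v := by
    apply gram_left
    intro x
    rw [hc2]
    simp only [N, Matrix.add_apply, Matrix.smul_apply, Matrix.of_apply, smul_eq_mul, add_smul, Finset.sum_add_distrib, Matrix.one_apply,
      ite_smul, one_smul, zero_smul, Finset.sum_ite_eq, Finset.mem_univ, if_true, Finset.smul_sum, smul_smul]
  have e2 : gram (fun x => Phi n (E x)) v = Matrix.diagonal (fun x : Reg l n => (p : ℚ) ^ Xw p r m' x.1.parts) * Q := by
    apply gram_left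
    intro x
    rw [hD2]
    simp only [Matrix.diagonal_apply, ite_smul, zero_smul, Finset.sum_ite_eq, Finset.mem_univ, if_true]
  have e3 := e1.symm.trans e2
  refine ⟨N, Q, hN, hQ, hNd, ?_, e3⟩
  have e4 := congrArg (fun M => padicNorm p (Matrix.det M)) e3
  simp only [Matrix.det_mul, padicNorm.mul, Matrix.det_diagonal, hNd, one_mul] at e4
  rw [hd] at e4
  have hne : padicNorm p (∏ x : Reg l n, (p : ℚ) ^ Xw p r m' x.1.parts) ≠ 0 :=
    padicNorm.nonzero (Finset.prod_ne_zero_iff.2 fun x _ => pow_ne_zero _ (by exact_mod_cast hp.out.ne_zero))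
  exact (mul_left_cancel₀ hne (by rw [mul_one]; exact e4)).symm

lemma local_form (r m' n : ℕ) (hpm : ¬ p ∣ m') {T : Type*} [Fintype T] (bs : T → (Equiv.Perm (Fin n) → ℚ))
    (hb1 : LinearIndependent ℤ bs)
    (hb2 : Submodule.span ℤ (Set.range bs) = VirtCharS n ⊓ VanishSub (p ^ r * m') n) :
    ∃ (e : T ≃ Reg (p ^ r * m') n) (b : T → ℚ) (U V : Matrix T T ℚ),
      (∀ s t, padicNorm p (U s t) ≤ 1) ∧ (∀ s t, padicNorm p (V s t) ≤ 1) ∧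
      padicNorm p U.det = 1 ∧ padicNorm p V.det = 1 ∧
      (∀ s, padicNorm p (b s) = padicNorm p (dL (p ^ r * m') n (e s).1.parts : ℚ)) ∧
      U * gram bs bs = Matrix.diagonal b * V := by
  have hEx1 := exists_NQ p r m' n hpm
  have hEx2 := stat_equiv p r m' n hpm
  have hd := det_Gx p r m' n hpm
  set l := p ^ r * m' with hl
  obtain ⟨N, Q, hN, hQ, hNd, hQd, hNQ⟩ := hEx1
  obtain ⟨e, he⟩ := hEx2
  set v := fun x : Reg l n => Phi n (xM p x.1.parts) with hv
  have hG : IsUnit (gram v v).det := by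
    rw [isUnit_iff_ne_zero]
    intro h0
    rw [h0, padicNorm.zero] at hd
    exact padicNorm.nonzero (Finset.prod_ne_zero_iff.2 fun x _ => pow_ne_zero _ (by exact_mod_cast hp.out.ne_zero)) hd.symm
  have h1 : ∀ t, ∃ c : Reg l n → ℚ, (∀ y, c y ∈ Kp p) ∧ bs t = ∑ y, c y • v y := by
    intro t
    have ht : bs t ∈ VirtCharS n ⊓ VanishSub l n := by rw [← hb2]; exact Submodule.subset_span ⟨t, rfl⟩
    obtain ⟨f, hf, h⟩ := virt_vanish p l n (bs t) ht.1 ht.2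
    rw [h]
    exact Px_expand p l n f hf
  choose a ha ha2 using h1
  have h2 : ∀ x : Reg l n, ∃ c : T → ℚ, (∀ t, c t ∈ Kp p) ∧ v x = ∑ t, c t • bs t := by
    intro x
    obtain ⟨M, hM, h⟩ := Px_virt p l n (xM p x.1.parts) (xM_Reg p x)
    rw [← hb2, Submodule.mem_span_range_iff_exists_fun] at h
    obtain ⟨c, hc⟩ := h
    have hM0 : (M : ℚ) ≠ 0 := by
      intro h0
      have : M = 0 := by exact_mod_cast h0
      rw [this] at hM; simp at hM
    refine ⟨fun t => (M : ℚ)⁻¹ * c t, fun t => Subring.mul_mem _ (inv_mem_Kp p M hM) (intCast_mem (Kp p) (c t)), ?_⟩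
    simp only [mul_smul]
    rw [← Finset.smul_sum]
    have h3 : ∑ t, (c t : ℚ) • bs t = (M : ℚ) • v x := by
      simp only [Int.cast_smul_eq_zsmul]
      rw [hc, ← Int.cast_smul_eq_zsmul ℚ]
      simp [hv]
    rw [h3, smul_smul, inv_mul_cancel₀ hM0, one_smul]
  choose a' ha' ha'2 using h2
  let A : Matrix T (Reg l n) ℚ := Matrix.of a
  let A' : Matrix (Reg l n) T ℚ := Matrix.of a'
  have hA'A : A' * A = 1 := by
    have h3 : A' * A * gram v v = gram v v := by
      rw [Matrix.mul_assoc, ← gram_left bs v v A ha2, ← gram_left v bs v A' ha'2]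
    have h4 := congrArg (fun M => M * (gram v v)⁻¹) h3
    simp only [Matrix.mul_assoc, Matrix.mul_nonsing_inv _ hG, Matrix.mul_one] at h4
    exact h4
  have hAA' : A * A' = 1 := by
    have hbQ : LinearIndependent ℚ bs := (LinearIndependent.iff_fractionRing ℤ ℚ).1 hb1
    ext t s
    have h3 : ∑ s, (A * A') t s • bs s = ∑ s, (1 : Matrix T T ℚ) t s • bs s := by
      simp only [Matrix.mul_apply, Finset.sum_smul, mul_smul, Matrix.one_apply, ite_smul, one_smul, zero_smul, Finset.sum_ite_eq, Finset.mem_univ, if_true]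
      rw [Finset.sum_comm, ha2 t]
      refine Finset.sum_congr rfl fun x _ => ?_
      rw [ha'2 x, Finset.smul_sum]; rfl
    have h4 : ∑ s, ((A * A') t s - (1 : Matrix T T ℚ) t s) • bs s = 0 := by
      simp only [sub_smul, Finset.sum_sub_distrib, h3, sub_self]
    exact sub_eq_zero.1 (Fintype.linearIndependent_iff.1 hbQ _ h4 s)
  have hcard : Fintype.card T = Fintype.card (Reg l n) := Matrix.square_of_invertible A A' hAA' hA'A
  let e0 : T ≃ Reg l n := Fintype.equivOfCardEq hcard
  have hB1 : padicNorm p (A'.submatrix e0 id).det = 1 ∧ padicNorm p (A.submatrix id e0).det = 1 := by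
    have h3 : (A'.submatrix e0 id) * (A.submatrix id e0) = 1 := by
      have h3' := Matrix.submatrix_mul_equiv A' A e0 (Equiv.refl T) e0
      rw [hA'A, Matrix.submatrix_one_equiv] at h3'
      exact h3'
    have h4 := congrArg (fun M => padicNorm p (Matrix.det M)) h3
    simp only [Matrix.det_mul, Matrix.det_one, padicNorm.one] at h4
    have h5 := det_mem_Kp p (A'.submatrix e0 id) (fun i j => ha' _ _)
    have h6 := det_mem_Kp p (A.submatrix id e0) (fun i j => ha _ _)
    exact ⟨norm_one_of_mul p _ _ h5 h6 h4, norm_one_of_mul p _ _ h6 h5 (by rw [mul_comm]; exact h4)⟩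
  refine ⟨e0.trans e, fun t => (p : ℚ) ^ Xw p r m' (e0 t).1.parts, (N * A').submatrix e0 id, (Q * A.transpose).submatrix e0 id,
    fun s t => mul_mem_Kp p N A' hN (fun i j => ha' _ _) _ _, fun s t => mul_mem_Kp p Q _ hQ (fun i j => ha _ _) _ _, ?_, ?_, fun s => he _, ?_⟩
  · have : (N * A').submatrix e0 id = N.submatrix e0 e0 * A'.submatrix e0 id := (Matrix.submatrix_mul_equiv N A' e0 e0 id).symm
    rw [this, Matrix.det_mul, padicNorm.mul, Matrix.det_submatrix_equiv_self, hNd, hB1.1, one_mul]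
  · have : (Q * A.transpose).submatrix e0 id = Q.submatrix e0 e0 * A.transpose.submatrix e0 id := (Matrix.submatrix_mul_equiv Q A.transpose e0 e0 id).symm
    have h7 : A.transpose.submatrix e0 id = (A.submatrix id e0).transpose := rfl
    rw [this, Matrix.det_mul, padicNorm.mul, Matrix.det_submatrix_equiv_self, hQd, h7, Matrix.det_transpose, hB1.2, one_mul]
  · have h8 : N * A' * gram bs bs = Matrix.diagonal (fun x : Reg l n => (p : ℚ) ^ Xw p r m' x.1.parts) * (Q * A.transpose) := by
      rw [← Matrix.mul_assoc, ← hNQ, Matrix.mul_assoc, ← gram_left v bs bs A' ha'2, gram_right bs v v A ha2, Matrix.mul_assoc]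
    have h9 := congrArg (fun M => Matrix.submatrix M e0 (id : T → T)) h8
    ext s t
    have h10 := congrFun (congrFun h9 s) t
    simp only [Matrix.submatrix_apply, Matrix.diagonal_mul, id] at h10 ⊢
    rw [← h10]
    rfl

end partF1

/-- **Corollary (Külshammer–Olsson–Robinson conjecture).**
For `ℓ, n ∈ ℕ`, the Cartan matrix `Cart_ℓ(n)` — the Gram matrix of any `ℤ`-basis of
`𝒫(S_n)`, the group of virtual characters of `S_n` vanishing on all `ℓ`-singular elements —
is equivalent over `ℤ` to the diagonal matrix with entries `r_ℓ(λ)`, where `λ` runs over the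
partitions of `n` none of whose parts is divisible by `ℓ`. -/
theorem cartan_invariant_factors (l n : ℕ) (hl : 1 ≤ l)
    {T : Type*} [Fintype T] (bs : T → (Equiv.Perm (Fin n) → ℚ))
    (hb1 : LinearIndependent ℤ bs)
    (hb2 : Submodule.span ℤ (Set.range bs) = VirtCharS n ⊓ VanishSub l n) :
    IntEquiv (Matrix.of fun t q => sp (bs t) (bs q))
      (Matrix.diagonal
        (fun lam : {lam : Nat.Partition n // ∀ j ∈ lam.parts, ¬ l ∣ j} =>
          rEll l n lam.1.parts)) := by
  have hzex : ∀ t q, ∃ z : ℤ, sp (bs t) (bs q) = (z : ℚ) := by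
    intro t q
    have hden : (sp (bs t) (bs q)).den = 1 := by
      by_contra hne
      obtain ⟨p, hp, hpd⟩ := Nat.exists_prime_and_dvd hne
      haveI := Fact.mk hp
      have hmem : ∀ s, bs s ∈ VirtCharS n ⊓ VanishSub l n := fun s => by
        rw [← hb2]; exact Submodule.subset_span ⟨s, rfl⟩
      obtain ⟨f, hf, h1⟩ := virt_vanish p l n (bs t) (hmem t).1 (hmem t).2
      obtain ⟨g, hg, h2⟩ := virt_vanish p l n (bs q) (hmem q).1 (hmem q).2
      have h3 := sp_int p n f g (Px_le p l hf) (Px_le p l hg)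
      rw [← h1, ← h2] at h3
      exact mem_Kp_iff_den p h3 hpd
    exact ⟨(sp (bs t) (bs q)).num, (Rat.coe_int_num_of_den_eq_one hden).symm⟩
  choose z hz using hzex
  have hG0 : (Matrix.of z).map (fun x : ℤ => (x : ℚ)) = gram bs bs := by
    ext t q
    exact (hz t q).symm
  have key := partA (Matrix.of z) (fun x : Reg l n => dL l n x.1.parts) (fun x => dL_ne l n hl x.1.parts) (by
    intro p hp
    haveI := Fact.mk hp
    rw [hG0]
    clear hG0 hz z
    obtain ⟨r, m', hpm, h⟩ := Nat.exists_eq_pow_mul_and_not_dvd (show l ≠ 0 by omega) p hp.ne_one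
    subst h
    exact local_form p r m' n hpm bs hb1 hb2)
  rw [hG0] at key
  simp only [rEll_eq]
  change IntEquiv (gram bs bs) _
  convert key


end
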